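/- Let A be a unital C*-algebra such that there is no surjective *-algebra homomorphism from A onto the C*-algebra M₂(ℂ) of 2×2 complex matrices. Let μ : A → ℝ be a function which is bounded on the set of self-adjoint elements of the closed unit ball of A and such that, for every self-adjoint a ∈ A, the restriction of μ to the norm closure of the non-unital subalgebra of A generated by a address is additive and ℝ-homogeneous. Then the following are equivalent: (i) there exists a bounded ℝ-linear functional φ : A → ℝ with φ(a) = μ(a) for every self-adjoint a ∈ A; (ii) μ is uniformly weakly continuous on the self-adjoint part of the closed unit ball of A, i.e. for every ε > 0 there exist δ > 0 and finitely many continuous ℝ-linear functionals f₁, …, fₘ on A such that for all self-adjoint a, b in the closed unit ball of A with |fᵢ(a) − fᵢ(b)| < δ for all i, one has |μ(a) − μ(b)| < ε. -/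

import Mathlib

open scoped InnerProductSpace ComplexStarModule

open MeasureTheory
open scoped InnerProductSpace

theorem affine_of_additive_of_bounded {κ : ℝ → ℝ} {C : ℝ}
    (hC : ∀ t, 0 ≤ t → t ≤ 1 → |κ t| ≤ C)
    (hadd : ∀ a b, 0 ≤ a → 0 ≤ b → a + b ≤ 1 → κ a + κ b = κ (a + b) + κ 0)
    {t : ℝ} (h0 : 0 ≤ t) (h1 : t ≤ 1) : κ t = κ 0 + t * (κ 1 - κ 0) := by
  set d : ℝ → ℝ := fun t => κ t - κ 0 - t * (κ 1 - κ 0) with hd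
  have dadd : ∀ a b, 0 ≤ a → 0 ≤ b → a + b ≤ 1 → d (a + b) = d a + d b := by
    intro a b ha hb hab
    have := hadd a b ha hb hab
    simp only [hd]; linarith
  have dmul : ∀ (r : ℝ), 0 ≤ r → ∀ N : ℕ, N * r ≤ 1 → d (N * r) = N * d r := by
    intro r hr N
    induction N with
    | zero => intro _; simp [hd]
    | succ N ih =>
      intro h
      push_cast at h ⊢
      have : (0 : ℝ) ≤ N * r := by positivity
      rw [add_mul, one_mul, dadd _ _ this hr (by linarith), ih (by linarith)]
      ring
  have dbd : ∀ t, 0 ≤ t → t ≤ 1 → |d t| ≤ 4 * C := by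
    intro t h0 h1
    have e1 := abs_le.1 (hC t h0 h1)
    have e2 := abs_le.1 (hC 0 le_rfl zero_le_one)
    have e3 := abs_le.1 (hC 1 zero_le_one le_rfl)
    simp only [hd]
    rw [abs_le]
    constructor <;> nlinarith
  have d1 : d 1 = 0 := by simp [hd]
  have key : ∀ N : ℕ, 0 < N → |d t| * N ≤ 4 * C := by
    intro N hN
    have hN' : (0 : ℝ) < N := by exact_mod_cast hN
    set k := ⌊t * N⌋₊
    have hk1 : (k : ℝ) ≤ t * N := Nat.floor_le (by positivity)
    have hk2 : t * N < k + 1 := Nat.lt_floor_add_one _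
    set r := t - k * (1 / N) with hr
    have r0 : 0 ≤ r := by
      rw [hr, sub_nonneg, mul_one_div, div_le_iff₀ hN']; exact hk1
    have r1 : N * r ≤ 1 := by
      have : N * r = t * N - k := by rw [hr]; field_simp
      linarith
    have hN1 : d (1 / N) = 0 := by
      have := dmul (1 / N) (by positivity) N (by field_simp; exact le_rfl)
      rw [mul_one_div_cancel hN'.ne', d1] at this
      rcases mul_eq_zero.1 this.symm with h | h
      · exact absurd h hN'.ne'
      · exact h
    have hdt : d t = d r := by
      have e : t = k * (1 / N) + r := by rw [hr]; ring
      have k0 : (0 : ℝ) ≤ k * (1 / N) := by positivity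
      conv_lhs => rw [e]
      rw [dadd _ _ k0 r0 (by linarith), dmul _ (by positivity) _ (by linarith), hN1]
      ring
    have := dmul r r0 N r1
    have hb := dbd (N * r) (by positivity) r1
    rw [this, abs_mul, abs_of_pos hN'] at hb
    rw [hdt]; linarith
  have hdt : d t = 0 := by
    by_contra hne
    have hpos : 0 < |d t| := abs_pos.2 hne
    obtain ⟨N, hN⟩ := exists_nat_gt (4 * C / |d t|)
    rw [div_lt_iff₀ hpos] at hN
    have := key (N + 1) (Nat.succ_pos _)
    push_cast at this
    nlinarith
  simp only [hd] at hdt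
  linarith

section Sphere
variable {E : Type*} [NormedAddCommGroup E] [InnerProductSpace ℂ E]

theorem exists_orthonormalBasis_extending_pair [FiniteDimensional ℂ E] {n : ℕ}
    (hn : Module.finrank ℂ E = n + 2) {p e : E} (hp : ‖p‖ = 1) (he : ‖e‖ = 1)
    (hpe : ⟪p, e⟫_ℂ = 0) :
    ∃ b : OrthonormalBasis (Fin (n + 2)) ℂ E, b 0 = p ∧ b 1 = e := by
  classical
  have hv : Orthonormal ℂ (({0, 1} : Set (Fin (n+2))).domRestrict (fun i => if i = 0 then p else e)) := by
    constructor
    · rintro ⟨i, hi⟩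
      simp only [Set.domRestrict_apply]
      split_ifs <;> assumption
    · rintro ⟨i, hi⟩ ⟨j, hj⟩ hij
      have hij' : i ≠ j := fun h => hij (Subtype.ext h)
      simp only [Set.domRestrict_apply]
      rcases hi with rfl | hi <;> rcases hj with rfl | hj
      · exact absurd rfl hij'
      · simp at hj; subst hj; simpa using hpe
      · simp at hi; subst hi; simpa using inner_eq_zero_symm.1 hpe
      · simp at hi hj; exact absurd (hi.trans hj.symm) hij'
  obtain ⟨b, hb⟩ := hv.exists_orthonormalBasis_extension_of_card_eq (by simp [hn])
  exact ⟨b, by simpa using hb 0 (by simp), by simpa using hb 1 (by simp)⟩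

theorem exists_unitary_map_pair [FiniteDimensional ℂ E] {n : ℕ}
    (b : OrthonormalBasis (Fin (n + 2)) ℂ E) {p e : E} (hp : ‖p‖ = 1) (he : ‖e‖ = 1)
    (hpe : ⟪p, e⟫_ℂ = 0) :
    ∃ g : unitary (E →L[ℂ] E), (g : E →L[ℂ] E) (b 0) = p ∧ (g : E →L[ℂ] E) (b 1) = e := by
  have hn : Module.finrank ℂ E = n + 2 := by
    simpa using Module.finrank_eq_card_basis b.toBasis
  obtain ⟨b', h0, h1⟩ := exists_orthonormalBasis_extending_pair hn hp he hpe
  refine ⟨Unitary.linearIsometryEquiv.symm (b.equiv b' (Equiv.refl _)), ?_, ?_⟩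
  · rw [Unitary.coe_symm_linearIsometryEquiv_apply]
    simp [h0]
  · rw [Unitary.coe_symm_linearIsometryEquiv_apply]
    simp [h1]

theorem exists_orthogonal_decomp [FiniteDimensional ℂ E]
    (hn : 2 ≤ Module.finrank ℂ E) {p s : E} (hp : ‖p‖ = 1) (hs : ‖s‖ = 1) :
    ∃ (c : ℂ) (e : E), ‖c‖ = 1 ∧ ‖e‖ = 1 ∧ ⟪p, e⟫_ℂ = 0 ∧
      s = c • ((‖⟪p, s⟫_ℂ‖ : ℂ) • p + ((Real.sqrt (1 - ‖⟪p, s⟫_ℂ‖ ^ 2) : ℝ) : ℂ) • e) := by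
  set α := ⟪p, s⟫_ℂ with hα
  have hpp : ⟪p, p⟫_ℂ = 1 := by simp [inner_self_eq_norm_sq_to_K, hp]
  obtain ⟨c, hc, hcα⟩ : ∃ c : ℂ, ‖c‖ = 1 ∧ c * (‖α‖ : ℂ) = α := by
    by_cases h : α = 0
    · exact ⟨1, by simp, by simp [h]⟩
    · have : (‖α‖ : ℂ) ≠ 0 := by simpa using h
      exact ⟨α / ‖α‖, by simp [h], by field_simp⟩
  have hc0 : c ≠ 0 := by rintro rfl; simp at hc
  set r := s - α • p with hr
  have hpr : ⟪p, r⟫_ℂ = 0 := by rw [hr, inner_sub_right, inner_smul_right, hpp, ← hα]; simp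
  have hrn : ‖r‖ ^ 2 = 1 - ‖α‖ ^ 2 := by
    have hs' : s = α • p + r := by rw [hr]; abel
    have := norm_add_sq_eq_norm_sq_add_norm_sq_of_inner_eq_zero (𝕜 := ℂ) (α • p) r (by rw [inner_smul_left, hpr, mul_zero])
    rw [← hs', hs, norm_smul, hp] at this
    nlinarith
  have hsq : Real.sqrt (1 - ‖α‖ ^ 2) = ‖r‖ := by
    rw [← hrn, Real.sqrt_sq (norm_nonneg _)]
  rw [hsq]
  by_cases hr0 : r = 0
  · obtain ⟨e, he1, he2⟩ : ∃ e : E, ‖e‖ = 1 ∧ ⟪p, e⟫_ℂ = 0 := by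
      obtain ⟨n, hn'⟩ : ∃ n, Module.finrank ℂ E = n + 2 := ⟨_, (Nat.sub_add_cancel hn).symm⟩
      have : Orthonormal ℂ (({0} : Set (Fin (n+2))).domRestrict (fun _ => p)) := by
        constructor
        · intro i; simp [hp]
        · rintro ⟨i, hi⟩ ⟨j, hj⟩ hij
          simp only [Set.mem_singleton_iff] at hi hj
          exact absurd (Subtype.ext (hi.trans hj.symm)) hij
      obtain ⟨b, hb⟩ := this.exists_orthonormalBasis_extension_of_card_eq (by simp [hn'])
      refine ⟨b 1, b.orthonormal.1 1, ?_⟩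
      rw [← hb 0 (by simp)]
      exact b.orthonormal.2 (by simp)
    refine ⟨c, e, hc, he1, he2, ?_⟩
    rw [hr0, smul_add, smul_smul, hcα]
    simp
    exact sub_eq_zero.1 (hr ▸ hr0)
  · have hrn0 : (‖r‖ : ℂ) ≠ 0 := by simpa using hr0
    refine ⟨c, (c⁻¹ * (‖r‖ : ℂ)⁻¹) • r, hc, ?_, by rw [inner_smul_right, hpr, mul_zero], ?_⟩
    · rw [norm_smul, norm_mul, norm_inv, norm_inv, hc]; simp [hr0]
    · rw [smul_add, smul_smul, smul_smul, smul_smul, hcα,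
        show c * (‖r‖ : ℂ) * (c⁻¹ * (‖r‖ : ℂ)⁻¹) = 1 by field_simp, one_smul, hr]
      abel


theorem exists_haar_probability (G : Type*) [Group G] [TopologicalSpace G] [IsTopologicalGroup G]
    [CompactSpace G] [MeasurableSpace G] [BorelSpace G] :
    ∃ ν : Measure G, IsProbabilityMeasure ν ∧ ν.IsMulLeftInvariant ∧ ν.IsOpenPosMeasure := by
  let K : TopologicalSpace.PositiveCompacts G := ⊤
  refine ⟨Measure.haarMeasure K, ⟨?_⟩, inferInstance, inferInstance⟩
  have := Measure.haarMeasure_self (K₀ := K)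
  simpa [K] using this

theorem finrank_of_orthonormalBasis {n : ℕ} (b : OrthonormalBasis (Fin n) ℂ E) :
    Module.finrank ℂ E = n := by
  simpa using Module.finrank_eq_card_basis b.toBasis

theorem norm_smul_add_smul_eq_one {e f : E} (he : ‖e‖ = 1) (hf : ‖f‖ = 1)
    (hef : ⟪e, f⟫_ℂ = 0) {t : ℝ} (h0 : 0 ≤ t) (h1 : t ≤ 1) :
    ‖((Real.sqrt t : ℝ) : ℂ) • e + ((Real.sqrt (1 - t) : ℝ) : ℂ) • f‖ = 1 := by
  have := norm_add_sq_eq_norm_sq_add_norm_sq_of_inner_eq_zero (𝕜 := ℂ)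
    (((Real.sqrt t : ℝ) : ℂ) • e) (((Real.sqrt (1 - t) : ℝ) : ℂ) • f)
    (by rw [inner_smul_left, inner_smul_right, hef]; simp)
  rw [norm_smul, norm_smul, he, hf] at this
  simp only [Complex.norm_real, Real.norm_eq_abs, mul_one, abs_mul_abs_self] at this
  rw [Real.mul_self_sqrt h0, Real.mul_self_sqrt (by linarith), ← sq] at this
  nlinarith [norm_nonneg (((Real.sqrt t : ℝ) : ℂ) • e + ((Real.sqrt (1 - t) : ℝ) : ℂ) • f)]

theorem sum_re_inner_rankOne {n : ℕ} (b : OrthonormalBasis (Fin n) ℂ E) (v : E) :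
    ∑ i, (⟪b i, InnerProductSpace.rankOne ℂ v v (b i)⟫_ℂ).re = ‖v‖ ^ 2 := by
  rw [← b.sum_sq_norm_inner_right v]
  refine Finset.sum_congr rfl fun i _ => ?_
  rw [InnerProductSpace.rankOne_apply, inner_smul_right, ← inner_conj_symm, mul_comm,
    Complex.mul_conj, Complex.normSq_eq_norm_sq]
  norm_cast

variable [FiniteDimensional ℂ E]

theorem compactSpace_unitary_clm : CompactSpace (unitary (E →L[ℂ] E)) := by
  have : ProperSpace (E →L[ℂ] E) := FiniteDimensional.proper ℂ _
  refine isCompact_iff_compactSpace.1 (?_ : IsCompact (unitary (E →L[ℂ] E) : Set (E →L[ℂ] E)))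
  refine Metric.isCompact_of_isClosed_isBounded (isClosed_unitary) ?_
  refine (Metric.isBounded_iff_subset_closedBall 0).2 ⟨1, fun u hu => ?_⟩
  rw [mem_closedBall_zero_iff]
  rcases subsingleton_or_nontrivial (E →L[ℂ] E) with h | h
  · rw [Subsingleton.elim u 0]; simp
  · exact (CStarRing.norm_coe_unitary (⟨u, hu⟩ : unitary _)).le

/-- A bounded frame function which is invariant under the stabilizer of `b 0` is affine in the
transition probability to `b 0`. -/
theorem invariant_frame_function {m : ℕ} (b : OrthonormalBasis (Fin (m + 3)) ℂ E) {k : E → ℝ}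
    {W C : ℝ} (hphase : ∀ (c : ℂ) (s : E), ‖c‖ = 1 → k (c • s) = k s)
    (hinv : ∀ (h : unitary (E →L[ℂ] E)), (h : E →L[ℂ] E) (b 0) = b 0 →
      ∀ s, k ((h : E →L[ℂ] E) s) = k s)
    (hframe : ∀ g : unitary (E →L[ℂ] E), ∑ i, k ((g : E →L[ℂ] E) (b i)) = W)
    (hC : ∀ s, ‖s‖ = 1 → |k s| ≤ C) {s : E} (hs : ‖s‖ = 1) :
    (m + 2 : ℝ) * k s = (W - k (b 0)) + ‖⟪b 0, s⟫_ℂ‖ ^ 2 * ((m + 3 : ℝ) * k (b 0) - W) := by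
  have hrank : 2 ≤ Module.finrank ℂ E := by rw [finrank_of_orthonormalBasis b]; omega
  have hb0 : ‖b 0‖ = 1 := b.orthonormal.1 0
  have hb1 : ‖b 1‖ = 1 := b.orthonormal.1 1
  have hb01 : ⟪b 0, b 1⟫_ℂ = 0 := b.orthonormal.2 (by simp)
  set κ : ℝ → ℝ := fun t =>
    k (((Real.sqrt t : ℝ) : ℂ) • b 0 + ((Real.sqrt (1 - t) : ℝ) : ℂ) • b 1) with hκ
  have hkκ : ∀ s : E, ‖s‖ = 1 → k s = κ (‖⟪b 0, s⟫_ℂ‖ ^ 2) := by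
    intro s hs
    obtain ⟨c, e, hc, he, hpe, hse⟩ := exists_orthogonal_decomp hrank hb0 hs
    obtain ⟨g, hg0, hg1⟩ := exists_unitary_map_pair b hb0 he hpe
    simp only [hκ]
    rw [← hinv g hg0 (_ + _), map_add, map_smul, map_smul, hg0, hg1, Real.sqrt_sq (norm_nonneg _)]
    conv_lhs => rw [hse]
    exact hphase _ _ hc
  have hsum : ∀ t : Fin (m + 3) → ℝ, (∀ i, 0 ≤ t i) → ∑ i, t i = 1 → ∑ i, κ (t i) = W := by
    intro t ht0 ht1
    set q : E := ∑ i, ((Real.sqrt (t i) : ℝ) : ℂ) • b i with hq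
    have hbq : ∀ i, ⟪b i, q⟫_ℂ = ((Real.sqrt (t i) : ℝ) : ℂ) := fun i =>
      b.orthonormal.inner_right_fintype _ _
    have hqn : ‖q‖ = 1 := by
      have := b.sum_sq_norm_inner_right q
      simp only [hbq, Complex.norm_real, Real.norm_eq_abs, sq_abs, Real.sq_sqrt (ht0 _), ht1] at this
      nlinarith [norm_nonneg q]
    obtain ⟨c, e, hc, he, hpe, -⟩ := exists_orthogonal_decomp hrank hqn hqn
    obtain ⟨g, hg0, -⟩ := exists_unitary_map_pair b hqn he hpe
    have := hframe g⁻¹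
    rw [← this]
    refine Finset.sum_congr rfl fun i _ => ?_
    have hgi : ‖((g⁻¹ : unitary (E →L[ℂ] E)) : E →L[ℂ] E) (b i)‖ = 1 := by
      rw [Unitary.norm_map, b.orthonormal.1 i]
    rw [hkκ _ hgi]
    have : ⟪b 0, ((g⁻¹ : unitary (E →L[ℂ] E)) : E →L[ℂ] E) (b i)⟫_ℂ = ⟪q, b i⟫_ℂ := by
      rw [← Unitary.inner_map_map g, hg0, ← mul_apply_eq_comp, ← Submonoid.coe_mul]
      simp
    rw [this, ← inner_conj_symm, RCLike.norm_conj, hbq, Complex.norm_real, Real.norm_eq_abs, sq_abs,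
      Real.sq_sqrt (ht0 i)]
  have hrest : ∀ a b' : ℝ, 0 ≤ a → 0 ≤ b' → a + b' ≤ 1 →
      κ a + κ b' + κ (1 - a - b') + m * κ 0 = W := by
    intro a b' ha hb hab
    rw [← hsum (Fin.cons a (Fin.cons b' (Fin.cons (1 - a - b') 0)))]
    · simp [Fin.sum_univ_succ]; ring
    · intro i
      refine Fin.cases ?_ (fun i => ?_) i
      · simpa
      refine Fin.cases ?_ (fun i => ?_) i
      · simpa
      refine Fin.cases ?_ (fun i => ?_) i
      · change 0 ≤ 1 - a - b'; linarith
      · simp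
    · simp [Fin.sum_univ_succ]
  have haff : ∀ t : ℝ, 0 ≤ t → t ≤ 1 → κ t = κ 0 + t * (κ 1 - κ 0) := fun t h0 h1 =>
    affine_of_additive_of_bounded (κ := κ) (C := C)
    (fun t h0 h1 => hC _ (norm_smul_add_smul_eq_one hb0 hb1 hb01 h0 h1))
    (by
      intro a b' ha hb hab
      have e1 := hrest a b' ha hb hab
      have e2 := hrest (a + b') 0 (by positivity) le_rfl (by linarith)
      rw [show 1 - (a + b') - 0 = 1 - a - b' by ring] at e2
      linarith) h0 h1
  have hκ1 : κ 1 = k (b 0) := by simp [hκ]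
  have h10 : κ 1 + (m + 2) * κ 0 = W := by
    have := hrest 1 0 zero_le_one le_rfl (by norm_num)
    norm_num at this
    linarith
  have hle : ‖⟪b 0, s⟫_ℂ‖ ^ 2 ≤ 1 := by
    have := norm_inner_le_norm (𝕜 := ℂ) (b 0) s
    rw [hb0, hs, mul_one] at this
    exact pow_le_one₀ (norm_nonneg _) this
  rw [hkκ s hs, haff _ (by positivity) hle, ← hκ1]
  rw [← h10]; ring

/-- The pointwise stabilizer of a vector in the unitary group. -/
def unitaryStabilizer (p : E) : Subgroup (unitary (E →L[ℂ] E)) where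
  carrier := {g | (g : E →L[ℂ] E) p = p}
  one_mem' := by simp
  mul_mem' := by
    intro a b ha hb
    simp only [Set.mem_ofPred_eq, Submonoid.coe_mul, mul_apply_eq_comp] at ha hb ⊢
    rw [hb, ha]
  inv_mem' := by
    intro a ha
    simp only [Set.mem_ofPred_eq] at ha ⊢
    conv_lhs => rw [← ha]
    rw [← mul_apply_eq_comp, ← Submonoid.coe_mul, inv_mul_cancel]
    simp

theorem continuous_unitary_apply : Continuous fun x : unitary (E →L[ℂ] E) × E =>
    (x.1 : E →L[ℂ] E) x.2 :=
  (continuous_subtype_val.comp continuous_fst).clm_apply continuous_snd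

theorem compactSpace_unitaryStabilizer (p : E) : CompactSpace (unitaryStabilizer p) := by
  have := compactSpace_unitary_clm (E := E)
  refine isCompact_iff_compactSpace.1 (IsClosed.isCompact ?_)
  exact isClosed_eq (continuous_unitary_apply.comp (Continuous.prodMk_left p)) continuous_const

theorem unitary_mul_apply (g h : unitary (E →L[ℂ] E)) (v : E) :
    ((g * h : unitary (E →L[ℂ] E)) : E →L[ℂ] E) v = (g : E →L[ℂ] E) ((h : E →L[ℂ] E) v) := rfl

theorem integral_frame_function_mul [MeasurableSpace (unitary (E →L[ℂ] E))]
    [BorelSpace (unitary (E →L[ℂ] E))] {m : ℕ} (b : OrthonormalBasis (Fin (m + 3)) ℂ E) {F : E → ℝ}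
    {W : ℝ} (hF : Continuous F) (hphase : ∀ (c : ℂ) (s : E), ‖c‖ = 1 → F (c • s) = F s)
    (hframe : ∀ g : unitary (E →L[ℂ] E), ∑ i, F ((g : E →L[ℂ] E) (b i)) = W)
    (ν : Measure (unitary (E →L[ℂ] E))) [IsProbabilityMeasure ν] [ν.IsMulLeftInvariant]
    {q : E} (hq : ‖q‖ = 1) :
    (m + 2 : ℝ) * ∫ g : unitary (E →L[ℂ] E), F ((g : E →L[ℂ] E) q) *
        ‖⟪b 0, (g : E →L[ℂ] E) q⟫_ℂ‖ ^ 2 ∂ν =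
      (W - F (b 0)) * ∫ g : unitary (E →L[ℂ] E), ‖⟪b 0, (g : E →L[ℂ] E) q⟫_ℂ‖ ^ 2 ∂ν +
      ((m + 3 : ℝ) * F (b 0) - W) *
        ∫ g : unitary (E →L[ℂ] E), (‖⟪b 0, (g : E →L[ℂ] E) q⟫_ℂ‖ ^ 2) ^ 2 ∂ν := by
  have hcG := compactSpace_unitary_clm (E := E)
  have hcK := compactSpace_unitaryStabilizer (b 0)
  let K := unitaryStabilizer (b 0)
  let _ : MeasurableSpace K := borel K
  have : BorelSpace K := ⟨rfl⟩
  obtain ⟨η, hη1, hη2, -⟩ := exists_haar_probability K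
  have hac : ∀ v : E, Continuous fun g : unitary (E →L[ℂ] E) => (g : E →L[ℂ] E) v := fun v =>
    continuous_unitary_apply.comp (Continuous.prodMk_left v)
  have hacK : ∀ v : E, Continuous fun h : K => ((h⁻¹ : unitary (E →L[ℂ] E)) : E →L[ℂ] E) v :=
    fun v => (hac v).comp continuous_subtype_val.inv
  have hintg : ∀ {f : unitary (E →L[ℂ] E) → ℝ}, Continuous f → Integrable f ν := fun hf =>
    hf.integrable_of_hasCompactSupport (HasCompactSupport.of_compactSpace _)
  have hintgK : ∀ {f : K → ℝ}, Continuous f → Integrable f η := fun hf =>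
    hf.integrable_of_hasCompactSupport (HasCompactSupport.of_compactSpace _)
  set k : E → ℝ := fun s => ∫ h : K, F (((h⁻¹ : unitary (E →L[ℂ] E)) : E →L[ℂ] E) s) ∂η with hk
  obtain ⟨C, hC⟩ : ∃ C, ∀ s : E, ‖s‖ = 1 → |F s| ≤ C := by
    have : ProperSpace E := FiniteDimensional.proper ℂ E
    obtain ⟨C, hC⟩ := (isCompact_sphere (0 : E) 1).exists_bound_of_continuousOn hF.continuousOn
    exact ⟨C, fun s hs => hC s (by simpa using hs)⟩
  have hkb : k (b 0) = F (b 0) := by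
    have : ∀ h : K, ((h⁻¹ : unitary (E →L[ℂ] E)) : E →L[ℂ] E) (b 0) = b 0 := fun h =>
      K.inv_mem h.2
    simp [hk, this]
  have hkaff : ∀ s : E, ‖s‖ = 1 → (m + 2 : ℝ) * k s = (W - F (b 0)) +
      ‖⟪b 0, s⟫_ℂ‖ ^ 2 * ((m + 3 : ℝ) * F (b 0) - W) := by
    intro s hs
    rw [← hkb]
    refine invariant_frame_function b (C := C) ?_ ?_ ?_ ?_ hs
    · intro c s hc
      simp only [hk, map_smul, hphase _ _ hc]
    · intro h hh s
      have := integral_mul_left_eq_self (μ := η)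
        (fun x : K => F (((x⁻¹ : unitary (E →L[ℂ] E)) : E →L[ℂ] E) s)) (⟨h, hh⟩ : K)⁻¹
      simp only [hk]
      rw [← this]
      refine integral_congr_ae (Filter.Eventually.of_forall fun x => ?_)
      simp only [Subgroup.coe_mul, Subgroup.coe_inv, mul_inv_rev, inv_inv, unitary_mul_apply]
    · intro g
      simp only [hk]
      rw [← integral_finsetSum _ (fun i _ => hintgK (f := fun h : K =>
        F (((h⁻¹ : unitary (E →L[ℂ] E)) : E →L[ℂ] E) ((g : E →L[ℂ] E) (b i)))) (hF.comp (hacK _)))]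
      have : ∀ h : K, ∑ i, F (((h⁻¹ : unitary (E →L[ℂ] E)) : E →L[ℂ] E)
          ((g : E →L[ℂ] E) (b i))) = W := fun h => hframe ((h : unitary (E →L[ℂ] E))⁻¹ * g)
      simp [this]
    · intro s hs
      have := norm_integral_le_of_norm_le_const (μ := η) (C := C)
        (f := fun h : K => F (((h⁻¹ : unitary (E →L[ℂ] E)) : E →L[ℂ] E) s))
        (Filter.Eventually.of_forall fun h => hC _ (by rw [Unitary.norm_map, hs]))
      simpa using this
  have hkc : ∫ g : unitary (E →L[ℂ] E), F ((g : E →L[ℂ] E) q) *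
        ‖⟪b 0, (g : E →L[ℂ] E) q⟫_ℂ‖ ^ 2 ∂ν = ∫ g : unitary (E →L[ℂ] E), k ((g : E →L[ℂ] E) q) *
        ‖⟪b 0, (g : E →L[ℂ] E) q⟫_ℂ‖ ^ 2 ∂ν := by
    have h1 : ∀ h : K, ∫ g : unitary (E →L[ℂ] E),
        F (((h⁻¹ : unitary (E →L[ℂ] E)) : E →L[ℂ] E) ((g : E →L[ℂ] E) q)) *
        ‖⟪b 0, (g : E →L[ℂ] E) q⟫_ℂ‖ ^ 2 ∂ν = ∫ g : unitary (E →L[ℂ] E), F ((g : E →L[ℂ] E) q) *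
        ‖⟪b 0, (g : E →L[ℂ] E) q⟫_ℂ‖ ^ 2 ∂ν := by
      intro h
      rw [← integral_mul_left_eq_self (fun g : unitary (E →L[ℂ] E) => F ((g : E →L[ℂ] E) q) *
        ‖⟪b 0, (g : E →L[ℂ] E) q⟫_ℂ‖ ^ 2) ((h : unitary (E →L[ℂ] E))⁻¹)]
      refine integral_congr_ae (Filter.Eventually.of_forall fun g => ?_)
      simp only [unitary_mul_apply]
      have hh : ((h⁻¹ : unitary (E →L[ℂ] E)) : E →L[ℂ] E) (b 0) = b 0 := K.inv_mem h.2
      rw [← Unitary.inner_map_map (h : unitary (E →L[ℂ] E))⁻¹ (b 0), hh]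
    have h2 : ∫ h : K, ∫ g : unitary (E →L[ℂ] E),
        F (((h⁻¹ : unitary (E →L[ℂ] E)) : E →L[ℂ] E) ((g : E →L[ℂ] E) q)) *
        ‖⟪b 0, (g : E →L[ℂ] E) q⟫_ℂ‖ ^ 2 ∂ν ∂η = ∫ g : unitary (E →L[ℂ] E), ∫ h : K,
        F (((h⁻¹ : unitary (E →L[ℂ] E)) : E →L[ℂ] E) ((g : E →L[ℂ] E) q)) *
        ‖⟪b 0, (g : E →L[ℂ] E) q⟫_ℂ‖ ^ 2 ∂η ∂ν := by
      refine integral_integral_swap_of_hasCompactSupport ?_ (HasCompactSupport.of_compactSpace _)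
      refine Continuous.mul (hF.comp ?_) ?_
      · exact continuous_unitary_apply.comp
          (((continuous_subtype_val.comp continuous_fst).inv).prodMk ((hac q).comp continuous_snd))
      · exact ((continuous_const.inner ((hac q).comp continuous_snd)).norm.pow 2)
    simp only [h1] at h2
    simp only [integral_mul_const] at h2
    simpa using h2
  rw [hkc, ← integral_const_mul, ← integral_const_mul, ← integral_const_mul, ← integral_add]
  · refine integral_congr_ae (Filter.Eventually.of_forall fun g => ?_)
    simp only
    rw [← mul_assoc, hkaff _ (by rw [Unitary.norm_map, hq])]
    ring
  · exact hintg (continuous_const.mul ((continuous_const.inner (hac q)).norm.pow 2))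
  · exact hintg (continuous_const.mul (((continuous_const.inner (hac q)).norm.pow 2).pow 2))

/-- A continuous frame function in complex dimension different from two is quadratic. -/
theorem gleason_continuous (hn : Module.finrank ℂ E ≠ 2) {F : E → ℝ} (hF : Continuous F)
    (hphase : ∀ (c : ℂ) (s : E), ‖c‖ = 1 → F (c • s) = F s) {W : ℝ}
    (hframe : ∀ b : OrthonormalBasis (Fin (Module.finrank ℂ E)) ℂ E, ∑ i, F (b i) = W) :
    ∃ ℓ : (E →L[ℂ] E) →ₗ[ℝ] ℝ, ∀ v, ‖v‖ = 1 → F v = ℓ (InnerProductSpace.rankOne ℂ v v) := by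
  have htr : ∃ ℓ : (E →L[ℂ] E) →ₗ[ℝ] ℝ, ∀ v, ‖v‖ = 1 →
      ℓ (InnerProductSpace.rankOne ℂ v v) = 1 := by
    let b := stdOrthonormalBasis ℂ E
    refine ⟨
      { toFun := fun T => ∑ i, (⟪b i, T (b i)⟫_ℂ).re
        map_add' := fun S T => by simp [Finset.sum_add_distrib]
        map_smul' := fun r T => by
          simp [Finset.mul_sum] }, fun v hv => ?_⟩
    have := sum_re_inner_rankOne b v
    rw [hv] at this
    simpa using this
  obtain ⟨tr, htr⟩ := htr
  rcases Nat.lt_or_ge (Module.finrank ℂ E) 2 with hlt | hge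
  · refine ⟨W • tr, fun v hv => ?_⟩
    have h1 : Module.finrank ℂ E = 1 := by
      have : 0 < Module.finrank ℂ E := by
        have : Nontrivial E := ⟨v, 0, by rintro rfl; simp at hv⟩
        exact Module.finrank_pos
      omega
    have hv' : Orthonormal ℂ (({⟨0, by omega⟩} : Set (Fin (Module.finrank ℂ E))).domRestrict
        (fun _ => v)) := by
      constructor
      · intro i; simp [hv]
      · rintro ⟨i, hi⟩ ⟨j, hj⟩ hij
        simp only [Set.mem_singleton_iff] at hi hj
        exact absurd (Subtype.ext (hi.trans hj.symm)) hij
    obtain ⟨b, hb⟩ := hv'.exists_orthonormalBasis_extension_of_card_eq (by simp)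
    have := hframe b
    have hall : ∀ i, b i = v := by
      intro i
      have : i = ⟨0, by omega⟩ := by ext; have := i.2; simp; omega
      rw [this]; exact hb _ (by simp)
    simp only [hall, Finset.sum_const, Finset.card_univ, Fintype.card_fin, h1, one_smul] at this
    simp [htr v hv, this]
  obtain ⟨m, hm⟩ : ∃ m, Module.finrank ℂ E = m + 3 :=
    ⟨Module.finrank ℂ E - 3, by omega⟩
  rw [hm] at hframe
  have hcG := compactSpace_unitary_clm (E := E)
  let _ : MeasurableSpace (unitary (E →L[ℂ] E)) := borel _
  have : BorelSpace (unitary (E →L[ℂ] E)) := ⟨rfl⟩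
  obtain ⟨ν, hν1, hν2, hν3⟩ := exists_haar_probability (unitary (E →L[ℂ] E))
  have hac : ∀ v : E, Continuous fun g : unitary (E →L[ℂ] E) => (g : E →L[ℂ] E) v := fun v =>
    continuous_unitary_apply.comp (Continuous.prodMk_left v)
  have hintg : ∀ {f : unitary (E →L[ℂ] E) → ℝ}, Continuous f → Integrable f ν := fun hf =>
    hf.integrable_of_hasCompactSupport (HasCompactSupport.of_compactSpace _)
  obtain ⟨b, -, -⟩ : ∃ b : OrthonormalBasis (Fin (m + 3)) ℂ E, True ∧ True :=
    ⟨(stdOrthonormalBasis ℂ E).reindex (finCongr hm), trivial, trivial⟩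
  set q := b 0 with hqdef
  have hq : ‖q‖ = 1 := b.orthonormal.1 0
  set τ : E → unitary (E →L[ℂ] E) → ℝ := fun p g => ‖⟪p, (g : E →L[ℂ] E) q⟫_ℂ‖ ^ 2 with hτ
  have hτc : ∀ p, Continuous (τ p) := fun p => (continuous_const.inner (hac q)).norm.pow 2
  have hframe' : ∀ (b : OrthonormalBasis (Fin (m + 3)) ℂ E) (g : unitary (E →L[ℂ] E)),
      ∑ i, F ((g : E →L[ℂ] E) (b i)) = W := by
    intro b g
    have := hframe (b.map (Unitary.linearIsometryEquiv g))
    exact this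
  -- the moments of the transition probability do not depend on the vector
  have htrans : ∀ p, ‖p‖ = 1 → ∀ ψ : ℝ → ℝ, ∫ g, ψ (τ p g) ∂ν = ∫ g, ψ (τ q g) ∂ν := by
    intro p hp ψ
    obtain ⟨c, e, hc, he, hpe, -⟩ := exists_orthogonal_decomp
      (by rw [finrank_of_orthonormalBasis b]; omega) hp hp
    obtain ⟨u, hu, -⟩ := exists_unitary_map_pair b hp he hpe
    rw [← integral_mul_left_eq_self (fun g => ψ (τ p g)) u]
    refine integral_congr_ae (Filter.Eventually.of_forall fun g => ?_)
    simp only [hτ, unitary_mul_apply]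
    rw [← hu, Unitary.inner_map_map]
  set A1 := ∫ g, τ q g ∂ν with hA1
  set A2 := ∫ g, (τ q g) ^ 2 ∂ν with hA2
  have hA1v : (m + 3 : ℝ) * A1 = 1 := by
    have h1 : ∑ i, ∫ g, τ (b i) g ∂ν = 1 := by
      rw [← integral_finsetSum _ (fun i _ => hintg (hτc _))]
      have : ∀ g : unitary (E →L[ℂ] E), ∑ i, τ (b i) g = 1 := by
        intro g
        simp only [hτ]
        rw [b.sum_sq_norm_inner_right, Unitary.norm_map, hq, one_pow]
      simp [this]
    have h2 : ∀ i, ∫ g, τ (b i) g ∂ν = A1 := fun i =>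
      htrans _ (b.orthonormal.1 i) id
    simpa [h2] using h1
  have hpos : 0 < (m + 3 : ℝ) * A2 - A1 := by
    have hc : Continuous fun g => (τ q g - A1) ^ 2 := ((hτc q).sub continuous_const).pow 2
    have h1 : 0 < ∫ g, (τ q g - A1) ^ 2 ∂ν := by
      refine hc.integral_pos_of_hasCompactSupport_nonneg_nonzero
        (HasCompactSupport.of_compactSpace _) (fun g => sq_nonneg _) (x := 1) ?_
      have : τ q 1 = 1 := by simp [hτ, inner_self_eq_norm_sq_to_K, hq]
      simp only [this]
      have : A1 ≠ 1 := by
        rintro h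
        rw [h] at hA1v
        have : (0 : ℝ) ≤ m := by positivity
        linarith
      exact pow_ne_zero _ (sub_ne_zero.2 this.symm)
    have h2 : ∫ g, (τ q g - A1) ^ 2 ∂ν = A2 - A1 * A1 := by
      have : ∀ g, (τ q g - A1) ^ 2 = ((τ q g) ^ 2 - (2 * A1) * τ q g) + A1 ^ 2 := fun g => by ring
      simp only [this]
      have i1 : Integrable (fun g => τ q g ^ 2) ν := hintg ((hτc q).pow 2)
      have i2 : Integrable (fun g => 2 * A1 * τ q g) ν := (hintg (hτc q)).const_mul _
      have i3 : Integrable (fun g => τ q g ^ 2 - 2 * A1 * τ q g) ν := i1.sub i2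
      rw [integral_add i3 (integrable_const _), integral_sub i1 i2, integral_const_mul]
      simp [← hA1, ← hA2]; ring
    rw [h2] at h1
    have h3 : (0 : ℝ) < m + 3 := by positivity
    have := mul_pos h3 h1
    nlinarith
  let I : (E →L[ℂ] E) →ₗ[ℝ] ℝ :=
    { toFun := fun T => ∫ g : unitary (E →L[ℂ] E), F ((g : E →L[ℂ] E) q) *
        (⟪(g : E →L[ℂ] E) q, T ((g : E →L[ℂ] E) q)⟫_ℂ).re ∂ν
      map_add' := fun S T => by
        rw [← integral_add]
        · simp [mul_add]
        · exact hintg ((hF.comp (hac q)).mul (Complex.continuous_re.comp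
            ((hac q).inner (S.continuous.comp (hac q)))))
        · exact hintg ((hF.comp (hac q)).mul (Complex.continuous_re.comp
            ((hac q).inner (T.continuous.comp (hac q)))))
      map_smul' := fun r T => by
        simp only [RingHom.id_apply, smul_eq_mul]
        rw [← integral_const_mul]
        refine integral_congr_ae (Filter.Eventually.of_forall fun g => ?_)
        simp
        ring }
  refine ⟨((m + 3 : ℝ) * A2 - A1)⁻¹ • ((m + 2 : ℝ) • I - (W * (A1 - A2)) • tr), fun p hp => ?_⟩
  obtain ⟨c, e, hc, he, hpe, -⟩ := exists_orthogonal_decomp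
    (by rw [finrank_of_orthonormalBasis b]; omega) hp hp
  obtain ⟨b', hb', -⟩ := exists_orthonormalBasis_extending_pair
    (finrank_of_orthonormalBasis b) hp he hpe
  have hI := integral_frame_function_mul b' hF hphase (hframe' b') ν hq
  rw [hb', ] at hI
  have e1 : ∫ g : unitary (E →L[ℂ] E), ‖⟪p, (g : E →L[ℂ] E) q⟫_ℂ‖ ^ 2 ∂ν = A1 := htrans p hp id
  have e2 : ∫ g : unitary (E →L[ℂ] E), (‖⟪p, (g : E →L[ℂ] E) q⟫_ℂ‖ ^ 2) ^ 2 ∂ν = A2 :=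
    htrans p hp (fun t => t ^ 2)
  have e3 : I (InnerProductSpace.rankOne ℂ p p) = ∫ g : unitary (E →L[ℂ] E),
      F ((g : E →L[ℂ] E) q) * ‖⟪p, (g : E →L[ℂ] E) q⟫_ℂ‖ ^ 2 ∂ν := by
    change ∫ g : unitary (E →L[ℂ] E), F ((g : E →L[ℂ] E) q) * _ ∂ν = _
    refine integral_congr_ae (Filter.Eventually.of_forall fun g => ?_)
    simp only
    congr 1
    rw [InnerProductSpace.rankOne_apply, inner_smul_right, ← inner_conj_symm _ p,
      Complex.mul_conj, Complex.normSq_eq_norm_sq]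
    norm_cast
  rw [e1, e2, ← e3] at hI
  simp only [LinearMap.smul_apply, LinearMap.sub_apply, smul_eq_mul, htr p hp]
  rw [hI, eq_inv_mul_iff_mul_eq₀ hpos.ne']
  ring
end Sphere

section VonNeumann
variable {H : Type*} [NormedAddCommGroup H] [InnerProductSpace ℂ H] [CompleteSpace H]

theorem cfc_mem_centralizer {S : Set (H →L[ℂ] H)} {x : H →L[ℂ] H}
    (hx : x ∈ StarSubalgebra.centralizer ℂ S) (f : ℝ → ℝ) :
    cfc f x ∈ StarSubalgebra.centralizer ℂ S := by
  rw [StarSubalgebra.mem_centralizer_iff] at hx ⊢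
  intro g hg
  obtain ⟨h1, h2⟩ := hx g hg
  exact ⟨(Commute.cfc_real (show Commute x g from h1.symm) f).symm.eq,
    (Commute.cfc_real (show Commute x (star g) from h2.symm) f).symm.eq⟩

omit [CompleteSpace H] in
theorem finite_spectrum_of_finiteDimensional {x : H →L[ℂ] H}
    (V : Submodule ℂ (H →L[ℂ] H)) [FiniteDimensional ℂ V] (hV : ∀ i : ℕ, x ^ (i + 1) ∈ V) :
    (spectrum ℝ x).Finite := by
  have hmem : ∀ P : Polynomial ℂ, Polynomial.aeval x (Polynomial.X * P) ∈ V := by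
    intro P
    rw [map_mul, Polynomial.aeval_X, Polynomial.aeval_eq_sum_range, Finset.mul_sum]
    refine V.sum_mem fun i _ => ?_
    rw [mul_smul_comm, ← pow_succ']
    exact V.smul_mem _ (hV i)
  let f : Polynomial ℂ →ₗ[ℂ] V := LinearMap.codRestrict V
    ((Polynomial.aeval x).toLinearMap ∘ₗ LinearMap.mulLeft ℂ Polynomial.X) hmem
  have hf : ¬ Function.Injective f := fun h => Polynomial.not_finite (Module.Finite.of_injective f h)
  rw [← LinearMap.ker_eq_bot, Submodule.eq_bot_iff] at hf
  push Not at hf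
  obtain ⟨P, hP, hP0⟩ := hf
  have hP' : Polynomial.aeval x (Polynomial.X * P) = 0 := congrArg Subtype.val hP
  have hne : Polynomial.X * P ≠ 0 := mul_ne_zero Polynomial.X_ne_zero hP0
  rcases subsingleton_or_nontrivial (H →L[ℂ] H) with hs | hs
  · have : spectrum ℝ x = ∅ := spectrum.of_subsingleton x
    rw [this]; exact Set.finite_empty
  have hfin : (spectrum ℂ x).Finite := by
    refine ((Polynomial.X * P).roots.toFinset.finite_toSet).subset fun z hz => ?_
    have := spectrum.subset_polynomial_aeval x (Polynomial.X * P) ⟨z, hz, rfl⟩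
    rw [hP', spectrum.zero_eq] at this
    simpa [hne] using this
  rw [← spectrum.preimage_algebraMap ℂ]
  exact hfin.preimage (algebraMap ℝ ℂ).injective.injOn

theorem exists_eigenprojection {S : Set (H →L[ℂ] H)} {x : H →L[ℂ] H}
    (hx : x ∈ StarSubalgebra.centralizer ℂ S) (hsa : IsSelfAdjoint x) (h0 : x ≠ 0)
    (V : Submodule ℂ (H →L[ℂ] H)) [FiniteDimensional ℂ V] (hV : ∀ i : ℕ, x ^ (i + 1) ∈ V) :
    ∃ (t : ℝ) (p y : H →L[ℂ] H), t ≠ 0 ∧ p ∈ StarSubalgebra.centralizer ℂ S ∧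
      y ∈ StarSubalgebra.centralizer ℂ S ∧ IsStarProjection p ∧ p ≠ 0 ∧ x * p = t • p ∧
      p = x * y * x := by
  have hfin := finite_spectrum_of_finiteDimensional V hV
  have hc : ∀ f : ℝ → ℝ, ContinuousOn f (spectrum ℝ x) := fun f => hfin.continuousOn f
  obtain ⟨t, ht, ht0⟩ : ∃ t ∈ spectrum ℝ x, t ≠ 0 := by
    by_contra! h
    exact h0 (CFC.eq_zero_of_spectrum_subset_zero x h)
  set χ : ℝ → ℝ := fun s => if s = t then 1 else 0 with hχ
  refine ⟨t, cfc χ x, cfc (fun s => t⁻¹ ^ 2 * χ s) x, ht0, cfc_mem_centralizer hx _,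
    cfc_mem_centralizer hx _, ⟨?_, cfc_predicate _ _⟩, ?_, ?_, ?_⟩
  · rw [IsIdempotentElem, ← cfc_mul _ _ _ (hc _) (hc _)]
    congr 1; ext s; simp [hχ]
  · intro h
    have h1 : (1 : ℝ) ∈ spectrum ℝ (cfc χ x) := by
      rw [cfc_map_spectrum _ _ hsa (hc _)]
      exact ⟨t, ht, by simp [hχ]⟩
    have : Nontrivial (H →L[ℂ] H) := ⟨x, 0, h0⟩
    rw [h, spectrum.zero_eq] at h1
    simp at h1
  · conv_lhs => enter [1]; rw [← cfc_id' ℝ x]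
    rw [← cfc_mul _ _ _ (hc _) (hc _), ← cfc_smul _ _ _ (hc _)]
    congr 1; ext s; simp only [hχ, smul_eq_mul]; split_ifs with h <;> simp [h]
  · conv_rhs => enter [1, 1]; rw [← cfc_id' ℝ x]
    conv_rhs => enter [2]; rw [← cfc_id' ℝ x]
    rw [← cfc_mul _ _ _ (hc _) (hc _), ← cfc_mul _ _ _ (hc _) (hc _)]
    congr 1; ext s; simp only [hχ]; split_ifs with h
    · subst h; field_simp
    · simp

/-- A minimal projection of a unital star algebra of operators. -/
structure IsMinimalProjection (M : StarSubalgebra ℂ (H →L[ℂ] H)) (e : H →L[ℂ] H) : Prop where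
  mem : e ∈ M
  proj : IsStarProjection e
  ne_zero : e ≠ 0
  scalar : ∀ m ∈ M, ∃ t : ℂ, e * m * e = t • e

/-- The compression of `M` by an operator. -/
def compression (M : StarSubalgebra ℂ (H →L[ℂ] H)) (k : H →L[ℂ] H) : Submodule ℂ (H →L[ℂ] H) :=
  (Subalgebra.toSubmodule M.toSubalgebra).map (LinearMap.mulLeft ℂ k ∘ₗ LinearMap.mulRight ℂ k)

theorem mem_compression {M : StarSubalgebra ℂ (H →L[ℂ] H)} {k T : H →L[ℂ] H} :
    T ∈ compression M k ↔ ∃ m ∈ M, k * m * k = T := by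
  simp [compression, mul_assoc]

theorem exists_selfAdjoint_not_scalar {M : StarSubalgebra ℂ (H →L[ℂ] H)} {p : H →L[ℂ] H}
    (h : ¬ ∀ m ∈ M, ∃ t : ℂ, p * m * p = t • p) :
    ∃ m ∈ M, IsSelfAdjoint m ∧ ∀ t : ℂ, p * m * p ≠ t • p := by
  by_contra! hcon
  refine h fun m hm => ?_
  obtain ⟨s, hs⟩ := hcon ((ℜ m : selfAdjoint (H →L[ℂ] H)) : H →L[ℂ] H) (by
    rw [realPart_apply_coe]
    exact M.smul_mem (show m + star m ∈ M from add_mem hm (star_mem hm)) (((2 : ℝ)⁻¹ : ℝ) : ℂ)) (ℜ m).2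
  obtain ⟨t, ht⟩ := hcon ((ℑ m : selfAdjoint (H →L[ℂ] H)) : H →L[ℂ] H) (by
    rw [imaginaryPart_apply_coe]
    exact M.smul_mem (M.smul_mem (show m - star m ∈ M from sub_mem hm (star_mem hm)) (((2 : ℝ)⁻¹ : ℝ) : ℂ)) (-Complex.I))
      (ℑ m).2
  refine ⟨s + Complex.I * t, ?_⟩
  conv_lhs => rw [← realPart_add_I_smul_imaginaryPart m]
  rw [mul_add, add_mul, mul_smul_comm, smul_mul_assoc, hs, ht, add_smul, mul_smul]

theorem exists_minimal_of_finiteDimensional {S : Set (H →L[ℂ] H)} (n : ℕ) :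
    ∀ p ∈ StarSubalgebra.centralizer ℂ S, IsStarProjection p → p ≠ 0 →
      FiniteDimensional ℂ (compression (StarSubalgebra.centralizer ℂ S) p) →
      Module.finrank ℂ (compression (StarSubalgebra.centralizer ℂ S) p) ≤ n →
      ∃ e, IsMinimalProjection (StarSubalgebra.centralizer ℂ S) e ∧ p * e = e := by
  induction n with
  | zero =>
    intro p hpM hp hp0 hfd hn
    have h1 := Submodule.finrank_eq_zero.1 (Nat.le_zero.1 hn)
    have : p ∈ compression (StarSubalgebra.centralizer ℂ S) p :=
      mem_compression.2 ⟨1, one_mem _, by rw [mul_one, hp.isIdempotentElem.eq]⟩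
    rw [h1] at this
    exact absurd (by simpa using this) hp0
  | succ n ih =>
    intro p hpM hp hp0 hfd hn
    by_cases hmin : ∀ m ∈ StarSubalgebra.centralizer ℂ S, ∃ t : ℂ, p * m * p = t • p
    · exact ⟨p, ⟨hpM, hp, hp0, hmin⟩, hp.isIdempotentElem.eq⟩
    obtain ⟨m, hm, hmsa, hmt⟩ := exists_selfAdjoint_not_scalar hmin
    set x := p * m * p with hxdef
    have hpp : p * p = p := hp.isIdempotentElem.eq
    have hpx : p * x = x := by rw [hxdef, ← mul_assoc, ← mul_assoc, hpp]
    have hxp : x * p = x := by rw [hxdef, mul_assoc, hpp]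
    have hxM : x ∈ StarSubalgebra.centralizer ℂ S := mul_mem (mul_mem hpM hm) hpM
    have hxsa : IsSelfAdjoint x := by
      rw [IsSelfAdjoint, hxdef, star_mul, star_mul, hp.isSelfAdjoint.star_eq, hmsa.star_eq,
        mul_assoc]
    have hx0 : x ≠ 0 := fun h => hmt 0 (by rw [zero_smul]; exact h)
    obtain ⟨t, q, y, ht0, hqM, hyM, hq, hq0, hxq, hqy⟩ := exists_eigenprojection hxM hxsa hx0
      (compression (StarSubalgebra.centralizer ℂ S) p) (fun i => mem_compression.2
        ⟨x ^ (i + 1), pow_mem hxM _, by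
          conv_lhs => rw [pow_succ', ← mul_assoc, hpx, ← pow_succ', pow_succ, mul_assoc, hxp, ← pow_succ]⟩)
    have hpq : p * q = q := by
      conv_lhs => rw [hqy]
      rw [mul_assoc x y x, ← mul_assoc p, hpx, ← mul_assoc, ← hqy]
    have hqp : q * p = q := by
      conv_lhs => rw [hqy]
      rw [mul_assoc, hxp, ← hqy]
    have hle : compression (StarSubalgebra.centralizer ℂ S) q ≤
        compression (StarSubalgebra.centralizer ℂ S) p := by
      intro T hT
      obtain ⟨w, hw, rfl⟩ := mem_compression.1 hT
      refine mem_compression.2 ⟨q * w * q, mul_mem (mul_mem hqM hw) hqM, ?_⟩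
      rw [← mul_assoc, ← mul_assoc, hpq, mul_assoc (q * w), hqp]
    have hlt : compression (StarSubalgebra.centralizer ℂ S) q <
        compression (StarSubalgebra.centralizer ℂ S) p := by
      refine lt_of_le_of_ne hle fun heq => ?_
      have : p ∈ compression (StarSubalgebra.centralizer ℂ S) q := by
        rw [heq]
        exact mem_compression.2 ⟨1, one_mem _, by rw [mul_one, hpp]⟩
      obtain ⟨w, hw, hwp⟩ := mem_compression.1 this
      have : q = p := by
        rw [← hqp]
        conv_lhs => rw [← hwp]
        rw [← mul_assoc, ← mul_assoc, hq.isIdempotentElem.eq, hwp]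
      rw [this, hxp] at hxq
      exact hmt t (by rw [hxq]; rfl)
    have hfd' : FiniteDimensional ℂ (compression (StarSubalgebra.centralizer ℂ S) q) :=
      Submodule.finiteDimensional_of_le hle
    obtain ⟨e, he, hqe⟩ := ih q hqM hq hq0 hfd'
      (by have := Submodule.finrank_lt_finrank_of_lt hlt; omega)
    exact ⟨e, he, by rw [← hqe, ← mul_assoc, hpq]⟩

/-- If `k M k` is finite-dimensional and `k ≠ 0`, there is a minimal projection below `k`. -/
theorem exists_minimal_of_finiteDimensional_compression {S : Set (H →L[ℂ] H)} {k : H →L[ℂ] H}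
    (hk : k ∈ StarSubalgebra.centralizer ℂ S) (hsa : IsSelfAdjoint k) (h0 : k ≠ 0)
    [FiniteDimensional ℂ (compression (StarSubalgebra.centralizer ℂ S) k)] :
    ∃ e, IsMinimalProjection (StarSubalgebra.centralizer ℂ S) e ∧
      ∀ c, c * k = k → c * e = e := by
  have hk2 : k * k ≠ 0 := by
    intro h
    have := CStarRing.norm_star_mul_self (x := k)
    rw [hsa.star_eq, h, norm_zero] at this
    exact h0 (norm_eq_zero.1 (mul_self_eq_zero.1 this.symm))
  have hk2sa : IsSelfAdjoint (k * k) := by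
    rw [IsSelfAdjoint, star_mul, hsa.star_eq]
  obtain ⟨t, q, y, ht0, hqM, hyM, hq, hq0, hxq, hqy⟩ := exists_eigenprojection (mul_mem hk hk)
    hk2sa hk2 (compression (StarSubalgebra.centralizer ℂ S) k) (fun i => mem_compression.2
      ⟨(k * k) ^ i, pow_mem (mul_mem hk hk) _, by
        rw [← sq, ← pow_mul, ← pow_mul, ← pow_succ', ← pow_succ]; congr 1⟩)
  have hle : compression (StarSubalgebra.centralizer ℂ S) q ≤
      compression (StarSubalgebra.centralizer ℂ S) k := by
    intro T hT
    obtain ⟨w, hw, rfl⟩ := mem_compression.1 hT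
    refine mem_compression.2 ⟨k * y * (k * k) * w * (k * k) * y * k, ?_, ?_⟩
    · exact mul_mem (mul_mem (mul_mem (mul_mem (mul_mem (mul_mem hk hyM) (mul_mem hk hk)) hw)
        (mul_mem hk hk)) hyM) hk
    · rw [hqy]; simp only [mul_assoc]
  have hfd' : FiniteDimensional ℂ (compression (StarSubalgebra.centralizer ℂ S) q) :=
    Submodule.finiteDimensional_of_le hle
  obtain ⟨e, he, hqe⟩ := exists_minimal_of_finiteDimensional _ q hqM hq hq0 hfd' le_rfl
  refine ⟨e, he, fun c hc => ?_⟩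
  have hcq : c * q = q := by
    conv_lhs => rw [hqy]
    rw [mul_assoc (k * k), mul_assoc k k, ← mul_assoc c, hc, ← mul_assoc, ← mul_assoc, ← hqy]
  rw [← hqe, ← mul_assoc, hcq]

end VonNeumann

section Extreme
variable {H : Type*} [NormedAddCommGroup H] [InnerProductSpace ℂ H] [CompleteSpace H]

/-- The sesquilinear form of an operator. -/
noncomputable def sesqForm : (H →L[ℂ] H) →ₗ[ℝ] (H → H → ℂ) where
  toFun T := fun v w => ⟪v, T w⟫_ℂ
  map_add' S T := by ext v w; simp
  map_smul' r T := by
    ext v w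
    simp [inner_smul_right_eq_smul]

omit [CompleteSpace H] in
theorem sesqForm_apply (T : H →L[ℂ] H) (v w : H) : sesqForm T v w = ⟪v, T w⟫_ℂ := rfl

omit [CompleteSpace H] in
theorem sesqForm_injective : Function.Injective (sesqForm : (H →L[ℂ] H) →ₗ[ℝ] (H → H → ℂ)) := by
  intro S T h
  ext w
  refine ext_inner_left ℂ fun v => ?_
  exact congrFun (congrFun h v) w

theorem exists_operator_of_form (B : H → H → ℂ)
    (hadd1 : ∀ u v w, B (u + v) w = B u w + B v w) (hadd2 : ∀ u v w, B u (v + w) = B u v + B u w)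
    (hsm1 : ∀ (a : ℂ) u v, B (a • u) v = (starRingEnd ℂ) a * B u v)
    (hsm2 : ∀ (a : ℂ) u v, B u (a • v) = a * B u v) {C : ℝ} (hb : ∀ u v, ‖B u v‖ ≤ C * ‖u‖ * ‖v‖) :
    ∃ T : H →L[ℂ] H, ∀ v w, ⟪v, T w⟫_ℂ = B v w := by
  let B' : H →L⋆[ℂ] H →L[ℂ] ℂ := LinearMap.mkContinuous₂
    (LinearMap.mk₂'ₛₗ (starRingEnd ℂ) (RingHom.id ℂ) B hadd1 hsm1 hadd2 hsm2) C hb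
  refine ⟨ContinuousLinearMap.adjoint (InnerProductSpace.continuousLinearMapOfBilin B'),
    fun v w => ?_⟩
  rw [ContinuousLinearMap.adjoint_inner_right, InnerProductSpace.continuousLinearMapOfBilin_apply]
  rfl

omit [CompleteSpace H] in
theorem nonneg_iff_form (T : H →L[ℂ] H) :
    0 ≤ T ↔ ∀ v, (⟪v, T v⟫_ℂ).im = 0 ∧ 0 ≤ (⟪v, T v⟫_ℂ).re := by
  rw [ContinuousLinearMap.nonneg_iff_isPositive, ContinuousLinearMap.isPositive_iff_complex]
  refine forall_congr' fun v => ?_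
  have hre : (⟪T v, v⟫_ℂ).re = (⟪v, T v⟫_ℂ).re := by
    rw [← inner_conj_symm, Complex.conj_re]
  have him : (⟪T v, v⟫_ℂ).im = -(⟪v, T v⟫_ℂ).im := by
    rw [← inner_conj_symm, Complex.conj_im]
  constructor
  · rintro ⟨h1, h2⟩
    have h3 := congrArg Complex.im h1
    rw [Complex.ofReal_im, him] at h3
    exact ⟨by linarith, h2.trans_eq hre⟩
  · rintro ⟨h1, h2⟩
    refine ⟨?_, h2.trans_eq hre.symm⟩
    apply Complex.ext
    · exact Complex.ofReal_re _
    · rw [Complex.ofReal_im, him, h1, neg_zero]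

theorem norm_le_one_of_nonneg_of_le_one {T : H →L[ℂ] H} (h0 : 0 ≤ T) (h1 : T ≤ 1) : ‖T‖ ≤ 1 :=
  (CStarAlgebra.norm_le_one_iff_of_nonneg T h0).2 h1

/-- The positive contractions of the commutant of `S` with `c * x = x` and prescribed matrix
coefficients. -/
def contractionSlice {ι : Type*} (S : Set (H →L[ℂ] H)) (c h : H →L[ℂ] H) (η : ι → H) (ξ : H) :
    Set (H →L[ℂ] H) :=
  {x | x ∈ StarSubalgebra.centralizer ℂ S ∧ 0 ≤ x ∧ x ≤ 1 ∧ c * x = x ∧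
    ∀ i, ⟪η i, x ξ⟫_ℂ = ⟪η i, h ξ⟫_ℂ}

theorem isCompact_sesqForm_contractionSlice {ι : Type*} (S : Set (H →L[ℂ] H)) (c h : H →L[ℂ] H)
    (η : ι → H) (ξ : H) : IsCompact (sesqForm '' contractionSlice S c h η ξ) := by
  let box : Set (H → H → ℂ) :=
    Set.univ.pi fun v => Set.univ.pi fun w => Metric.closedBall (0 : ℂ) (‖v‖ * ‖w‖)
  have hbox : IsCompact box :=
    isCompact_univ_pi fun v => isCompact_univ_pi fun w => isCompact_closedBall _ _
  have hev : ∀ v w : H, Continuous fun B : H → H → ℂ => B v w := fun v w =>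
    (continuous_apply w).comp (continuous_apply v)
  have heq : sesqForm '' contractionSlice S c h η ξ = box ∩ {B |
      ((∀ u v w, B (u + v) w = B u w + B v w) ∧ (∀ u v w, B u (v + w) = B u v + B u w) ∧
      (∀ (a : ℂ) u v, B (a • u) v = (starRingEnd ℂ) a * B u v) ∧
      (∀ (a : ℂ) u v, B u (a • v) = a * B u v)) ∧
      (∀ s ∈ S, ∀ v w, B (star s v) w = B v (s w) ∧ B (s v) w = B v (star s w)) ∧
      (∀ v, (B v v).im = 0 ∧ 0 ≤ (B v v).re) ∧ (∀ v, (B v v).re ≤ ‖v‖ ^ 2) ∧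
      (∀ v w, B (star c v) w = B v w) ∧ (∀ i, B (η i) ξ = ⟪η i, h ξ⟫_ℂ)} := by
    ext B
    constructor
    · rintro ⟨x, ⟨hxM, hx0, hx1, hcx, hη⟩, rfl⟩
      have hadj : ∀ (s : H →L[ℂ] H) (v w : H), ⟪star s v, w⟫_ℂ = ⟪v, s w⟫_ℂ := fun s v w => by
        rw [ContinuousLinearMap.star_eq_adjoint, ContinuousLinearMap.adjoint_inner_left]
      refine ⟨?_, ⟨?_, ?_, ?_, ?_⟩, ?_, ?_, ?_, ?_, ?_⟩
      · simp only [box, Set.mem_pi, Set.mem_univ, true_imp_iff, mem_closedBall_zero_iff,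
          sesqForm_apply]
        intro v w
        refine (norm_inner_le_norm v (x w)).trans ?_
        have := x.le_of_opNorm_le (norm_le_one_of_nonneg_of_le_one hx0 hx1) w
        rw [one_mul] at this
        gcongr
      · intro u v w; simp [sesqForm_apply]
      · intro u v w; simp [sesqForm_apply]
      · intro a u v; simp [sesqForm_apply, mul_comm]
      · intro a u v; simp [sesqForm_apply]
      · intro s hs v w
        obtain ⟨h1, h2⟩ := (StarSubalgebra.mem_centralizer_iff ℂ).1 hxM s hs
        simp only [sesqForm_apply]
        refine ⟨?_, ?_⟩
        · rw [hadj, ← mul_apply_eq_comp, h1]; rfl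
        · rw [← star_star s, hadj, ← mul_apply_eq_comp, h2, star_star]; rfl
      · exact (nonneg_iff_form x).1 hx0
      · intro v
        have := ((nonneg_iff_form (1 - x)).1 (sub_nonneg.2 hx1) v).2
        have h2 : (⟪v, v⟫_ℂ).re = ‖v‖ ^ 2 := by
          rw [inner_self_eq_norm_sq_to_K]; norm_cast
        simp [-inner_self_eq_norm_sq_to_K, h2] at this
        simpa [sesqForm_apply] using this
      · intro v w
        simp only [sesqForm_apply]
        rw [hadj, ← mul_apply_eq_comp, hcx]
      · exact hη
    · rintro ⟨hB, ⟨h1, h2, h3, h4⟩, h5, h6, h7, h8, h9⟩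
      simp only [box, Set.mem_pi, Set.mem_univ, true_imp_iff, mem_closedBall_zero_iff] at hB
      obtain ⟨x, hx⟩ := exists_operator_of_form B h1 h2 h3 h4 (C := 1) (by simpa using hB)
      have hadj : ∀ (s : H →L[ℂ] H) (v w : H), ⟪v, s w⟫_ℂ = ⟪star s v, w⟫_ℂ := fun s v w => by
        rw [ContinuousLinearMap.star_eq_adjoint, ContinuousLinearMap.adjoint_inner_left]
      refine ⟨x, ⟨?_, ?_, ?_, ?_, ?_⟩, by ext v w; exact hx v w⟩
      · rw [StarSubalgebra.mem_centralizer_iff]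
        intro s hs
        constructor <;> ext w <;> refine ext_inner_left ℂ fun v => ?_
        · simp only [mul_apply_eq_comp]
          rw [hadj, hx, hx, (h5 s hs v w).1]
        · simp only [mul_apply_eq_comp]
          rw [hadj, hx, hx, star_star, (h5 s hs v w).2]
      · rw [nonneg_iff_form]
        intro v; rw [hx]; exact h6 v
      · rw [← sub_nonneg, nonneg_iff_form]
        intro v
        have e2 : ⟪v, v⟫_ℂ = ((‖v‖ ^ 2 : ℝ) : ℂ) := by
          rw [inner_self_eq_norm_sq_to_K]; norm_cast
        have e : ⟪v, (1 - x) v⟫_ℂ = ((‖v‖ ^ 2 : ℝ) : ℂ) - B v v := by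
          rw [← e2, ← hx]; simp [-inner_self_eq_norm_sq_to_K]
        rw [e]
        have := h7 v
        refine ⟨by simp [(h6 v).1, -Complex.ofReal_pow], ?_⟩
        rw [Complex.sub_re, Complex.ofReal_re]; linarith
      · ext w; refine ext_inner_left ℂ fun v => ?_
        rw [mul_apply_eq_comp, hadj, hx, hx, h8]
      · intro i; rw [hx, h9]
  rw [heq]
  refine hbox.inter_right ?_
  simp only [Set.ofPred_and, Set.ofPred_forall]
  have hre : ∀ v w : H, Continuous fun B : H → H → ℂ => (B v w).re := fun v w =>
    Complex.continuous_re.comp (hev v w)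
  have him : ∀ v w : H, Continuous fun B : H → H → ℂ => (B v w).im := fun v w =>
    Complex.continuous_im.comp (hev v w)
  refine IsClosed.inter (IsClosed.inter ?_ (IsClosed.inter ?_ (IsClosed.inter ?_ ?_)))
    (IsClosed.inter ?_ (IsClosed.inter (isClosed_iInter fun v => IsClosed.inter ?_ ?_)
      (IsClosed.inter ?_ (IsClosed.inter ?_ ?_))))
  · exact isClosed_iInter fun u => isClosed_iInter fun v => isClosed_iInter fun w =>
      isClosed_eq (hev _ _) ((hev _ _).add (hev _ _))
  · exact isClosed_iInter fun u => isClosed_iInter fun v => isClosed_iInter fun w =>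
      isClosed_eq (hev _ _) ((hev _ _).add (hev _ _))
  · exact isClosed_iInter fun u => isClosed_iInter fun v => isClosed_iInter fun w =>
      isClosed_eq (hev _ _) ((hev _ _).const_mul _)
  · exact isClosed_iInter fun u => isClosed_iInter fun v => isClosed_iInter fun w =>
      isClosed_eq (hev _ _) ((hev _ _).const_mul _)
  · exact isClosed_iInter fun s => isClosed_iInter fun _ => isClosed_iInter fun v =>
      isClosed_iInter fun w => (isClosed_eq (hev _ _) (hev _ _)).inter
        (isClosed_eq (hev _ _) (hev _ _))
  · exact isClosed_eq (him _ _) continuous_const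
  · exact isClosed_le continuous_const (hre _ _)
  · exact isClosed_iInter fun v => isClosed_le (hre _ _) continuous_const
  · exact isClosed_iInter fun v => isClosed_iInter fun w => isClosed_eq (hev _ _) (hev _ _)
  · exact isClosed_iInter fun i => isClosed_eq (hev _ _) continuous_const

theorem mul_self_le_self {x : H →L[ℂ] H} (h0 : 0 ≤ x) (h1 : x ≤ 1) : x * x ≤ x := by
  have hx : IsSelfAdjoint x := .of_nonneg h0
  have hx' : IsSelfAdjoint (1 - x) := (IsSelfAdjoint.one _).sub hx
  have e : x - x * x = x * (1 - x) * x + (1 - x) * x * (1 - x) := by noncomm_ring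
  rw [← sub_nonneg, e]
  exact add_nonneg (hx.conjugate_nonneg (sub_nonneg.2 h1)) (hx'.conjugate_nonneg h0)

/-- Perturbations of `x` by compressions to `x - x * x` remain positive contractions. -/
theorem nonneg_add_compression {x w : H →L[ℂ] H} (h0 : 0 ≤ x) (h1 : x ≤ 1) (hw : IsSelfAdjoint w)
    (hw1 : ‖w‖ ≤ 1) :
    0 ≤ x + (x - x * x) * w * (x - x * x) ∧ x + (x - x * x) * w * (x - x * x) ≤ 1 := by
  have hx : IsSelfAdjoint x := .of_nonneg h0
  set k := x - x * x with hk
  have hk0 : 0 ≤ k := sub_nonneg.2 (mul_self_le_self h0 h1)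
  have hksa : IsSelfAdjoint k := .of_nonneg hk0
  have hkx : k ≤ x := by
    rw [hk]; exact sub_le_self _ hx.mul_self_nonneg
  have hkx' : k ≤ 1 - x := by
    have e : 1 - x - k = (1 - x) * (1 - x) := by rw [hk]; noncomm_ring
    rw [← sub_nonneg, e]
    exact ((IsSelfAdjoint.one _).sub hx).mul_self_nonneg
  have hkk : k * k ≤ k := mul_self_le_self hk0 (hkx.trans h1)
  have key : ∀ v : H →L[ℂ] H, IsSelfAdjoint v → ‖v‖ ≤ 1 → k * v * k ≤ k := by
    intro v hv hv1
    have := CStarAlgebra.star_left_conjugate_le_norm_smul (a := k) (b := v) hv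
    rw [hksa.star_eq] at this
    refine this.trans (le_trans ?_ hkk)
    calc ‖v‖ • (k * k) ≤ (1 : ℝ) • (k * k) := smul_le_smul_of_nonneg_right hv1 hksa.mul_self_nonneg
      _ = k * k := one_smul _ _
  have k1 := key w hw hw1
  have k2 := key (-w) hw.neg (by rwa [norm_neg])
  have e2 : k * -w * k = -(k * w * k) := by noncomm_ring
  rw [e2] at k2
  constructor
  · have := k2.trans hkx
    rw [← sub_nonneg] at this
    rwa [sub_neg_eq_add] at this
  · have := k1.trans hkx'
    rwa [le_sub_iff_add_le'] at this

/-- A positive contraction can be replaced, with finitely many matrix coefficients kept, by one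
which is a projection up to a finite-dimensional part. -/
theorem exists_almost_projection {ι : Type*} [Finite ι] {S : Set (H →L[ℂ] H)} {c h : H →L[ℂ] H}
    (hM : h ∈ StarSubalgebra.centralizer ℂ S) (h0 : 0 ≤ h) (h1 : h ≤ 1) (hc : c * h = h)
    (η : ι → H) (ξ : H) :
    ∃ x ∈ StarSubalgebra.centralizer ℂ S, 0 ≤ x ∧ x ≤ 1 ∧ c * x = x ∧
      (∀ i, ⟪η i, x ξ⟫_ℂ = ⟪η i, h ξ⟫_ℂ) ∧
      FiniteDimensional ℂ (compression (StarSubalgebra.centralizer ℂ S) (x - x * x)) := by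
  have _ := Fintype.ofFinite ι
  obtain ⟨B, hB⟩ := (isCompact_sesqForm_contractionSlice S c h η ξ).extremePoints_nonempty
    ⟨_, h, ⟨hM, h0, h1, hc, fun _ => rfl⟩, rfl⟩
  rw [mem_extremePoints] at hB
  obtain ⟨⟨x, ⟨hxM, hx0, hx1, hcx, hη⟩, rfl⟩, hext⟩ := hB
  refine ⟨x, hxM, hx0, hx1, hcx, hη, ?_⟩
  have hx : IsSelfAdjoint x := .of_nonneg hx0
  set M := StarSubalgebra.centralizer ℂ S with hMdef
  set k := x - x * x with hk
  have hkM : k ∈ M := sub_mem hxM (mul_mem hxM hxM)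
  have hck : c * k = k := by rw [hk, mul_sub, ← mul_assoc, hcx]
  have hksa : IsSelfAdjoint k := hx.sub (by rw [isSelfAdjoint_iff, star_mul, hx.star_eq])
  have main : ∀ w ∈ M, IsSelfAdjoint w → (∀ i, ⟪η i, (k * w * k) ξ⟫_ℂ = 0) → k * w * k = 0 := by
    intro w hw hwsa hwη
    obtain ⟨t, ht0, ht1⟩ : ∃ t : ℝ, 0 < t ∧ t * ‖w‖ ≤ 1 :=
      ⟨(‖w‖ + 1)⁻¹, by positivity, by rw [inv_mul_le_iff₀ (by positivity)]; linarith⟩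
    have hmem : ∀ s : ℝ, |s| = t → x + k * ((s : ℂ) • w) * k ∈ contractionSlice S c h η ξ := by
      intro s hs
      have hsw : IsSelfAdjoint ((s : ℂ) • w) := by
        rw [isSelfAdjoint_iff, star_smul, hwsa.star_eq]; simp
      have hn : ‖(s : ℂ) • w‖ ≤ 1 := by
        rw [norm_smul, Complex.norm_real, Real.norm_eq_abs, hs]; exact ht1
      obtain ⟨p1, p2⟩ := nonneg_add_compression hx0 hx1 hsw hn
      refine ⟨add_mem hxM (mul_mem (mul_mem hkM (M.smul_mem hw _)) hkM), p1, p2, ?_, fun i => ?_⟩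
      · rw [mul_add, hcx, ← mul_assoc, ← mul_assoc, hck]
      · rw [add_apply, inner_add_right, hη, mul_smul_comm, smul_mul_assoc,
          smul_apply, inner_smul_right, hwη, mul_zero, add_zero]
    have hE := (hext _ ⟨_, hmem t (abs_of_pos ht0), rfl⟩ _
      ⟨_, hmem (-t) (by rw [abs_neg, abs_of_pos ht0]), rfl⟩ ?_).1
    · have := sesqForm_injective hE
      rw [add_eq_left, mul_smul_comm, smul_mul_assoc] at this
      exact (smul_eq_zero.1 this).resolve_left (by exact_mod_cast ht0.ne')
    · refine ⟨1 / 2, 1 / 2, by norm_num, by norm_num, by norm_num, ?_⟩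
      rw [← map_smul, ← map_smul, ← map_add]
      congr 1
      push_cast
      rw [neg_smul, mul_neg, neg_mul, ← smul_add]
      rw [show x + k * ((t : ℂ) • w) * k + (x + -(k * ((t : ℂ) • w) * k)) = (2 : ℝ) • x by
        rw [two_smul]; abel, smul_smul]
      norm_num
  clear_value k
  let L : (H →L[ℂ] H) →ₗ[ℂ] (ι → ℂ) × (ι → ℂ) :=
    { toFun := fun T => (fun i => ⟪η i, T ξ⟫_ℂ, fun i => ⟪ξ, T (η i)⟫_ℂ)
      map_add' := fun S T => by ext i <;> simp
      map_smul' := fun a T => by ext i <;> simp }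
  refine Module.Finite.of_injective (L.domRestrict (compression M k)) ?_
  rw [← LinearMap.ker_eq_bot, Submodule.eq_bot_iff]
  rintro ⟨T, hT⟩ hT0
  obtain ⟨w, hw, rfl⟩ := mem_compression.1 hT
  have hL : L (k * w * k) = 0 := hT0
  have hL1 : ∀ i, ⟪η i, (k * w * k) ξ⟫_ℂ = 0 := fun i => congrFun (congrArg Prod.fst hL) i
  have hL2 : ∀ i, ⟪ξ, (k * w * k) (η i)⟫_ℂ = 0 := fun i => congrFun (congrArg Prod.snd hL) i
  have hst : k * star w * k = star (k * w * k) := by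
    rw [star_mul, star_mul, hksa.star_eq, mul_assoc]
  have hL3 : ∀ i, ⟪η i, (k * star w * k) ξ⟫_ℂ = 0 := fun i => by
    rw [hst, ContinuousLinearMap.star_eq_adjoint, ContinuousLinearMap.adjoint_inner_right,
      ← inner_conj_symm, hL2, map_zero]
  have r1 := main (w + star w) (add_mem hw (star_mem hw)) (IsSelfAdjoint.add_star_self w) fun i => by
    rw [mul_add, add_mul, add_apply, inner_add_right, hL1, hL3, add_zero]
  have r2 := main (Complex.I • (w - star w)) (M.smul_mem (sub_mem hw (star_mem hw)) _)
    (by rw [isSelfAdjoint_iff, star_smul, star_sub, star_star]; simp [← smul_neg]) fun i => by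
    rw [mul_smul_comm, smul_mul_assoc, smul_apply, inner_smul_right,
      mul_sub, sub_mul, sub_apply, inner_sub_right, hL1, hL3, sub_zero,
      mul_zero]
  rw [mul_smul_comm, smul_mul_assoc] at r2
  have r3 := (smul_eq_zero.1 r2).resolve_left Complex.I_ne_zero
  rw [mul_add, add_mul] at r1
  rw [mul_sub, sub_mul] at r3
  have r4 : (2 : ℂ) • (k * w * k) = 0 := by
    rw [two_smul]
    calc _ = (k * w * k + k * star w * k) + (k * w * k - k * star w * k) := by abel
      _ = 0 := by rw [r1, r3, add_zero]
  exact Subtype.ext ((smul_eq_zero.1 r4).resolve_left two_ne_zero)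
end Extreme

theorem reassoc_mul {R : Type*} [Semigroup R] {a b c : R} (h : a * b = c) (z : R) :
    a * (b * z) = c * z := by
  rw [← mul_assoc, h]

section Diffuse
variable {H : Type*} [NormedAddCommGroup H] [InnerProductSpace ℂ H] [CompleteSpace H]

/-- A real function on the self-adjoint part of the commutant of `S` which is homogeneous,
additive on orthogonal pairs and on shifts by scalars, and uniformly continuous on bounded sets
for the topology given by the matrix coefficients at `ξ`. -/
structure IsLocallyLinear (S : Set (H →L[ℂ] H)) (ξ : H) (m : (H →L[ℂ] H) → ℝ) : Prop where
  cont : ∀ r > (0 : ℝ), ∀ ε > (0 : ℝ), ∃ δ > (0 : ℝ), ∃ s : Finset H,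
    ∀ x ∈ StarSubalgebra.centralizer ℂ S, ∀ y ∈ StarSubalgebra.centralizer ℂ S,
      IsSelfAdjoint x → IsSelfAdjoint y → ‖x‖ ≤ r → ‖y‖ ≤ r →
      (∀ η ∈ s, ‖⟪η, x ξ - y ξ⟫_ℂ‖ < δ) → |m x - m y| < ε
  smul : ∀ x ∈ StarSubalgebra.centralizer ℂ S, IsSelfAdjoint x → ∀ t : ℝ, m (t • x) = t * m x
  orth : ∀ x ∈ StarSubalgebra.centralizer ℂ S, ∀ y ∈ StarSubalgebra.centralizer ℂ S,
    IsSelfAdjoint x → IsSelfAdjoint y → x * y = 0 → m (x + y) = m x + m y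
  shift : ∀ x ∈ StarSubalgebra.centralizer ℂ S, IsSelfAdjoint x → ∀ t : ℝ,
    m (x + t • 1) = m x + t * m 1

/-- The relations between two projections whose squared difference is a scalar multiple of the
unit `g` of the corner containing them. -/
theorem two_projections_relations {R : Type*} [Ring R] [Algebra ℂ R] {g P Q : R} {l : ℂ}
    (hPP : P * P = P) (hQQ : Q * Q = Q) (hPg : P * g = P) (h : (P - Q) * (P - Q) = l • g) :
    P * Q * P = (1 - l) • P := by
  have e := congrArg (fun t => P * t * P) h
  simp only [mul_smul_comm, smul_mul_assoc, hPg, hPP, mul_sub, sub_mul, mul_assoc, hQQ,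
    reassoc_mul hPP, reassoc_mul hQQ] at e
  rw [sub_smul, one_smul, ← e, mul_assoc]
  abel

theorem two_projections_commute {R : Type*} [Ring R] [Algebra ℂ R] {g P Q m : R} {l : ℂ}
    (hPP : P * P = P) (hQQ : Q * Q = Q) (hPg : P * g = P) (hgP : g * P = P) (hQg : Q * g = Q)
    (hgQ : g * Q = Q)
    (h1 : P * Q * P = (1 - l) • P) (h2 : Q * P * Q = (1 - l) • Q) (hPm : P * m = m)
    (hmP : m * P = m) :
    Q * ((l * (1 - l)) • m + (g - P) * Q * m * Q * (g - P)) =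
      ((l * (1 - l)) • m + (g - P) * Q * m * Q * (g - P)) * Q := by
  have a1 : P * (Q * m) = (1 - l) • m := by
    rw [← hPm, ← mul_assoc, ← mul_assoc, h1, smul_mul_assoc]
  have a2 : m * (Q * P) = (1 - l) • m := by
    rw [← hmP, mul_assoc, ← mul_assoc P, h1, mul_smul_comm, hmP]
  have a3 : Q * (P * (Q * (m * Q))) = (1 - l) • (Q * (m * Q)) := by
    rw [← mul_assoc, ← mul_assoc, h2, smul_mul_assoc]
  have a1' : ∀ z, P * (Q * (m * z)) = (1 - l) • (m * z) := fun z => by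
    rw [← smul_mul_assoc, ← a1]; simp only [mul_assoc]
  have a2' : ∀ z, m * (Q * (P * z)) = (1 - l) • (m * z) := fun z => by
    rw [← smul_mul_assoc, ← a2]; simp only [mul_assoc]
  simp only [mul_smul_comm, smul_mul_assoc, mul_sub, sub_mul, mul_assoc, mul_add, add_mul, hQQ,
    reassoc_mul hQQ, hgQ, hQg, reassoc_mul hgQ, reassoc_mul hQg, hPP, reassoc_mul hPP, a1, a2, a1',
    a2', smul_sub]
  module

theorem exists_minimal_of_two_projections {S : Set (H →L[ℂ] H)} {p q g : H →L[ℂ] H}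
    (hpM : p ∈ StarSubalgebra.centralizer ℂ S) (hqM : q ∈ StarSubalgebra.centralizer ℂ S)
    (hp : IsStarProjection p) (hq : IsStarProjection q)
    (hg : IsMinimalProjection (StarSubalgebra.centralizer ℂ (S ∪ {p, q})) g) :
    ∃ e, IsMinimalProjection (StarSubalgebra.centralizer ℂ S) e ∧ ∀ c, c * g = g → c * e = e := by
  set M := StarSubalgebra.centralizer ℂ S with hM
  have hN : ∀ x, x ∈ StarSubalgebra.centralizer ℂ (S ∪ {p, q}) ↔
      x ∈ M ∧ p * x = x * p ∧ q * x = x * q := by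
    intro x
    simp only [hM, StarSubalgebra.mem_centralizer_iff, Set.mem_union, Set.mem_insert_iff,
      Set.mem_singleton_iff]
    constructor
    · intro h
      exact ⟨fun g hg => h g (Or.inl hg), (h p (by simp)).1, (h q (by simp)).1⟩
    · rintro ⟨h1, h2, h3⟩ z (hz | rfl | rfl)
      · exact h1 z hz
      · rw [hp.isSelfAdjoint.star_eq]; exact ⟨h2, h2⟩
      · rw [hq.isSelfAdjoint.star_eq]; exact ⟨h3, h3⟩
  obtain ⟨hgN, hgp, hg0, hgs⟩ := hg
  obtain ⟨hgM, hpg, hqg⟩ := (hN g).1 hgN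
  have hgg : g * g = g := hgp.isIdempotentElem
  have hpp : p * p = p := hp.isIdempotentElem
  have hqq : q * q = q := hq.isIdempotentElem
  obtain ⟨P, hP⟩ : ∃ P, P = g * p := ⟨_, rfl⟩
  obtain ⟨Q, hQ⟩ : ∃ Q, Q = g * q := ⟨_, rfl⟩
  have hPM : P ∈ M := hP ▸ mul_mem hgM hpM
  have hQM : Q ∈ M := hQ ▸ mul_mem hgM hqM
  have hPP : P * P = P := by
    rw [hP, mul_assoc, ← mul_assoc p, hpg, mul_assoc, hpp, ← mul_assoc, hgg]
  have hQQ : Q * Q = Q := by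
    rw [hQ, mul_assoc, ← mul_assoc q, hqg, mul_assoc, hqq, ← mul_assoc, hgg]
  have hgP : g * P = P := by rw [hP, ← mul_assoc, hgg]
  have hgQ : g * Q = Q := by rw [hQ, ← mul_assoc, hgg]
  have hPg : P * g = P := by rw [hP, mul_assoc, hpg, ← mul_assoc, hgg]
  have hQg : Q * g = Q := by rw [hQ, mul_assoc, hqg, ← mul_assoc, hgg]
  have hPsa : star P = P := by
    rw [hP, star_mul, hp.isSelfAdjoint.star_eq, hgp.isSelfAdjoint.star_eq, hpg]
  have hQsa : star Q = Q := by
    rw [hQ, star_mul, hq.isSelfAdjoint.star_eq, hgp.isSelfAdjoint.star_eq, hqg]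
  have hpx : ∀ x, g * x = x → p * x = P * x := fun x hx => by
    rw [hP, ← hpg, mul_assoc, hx]
  have hxp : ∀ x, x * g = x → x * p = x * P := fun x hx => by
    rw [hP, ← mul_assoc, hx]
  have hqx : ∀ x, g * x = x → q * x = Q * x := fun x hx => by
    rw [hQ, ← hqg, mul_assoc, hx]
  have hxq : ∀ x, x * g = x → x * q = x * Q := fun x hx => by
    rw [hQ, ← mul_assoc, hx]
  have hcorner : ∀ x ∈ M, g * x = x → x * g = x → P * x = x * P → Q * x = x * Q →
      ∃ t : ℂ, x = t • g := by
    intro x hx h1 h2 h3 h4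
    obtain ⟨t, ht⟩ := hgs x ((hN x).2 ⟨hx, by rw [hpx x h1, hxp x h2, h3],
      by rw [hqx x h1, hxq x h2, h4]⟩)
    exact ⟨t, by rw [← ht, h1, h2]⟩
  have hidem : ∀ x ∈ M, g * x = x → x * g = x → P * x = x * P → Q * x = x * Q → x * x = x →
      x = 0 ∨ x = g := by
    intro x hx h1 h2 h3 h4 h5
    obtain ⟨t, rfl⟩ := hcorner x hx h1 h2 h3 h4
    rcases eq_or_ne t 0 with rfl | ht
    · left; rw [zero_smul]
    · right
      rw [smul_mul_assoc, mul_smul_comm, hgg, smul_smul] at h5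
      have : (t * t - t) • g = 0 := by rw [sub_smul, h5, sub_self]
      have h6 := (smul_eq_zero.1 this).resolve_right hg0
      have h7 : t = 1 := by
        have : t * (t - 1) = 0 := by linear_combination h6
        exact sub_eq_zero.1 ((mul_eq_zero.1 this).resolve_left ht)
      rw [h7, one_smul]
  by_cases hcomm : P * Q = Q * P
  · refine ⟨g, ⟨hgM, hgp, hg0, fun m hm => ?_⟩, fun c hc => hc⟩
    have h0g : ∀ E, E = 0 ∨ E = g → E * (g * m * g) = g * m * g * E := by
      rintro E (rfl | rfl)
      · simp
      · simp only [mul_assoc, hgg, reassoc_mul hgg]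
    exact hcorner _ (mul_mem (mul_mem hgM hm) hgM) (by simp only [mul_assoc, reassoc_mul hgg])
      (by simp only [mul_assoc, hgg]) (h0g P (hidem P hPM hgP hPg rfl hcomm.symm hPP))
      (h0g Q (hidem Q hQM hgQ hQg hcomm rfl hQQ))
  · obtain ⟨l, hl⟩ := hcorner ((P - Q) * (P - Q)) (mul_mem (sub_mem hPM hQM) (sub_mem hPM hQM))
      (by rw [← mul_assoc, mul_sub g, hgP, hgQ]) (by rw [mul_assoc, sub_mul P Q g, hPg, hQg])
      (by simp only [mul_sub, sub_mul, mul_assoc, hPP, hQQ, reassoc_mul hPP, reassoc_mul hQQ]; abel)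
      (by simp only [mul_sub, sub_mul, mul_assoc, hPP, hQQ, reassoc_mul hPP, reassoc_mul hQQ]; abel)
    have h1 := two_projections_relations hPP hQQ hPg hl
    have h2 : Q * P * Q = (1 - l) • Q :=
      two_projections_relations hQQ hPP hQg (by rw [← neg_sub P Q, neg_mul_neg, hl])
    have hl1 : 1 - l ≠ 0 := by
      intro h0
      rw [h0, zero_smul] at h1
      have : star (Q * P) * (Q * P) = 0 := by
        rw [star_mul, hPsa, hQsa, mul_assoc, ← mul_assoc Q, hQQ, ← mul_assoc, h1]
      have h3 := (CStarRing.star_mul_self_eq_zero_iff _).1 this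
      have h4 := congrArg star h3
      rw [star_mul, hPsa, hQsa, star_zero] at h4
      exact hcomm (by rw [h3, h4])
    have hl0 : l ≠ 0 := by
      rintro rfl
      rw [sub_zero, one_smul] at h1
      have : star (Q * P - P) * (Q * P - P) = 0 := by
        rw [star_sub, star_mul, hPsa, hQsa]
        simp only [mul_sub, sub_mul, mul_assoc, hPP, reassoc_mul hQQ]
        rw [← mul_assoc, h1]; abel
      have h3 := sub_eq_zero.1 ((CStarRing.star_mul_self_eq_zero_iff _).1 this)
      have h4 := congrArg star h3
      rw [star_mul, hPsa, hQsa] at h4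
      exact hcomm (by rw [h3, h4])
    refine ⟨P, ⟨hPM, ⟨hPP, hPsa⟩, ?_, fun m hm => ?_⟩, fun c hc => by rw [hP, ← mul_assoc, hc]⟩
    · rintro rfl; simp at hcomm
    · obtain ⟨m₀, hm₀⟩ : ∃ m₀, m₀ = P * m * P := ⟨_, rfl⟩
      have hm₀M : m₀ ∈ M := hm₀ ▸ mul_mem (mul_mem hPM hm) hPM
      have hPm : P * m₀ = m₀ := by rw [hm₀, ← mul_assoc, ← mul_assoc, hPP]
      have hmP : m₀ * P = m₀ := by rw [hm₀, mul_assoc _ P, hPP]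
      have hgm : g * m₀ = m₀ := by rw [← hPm, ← mul_assoc, hgP]
      have hmg : m₀ * g = m₀ := by rw [← hmP, mul_assoc, hPg]
      obtain ⟨t, ht⟩ := hcorner ((l * (1 - l)) • m₀ + (g - P) * Q * m₀ * Q * (g - P))
        (add_mem (M.smul_mem hm₀M _) (mul_mem (mul_mem (mul_mem (mul_mem (sub_mem hgM hPM) hQM)
          hm₀M) hQM) (sub_mem hgM hPM)))
        (by simp only [mul_add, mul_smul_comm, hgm, mul_sub, sub_mul, mul_assoc, reassoc_mul hgg,
              reassoc_mul hgP])
        (by simp only [add_mul, smul_mul_assoc, hmg, mul_sub, sub_mul, mul_assoc, hgg, hPg])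
        (by simp only [mul_add, add_mul, smul_mul_assoc, mul_smul_comm, hPm, hmP, mul_sub, sub_mul,
              mul_assoc, hPg, hgP, hPP, reassoc_mul hPg, reassoc_mul hPP, sub_self])
        (two_projections_commute hPP hQQ hPg hgP hQg hgQ h1 h2 hPm hmP)
      have h5 := congrArg (fun z => P * z * P) ht
      simp only [mul_add, add_mul, smul_mul_assoc, mul_smul_comm, hPm, hmP, mul_sub, sub_mul,
              mul_assoc, hPg, hgP, hPP, reassoc_mul hPg, reassoc_mul hPP, sub_self, add_zero] at h5
      refine ⟨(l * (1 - l))⁻¹ * t, ?_⟩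
      rw [← hm₀, mul_smul, ← h5, smul_smul, show l * 1 - l * l = l * (1 - l) by ring,
        inv_mul_cancel₀ (mul_ne_zero hl0 hl1), one_smul]


/-- A positive contraction under a projection `c` that dominates no minimal projection can be
replaced by a projection with the same matrix coefficients. -/
theorem exists_projection_of_diffuse {ι : Type*} [Finite ι] {S : Set (H →L[ℂ] H)}
    {c h : H →L[ℂ] H}
    (hc : ∀ e, IsMinimalProjection (StarSubalgebra.centralizer ℂ S) e → c * e ≠ e)
    (hM : h ∈ StarSubalgebra.centralizer ℂ S) (h0 : 0 ≤ h) (h1 : h ≤ 1) (hch : c * h = h)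
    (η : ι → H) (ξ : H) :
    ∃ p ∈ StarSubalgebra.centralizer ℂ S, IsStarProjection p ∧ c * p = p ∧
      ∀ i, ⟪η i, p ξ⟫_ℂ = ⟪η i, h ξ⟫_ℂ := by
  obtain ⟨x, hxM, hx0, hx1, hcx, hx, hfin⟩ := exists_almost_projection hM h0 h1 hch η ξ
  have hxsa : IsSelfAdjoint x := .of_nonneg hx0
  refine ⟨x, hxM, ⟨?_, hxsa⟩, hcx, hx⟩
  by_contra hne
  have hk : x - x * x ≠ 0 := fun h => hne (sub_eq_zero.1 h).symm
  obtain ⟨e, he, hce⟩ := exists_minimal_of_finiteDimensional_compression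
    (show x - x * x ∈ StarSubalgebra.centralizer ℂ S from sub_mem hxM (mul_mem hxM hxM))
    (hxsa.sub (by rw [isSelfAdjoint_iff, star_mul, hxsa.star_eq])) hk
  exact hc e he (hce c (by rw [mul_sub, ← mul_assoc, hcx]))

theorem norm_two_smul_mul_le {p e : H →L[ℂ] H} (hp : IsStarProjection p)
    (he : IsStarProjection e) : ‖(2 : ℝ) • (p * e)‖ ≤ 2 := by
  rw [norm_smul]
  have := norm_mul_le p e
  have h1 := hp.norm_le
  have h2 := he.norm_le
  have : ‖p * e‖ ≤ 1 := this.trans (mul_le_one₀ h1 (norm_nonneg _) h2)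
  norm_num; linarith

/-- Additivity on positive contractions under a projection dominating no minimal projection. -/
theorem IsLocallyLinear.add_of_diffuse {S : Set (H →L[ℂ] H)} {ξ : H} {m : (H →L[ℂ] H) → ℝ}
    (hm : IsLocallyLinear S ξ m) {c : H →L[ℂ] H} (hcM : c ∈ StarSubalgebra.centralizer ℂ S)
    (hcp : IsStarProjection c)
    (hc : ∀ e, IsMinimalProjection (StarSubalgebra.centralizer ℂ S) e → c * e ≠ e)
    {x y : H →L[ℂ] H} (hx : x ∈ StarSubalgebra.centralizer ℂ S)
    (hy : y ∈ StarSubalgebra.centralizer ℂ S) (hx0 : 0 ≤ x) (hx1 : x ≤ 1) (hcx : c * x = x)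
    (hy0 : 0 ≤ y) (hy1 : y ≤ 1) (hcy : c * y = y) : m (x + y) = m x + m y := by
  refine eq_of_forall_dist_le fun ε hε => ?_
  rw [Real.dist_eq]
  obtain ⟨δ, hδ, s, hs⟩ := hm.cont 4 (by norm_num) (ε / 3) (by positivity)
  set M := StarSubalgebra.centralizer ℂ S with hMdef
  obtain ⟨p, hpM, hp, hcp', hpη⟩ := exists_projection_of_diffuse hc hx hx0 hx1 hcx
    (fun η : s => (η : H)) ξ
  obtain ⟨q, hqM, hq, hcq', hqη⟩ := exists_projection_of_diffuse hc hy hy0 hy1 hcy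
    (fun η : s => (η : H)) ξ
  have hpc : p * c = p := by
    have := congrArg star hcp'
    rwa [star_mul, hp.isSelfAdjoint.star_eq, hcp.isSelfAdjoint.star_eq] at this
  have hqc : q * c = q := by
    have := congrArg star hcq'
    rwa [star_mul, hq.isSelfAdjoint.star_eq, hcp.isSelfAdjoint.star_eq] at this
  have hcc : c * c = c := hcp.isIdempotentElem
  have hN : ∀ x, x ∈ StarSubalgebra.centralizer ℂ (S ∪ {p, q}) ↔
      x ∈ M ∧ p * x = x * p ∧ q * x = x * q := by
    intro x
    simp only [hMdef, StarSubalgebra.mem_centralizer_iff, Set.mem_union, Set.mem_insert_iff,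
      Set.mem_singleton_iff]
    constructor
    · intro h
      exact ⟨fun g hg => h g (Or.inl hg), (h p (by simp)).1, (h q (by simp)).1⟩
    · rintro ⟨h1, h2, h3⟩ z (hz | rfl | rfl)
      · exact h1 z hz
      · rw [hp.isSelfAdjoint.star_eq]; exact ⟨h2, h2⟩
      · rw [hq.isSelfAdjoint.star_eq]; exact ⟨h3, h3⟩
  have hcN : ∀ e, IsMinimalProjection (StarSubalgebra.centralizer ℂ (S ∪ {p, q})) e →
      c * e ≠ e := by
    intro e he hce
    obtain ⟨e', he', hce'⟩ := exists_minimal_of_two_projections hpM hqM hp hq he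
    exact hc e' he' (hce' c hce)
  have hc0 : 0 ≤ c := hcp.nonneg
  have hc1 : c ≤ 1 := hcp.le_one
  obtain ⟨e, heN, he, hce, heη⟩ := exists_projection_of_diffuse (S := S ∪ {p, q}) hcN
    (h := (1 / 2 : ℝ) • c)
    (by
      have : c ∈ StarSubalgebra.centralizer ℂ (S ∪ {p, q}) :=
        (hN c).2 ⟨hcM, by rw [hpc, hcp'], by rw [hqc, hcq']⟩
      have h2 := (StarSubalgebra.centralizer ℂ (S ∪ {p, q})).smul_mem this ((1 / 2 : ℝ) : ℂ)
      rwa [Complex.coe_smul] at h2)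
    (smul_nonneg (by norm_num) hc0)
    (by
      calc (1 / 2 : ℝ) • c ≤ (1 : ℝ) • c := smul_le_smul_of_nonneg_right (by norm_num) hc0
        _ = c := one_smul _ _
        _ ≤ 1 := hc1)
    (by rw [mul_smul_comm, hcc])
    (Sum.elim (fun η : s => p η) (fun η : s => q η)) ξ
  obtain ⟨heM, hpe, hqe⟩ := (hN e).1 heN
  have hec : e * c = e := by
    have := congrArg star hce
    rwa [star_mul, he.isSelfAdjoint.star_eq, hcp.isSelfAdjoint.star_eq] at this
  have hee : e * e = e := he.isIdempotentElem
  have hadj : ∀ r : H →L[ℂ] H, IsSelfAdjoint r → ∀ v w, ⟪r v, w⟫_ℂ = ⟪v, r w⟫_ℂ := by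
    intro r hr v w
    nth_rw 1 [← hr.star_eq]
    rw [ContinuousLinearMap.star_eq_adjoint, ContinuousLinearMap.adjoint_inner_left]
  have hcesP : IsStarProjection (c - e) := by
    refine ⟨?_, hcp.isSelfAdjoint.sub he.isSelfAdjoint⟩
    rw [IsIdempotentElem, mul_sub, sub_mul, sub_mul, hcc, hce, hec, hee]; abel
  set a : H →L[ℂ] H := (2 : ℝ) • (p * e) with ha
  set b : H →L[ℂ] H := (2 : ℝ) • (q * (c - e)) with hb
  have haM : a ∈ M := by
    have := M.smul_mem (mul_mem hpM heM : p * e ∈ M) ((2 : ℝ) : ℂ)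
    rwa [Complex.coe_smul] at this
  have hbM : b ∈ M := by
    have := M.smul_mem (mul_mem hqM (sub_mem hcM heM) : q * (c - e) ∈ M) ((2 : ℝ) : ℂ)
    rwa [Complex.coe_smul] at this
  have hasa : IsSelfAdjoint a := by
    rw [isSelfAdjoint_iff, ha, star_smul, star_mul, hp.isSelfAdjoint.star_eq,
      he.isSelfAdjoint.star_eq, hpe]; simp
  have hbsa : IsSelfAdjoint b := by
    rw [isSelfAdjoint_iff, hb, star_smul, star_mul, hq.isSelfAdjoint.star_eq,
      hcesP.isSelfAdjoint.star_eq, mul_sub, sub_mul, hqe, hqc, hcq']; simp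
  have hab : a * b = 0 := by
    rw [ha, hb, smul_mul_smul_comm, mul_assoc, ← mul_assoc e, ← hqe, mul_assoc, mul_sub, hec, hee,
      sub_self, mul_zero, mul_zero, smul_zero]
  have haη : ∀ η ∈ s, ⟪η, a ξ⟫_ℂ = ⟪η, x ξ⟫_ℂ := by
    intro η hη
    have h1 := heη (Sum.inl ⟨η, hη⟩)
    have h2 := hpη ⟨η, hη⟩
    simp only [Sum.elim_inl] at h1
    rw [hadj p hp.isSelfAdjoint, hadj p hp.isSelfAdjoint, ← mul_apply_eq_comp p (_ • c),
      mul_smul_comm, smul_apply, hpc, ← Complex.coe_smul, inner_smul_right, h2] at h1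
    rw [ha, smul_apply, ← Complex.coe_smul, inner_smul_right, mul_apply_eq_comp, h1]
    push_cast; ring
  have hbη : ∀ η ∈ s, ⟪η, b ξ⟫_ℂ = ⟪η, y ξ⟫_ℂ := by
    intro η hη
    have h1 := heη (Sum.inr ⟨η, hη⟩)
    have h2 := hqη ⟨η, hη⟩
    simp only [Sum.elim_inr] at h1
    rw [hadj q hq.isSelfAdjoint, hadj q hq.isSelfAdjoint, ← mul_apply_eq_comp q (_ • c),
      mul_smul_comm, smul_apply, hqc, ← Complex.coe_smul, inner_smul_right, h2] at h1
    rw [hb, smul_apply, ← Complex.coe_smul, inner_smul_right, mul_sub, sub_apply, inner_sub_right,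
      mul_apply_eq_comp q e, h1, hqc, h2]
    push_cast; ring
  have hna : ‖a‖ ≤ 2 := norm_two_smul_mul_le hp he
  have hnb : ‖b‖ ≤ 2 := norm_two_smul_mul_le hq hcesP
  have hnx := norm_le_one_of_nonneg_of_le_one hx0 hx1
  have hny := norm_le_one_of_nonneg_of_le_one hy0 hy1
  have hxsa : IsSelfAdjoint x := .of_nonneg hx0
  have hysa : IsSelfAdjoint y := .of_nonneg hy0
  have r1 := hs x hx a haM hxsa hasa (by linarith) (by linarith) fun η hη => by
    rw [inner_sub_right, haη η hη, sub_self, norm_zero]; exact hδ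
  have r2 := hs y hy b hbM hysa hbsa (by linarith) (by linarith) fun η hη => by
    rw [inner_sub_right, hbη η hη, sub_self, norm_zero]; exact hδ
  have r3 := hs (x + y) (add_mem hx hy) (a + b) (add_mem haM hbM) (hxsa.add hysa) (hasa.add hbsa)
    (by linarith [norm_add_le x y]) (by linarith [norm_add_le a b]) fun η hη => by
      rw [inner_sub_right, add_apply, add_apply, inner_add_right, inner_add_right, haη η hη,
        hbη η hη, sub_self, norm_zero]
      exact hδ
  rw [hm.orth a haM b hbM hasa hbsa hab] at r3
  rw [abs_lt] at r1 r2 r3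
  rw [abs_le]
  constructor <;> linarith
end Diffuse

section Atomic
variable {H : Type*} [NormedAddCommGroup H] [InnerProductSpace ℂ H] [CompleteSpace H]

namespace IsLocallyLinear
variable {S : Set (H →L[ℂ] H)} {ξ : H} {m : (H →L[ℂ] H) → ℝ}

theorem norm_cont (hm : IsLocallyLinear S ξ m) {r : ℝ} (hr : 0 < r) {ε : ℝ} (hε : 0 < ε) :
    ∃ δ > (0 : ℝ), ∀ x ∈ StarSubalgebra.centralizer ℂ S, ∀ y ∈ StarSubalgebra.centralizer ℂ S,
      IsSelfAdjoint x → IsSelfAdjoint y → ‖x‖ ≤ r → ‖y‖ ≤ r → ‖x ξ - y ξ‖ < δ →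
        |m x - m y| < ε := by
  obtain ⟨δ, hδ, s, hs⟩ := hm.cont r hr ε hε
  have hpos : 0 < 1 + ∑ η ∈ s, ‖η‖ := by positivity
  refine ⟨δ / (1 + ∑ η ∈ s, ‖η‖), by positivity, fun x hx y hy hxs hys hxr hyr h => ?_⟩
  refine hs x hx y hy hxs hys hxr hyr fun η hη => ?_
  rw [lt_div_iff₀ hpos] at h
  refine lt_of_le_of_lt (norm_inner_le_norm _ _) (lt_of_le_of_lt ?_ h)
  rw [mul_comm]
  have : ‖η‖ ≤ ∑ η ∈ s, ‖η‖ :=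
    Finset.single_le_sum (f := fun η : H => ‖η‖) (fun _ _ => norm_nonneg _) hη
  exact mul_le_mul_of_nonneg_left (by linarith) (norm_nonneg _)

theorem zero (hm : IsLocallyLinear S ξ m) : m 0 = 0 := by
  have := hm.smul 0 (zero_mem _) (IsSelfAdjoint.zero _) 0
  simpa using this

theorem sum {ι : Type*} (hm : IsLocallyLinear S ξ m) (s : Finset ι) (x : ι → H →L[ℂ] H)
    (hx : ∀ i, x i ∈ StarSubalgebra.centralizer ℂ S) (hsa : ∀ i, IsSelfAdjoint (x i))
    (horth : ∀ i j, i ≠ j → x i * x j = 0) : m (∑ i ∈ s, x i) = ∑ i ∈ s, m (x i) := by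
  classical
  induction s using Finset.induction_on with
  | empty => simpa using hm.zero
  | insert a s ha ih =>
    rw [Finset.sum_insert ha, Finset.sum_insert ha, ← ih]
    refine hm.orth _ (hx a) _ (sum_mem fun i _ => hx i) (hsa a) ?_ ?_
    · rw [isSelfAdjoint_iff, star_sum]
      exact Finset.sum_congr rfl fun i _ => (hsa i).star_eq
    · rw [Finset.mul_sum]
      exact Finset.sum_eq_zero fun i hi => horth a i fun h => ha (h ▸ hi)

end IsLocallyLinear

/-- A linear family of partial isometries (up to scaling) with initial projection `e`. -/
structure IsCornerFrame (S : Set (H →L[ℂ] H)) {E : Type*} [NormedAddCommGroup E]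
    [InnerProductSpace ℂ E] (e : H →L[ℂ] H) (Y : E →ₗ[ℂ] (H →L[ℂ] H)) : Prop where
  mem : ∀ v, Y v ∈ StarSubalgebra.centralizer ℂ S
  mul_right : ∀ v, Y v * e = Y v
  star_mul : ∀ v w, star (Y v) * Y w = ⟪v, w⟫_ℂ • e

namespace IsCornerFrame
variable {S : Set (H →L[ℂ] H)} {E : Type*} [NormedAddCommGroup E] [InnerProductSpace ℂ E]
  {e : H →L[ℂ] H} {Y : E →ₗ[ℂ] (H →L[ℂ] H)}

/-- The final projection of an orthonormal family. -/
noncomputable def final {ι : Type*} [Fintype ι] (Y : E →ₗ[ℂ] (H →L[ℂ] H)) (b : OrthonormalBasis ι ℂ E) :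
    H →L[ℂ] H := ∑ i, Y (b i) * star (Y (b i))

variable {ι κ : Type*} [Fintype ι] [Fintype κ]

theorem final_mem (hY : IsCornerFrame S e Y) (b : OrthonormalBasis ι ℂ E) :
    final Y b ∈ StarSubalgebra.centralizer ℂ S :=
  sum_mem fun i _ => mul_mem (hY.mem _) (star_mem (hY.mem _))

theorem star_final (b : OrthonormalBasis ι ℂ E) : star (final Y b) = final Y b := by
  simp [final, star_sum]

theorem final_mul (hY : IsCornerFrame S e Y) (b : OrthonormalBasis ι ℂ E) (v : E) :
    final Y b * Y v = Y v := by
  conv_rhs => rw [← b.sum_repr' v, map_sum]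
  rw [final, Finset.sum_mul]
  refine Finset.sum_congr rfl fun i _ => ?_
  rw [mul_assoc, hY.star_mul, mul_smul_comm, hY.mul_right, map_smul]

theorem final_mul_final (hY : IsCornerFrame S e Y) (b : OrthonormalBasis ι ℂ E)
    (b' : OrthonormalBasis κ ℂ E) : final Y b * final Y b' = final Y b' := by
  conv_lhs => rw [final.eq_def Y b', Finset.mul_sum]
  conv_rhs => rw [final.eq_def Y b']
  exact Finset.sum_congr rfl fun i _ => by rw [← mul_assoc, hY.final_mul]

theorem final_eq_final (hY : IsCornerFrame S e Y) (b : OrthonormalBasis ι ℂ E)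
    (b' : OrthonormalBasis κ ℂ E) : final Y b = final Y b' := by
  have h := congrArg star (hY.final_mul_final b' b)
  rw [StarMul.star_mul, star_final, star_final] at h
  rw [← h, hY.final_mul_final]

theorem isStarProjection_final (hY : IsCornerFrame S e Y) (b : OrthonormalBasis ι ℂ E) :
    IsStarProjection (final Y b) := ⟨hY.final_mul_final b b, star_final b⟩

theorem norm_eq (hY : IsCornerFrame S e Y) {ζ : H} (heζ : e ζ = ζ) (he : IsStarProjection e)
    (hζ : ‖ζ‖ = 1) (v : E) : ‖Y v‖ = ‖v‖ := by
  have h1 : ‖e‖ = 1 := by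
    refine le_antisymm he.norm_le ?_
    have := e.le_opNorm ζ
    rwa [heζ, hζ, mul_one] at this
  have h := CStarRing.norm_star_mul_self (x := Y v)
  rw [hY.star_mul, norm_smul, h1, mul_one, inner_self_eq_norm_sq_to_K] at h
  have h2 : ‖v‖ * ‖v‖ = ‖Y v‖ * ‖Y v‖ := by
    rw [← h]; simp [sq]
  exact ((mul_self_inj (norm_nonneg _) (norm_nonneg _)).1 h2).symm

variable [FiniteDimensional ℂ E] {ξ ζ : H} {m : (H →L[ℂ] H) → ℝ}

/-- The compression of an operator to the coefficient space. -/
noncomputable def coeff (Y : E →ₗ[ℂ] (H →L[ℂ] H)) (ζ : H) : (H →L[ℂ] H) →ₗ[ℝ] (E →L[ℂ] E) :=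
  let J : E →L[ℂ] H := LinearMap.toContinuousLinearMap
    ((ContinuousLinearMap.apply ℂ H ζ).toLinearMap ∘ₗ Y)
  { toFun := fun x => J.adjoint ∘L x ∘L J
    map_add' := fun x y => by ext v; simp
    map_smul' := fun t x => by ext v; simp }

theorem inner_coeff (x : H →L[ℂ] H) (v w : E) :
    ⟪v, coeff Y ζ x w⟫_ℂ = ⟪Y v ζ, x (Y w ζ)⟫_ℂ := by
  simp [coeff, ContinuousLinearMap.adjoint_inner_right]

theorem star_mul_mul (hY : IsCornerFrame S e Y)
    (he : IsMinimalProjection (StarSubalgebra.centralizer ℂ S) e) (heζ : e ζ = ζ) (hζ : ‖ζ‖ = 1)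
    {x : H →L[ℂ] H} (hx : x ∈ StarSubalgebra.centralizer ℂ S) (v w : E) :
    star (Y v) * x * Y w = ⟪v, coeff Y ζ x w⟫_ℂ • e := by
  obtain ⟨t, ht⟩ := he.scalar (star (Y v) * x * Y w)
    (mul_mem (mul_mem (star_mem (hY.mem v)) hx) (hY.mem w))
  have h1 : e * star (Y v) = star (Y v) := by
    rw [← he.proj.isSelfAdjoint.star_eq, ← StarMul.star_mul, hY.mul_right]
  have h2 : star (Y v) * x * Y w = t • e := by
    rw [← ht, ← mul_assoc, ← mul_assoc, h1, mul_assoc _ (Y w), hY.mul_right]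
  rw [h2, inner_coeff]
  congr 1
  have h3 := congrArg (fun T : H →L[ℂ] H => ⟪ζ, T ζ⟫_ℂ) h2
  simp only [mul_apply_eq_comp, smul_apply, heζ, inner_smul_right,
    ContinuousLinearMap.star_eq_adjoint, ContinuousLinearMap.adjoint_inner_right,
    inner_self_eq_norm_sq_to_K, hζ] at h3
  rw [h3]; simp

theorem final_mul_mul (hY : IsCornerFrame S e Y)
    (he : IsMinimalProjection (StarSubalgebra.centralizer ℂ S) e) (heζ : e ζ = ζ) (hζ : ‖ζ‖ = 1)
    {x : H →L[ℂ] H} (hx : x ∈ StarSubalgebra.centralizer ℂ S) (b : OrthonormalBasis ι ℂ E) (w : E) :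
    final Y b * x * Y w = Y (coeff Y ζ x w) := by
  conv_rhs => rw [← b.sum_repr' (coeff Y ζ x w), map_sum]
  rw [final, Finset.sum_mul, Finset.sum_mul]
  refine Finset.sum_congr rfl fun i _ => ?_
  rw [mul_assoc, mul_assoc, ← mul_assoc (star _), hY.star_mul_mul he heζ hζ hx, mul_smul_comm,
    hY.mul_right, map_smul]

theorem isLinear_compression (hY : IsCornerFrame S e Y) (hm : IsLocallyLinear S ξ m)
    (he : IsMinimalProjection (StarSubalgebra.centralizer ℂ S) e) (heζ : e ζ = ζ) (hζ : ‖ζ‖ = 1)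
    (hE : Module.finrank ℂ E ≠ 2) (b : OrthonormalBasis ι ℂ E) :
    ∃ ℓ : (E →L[ℂ] E) →ₗ[ℝ] ℝ, ∀ x ∈ StarSubalgebra.centralizer ℂ S, IsSelfAdjoint x →
      m (final Y b * x * final Y b) = ℓ (coeff Y ζ x) := by
  have hrank : ∀ v, Y v * star (Y v) ∈ StarSubalgebra.centralizer ℂ S := fun v =>
    mul_mem (hY.mem v) (star_mem (hY.mem v))
  have hrank_sa : ∀ v, IsSelfAdjoint (Y v * star (Y v)) := fun v => IsSelfAdjoint.mul_star_self _
  have hYc : Continuous Y := Y.continuous_of_finiteDimensional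
  have hF : Continuous fun v => m (Y v * star (Y v)) := by
    rw [Metric.continuous_iff]
    intro v ε hε
    obtain ⟨δ, hδ, h⟩ := hm.norm_cont (r := (‖v‖ + 1) * (‖v‖ + 1)) (by positivity) hε
    have hc : Continuous fun v => (Y v * star (Y v)) ξ :=
      (ContinuousLinearMap.apply ℂ H ξ).continuous.comp (hYc.mul (continuous_star.comp hYc))
    obtain ⟨δ', hδ', h'⟩ := Metric.continuous_iff.1 hc v δ hδ
    refine ⟨min δ' 1, lt_min hδ' one_pos, fun w hw => ?_⟩
    have hn : ∀ u, ‖u‖ ≤ ‖v‖ + 1 → ‖Y u * star (Y u)‖ ≤ (‖v‖ + 1) * (‖v‖ + 1) := fun u hu => by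
      rw [CStarRing.norm_self_mul_star, hY.norm_eq heζ he.proj hζ]
      gcongr
    refine h _ (hrank w) _ (hrank v) (hrank_sa w) (hrank_sa v) (hn w ?_) (hn v (by linarith)) ?_
    · have := (lt_min_iff.1 hw).2
      rw [dist_eq_norm] at this
      linarith [norm_sub_norm_le w v]
    · have := h' w (lt_min_iff.1 hw).1
      rwa [dist_eq_norm] at this
  have horth : ∀ {κ : Type} [Fintype κ] (b : OrthonormalBasis κ ℂ E) (i j), i ≠ j →
      (Y (b i) * star (Y (b i))) * (Y (b j) * star (Y (b j))) = 0 := by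
    intro κ _ b i j hij
    rw [mul_assoc, ← mul_assoc (star _), hY.star_mul, b.orthonormal.2 hij, zero_smul, zero_mul,
      mul_zero]
  obtain ⟨ℓ, hℓ⟩ := gleason_continuous hE hF (W := m (final Y b))
    (fun c v hc => by
      simp only [map_smul, star_smul, smul_mul_smul_comm]
      have : c * star c = 1 := by
        rw [Complex.star_def, Complex.mul_conj, Complex.normSq_eq_norm_sq, hc]; simp
      rw [this, one_smul])
    (fun b' => by
      rw [hY.final_eq_final b b', final,
        hm.sum _ _ (fun i => hrank _) (fun i => hrank_sa _) (horth b')])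
  refine ⟨ℓ, fun x hx hxsa => ?_⟩
  set T := coeff Y ζ x with hT
  have hsym : T.toLinearMap.IsSymmetric := by
    intro v w
    change ⟪T v, w⟫_ℂ = ⟪v, T w⟫_ℂ
    rw [← inner_conj_symm, hT, inner_coeff, inner_coeff, inner_conj_symm]
    nth_rw 1 [← hxsa.star_eq]
    rw [ContinuousLinearMap.star_eq_adjoint, ContinuousLinearMap.adjoint_inner_left]
  obtain ⟨b', hb'⟩ : ∃ b', b' = hsym.eigenvectorBasis rfl := ⟨_, rfl⟩
  obtain ⟨l, hl⟩ : ∃ l, l = hsym.eigenvalues rfl := ⟨_, rfl⟩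
  have hTb : ∀ i, T (b' i) = (l i : ℂ) • b' i := fun i => by
    rw [hb', hl]; exact hsym.apply_eigenvectorBasis rfl i
  have e1 : final Y b * x * final Y b = ∑ i, l i • (Y (b' i) * star (Y (b' i))) := by
    rw [hY.final_eq_final b b']
    nth_rw 2 [final]
    rw [Finset.mul_sum]
    refine Finset.sum_congr rfl fun i _ => ?_
    rw [← mul_assoc, hY.final_mul_mul he heζ hζ hx, ← hT, hTb, map_smul, smul_mul_assoc,
      Complex.coe_smul]
  have e2 : T = ∑ i, l i • InnerProductSpace.rankOne ℂ (b' i) (b' i) := by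
    ext v
    conv_lhs => rw [← b'.sum_repr' v, map_sum]
    rw [sum_apply]
    refine Finset.sum_congr rfl fun i _ => ?_
    rw [map_smul, hTb, smul_comm]
    simp
  rw [e1, e2, map_sum, hm.sum _ _ (fun i => ?_) (fun i => ?_) (fun i j hij => ?_)]
  · refine Finset.sum_congr rfl fun i _ => ?_
    rw [map_smul, hm.smul _ (hrank _) (hrank_sa _), hℓ _ (b'.orthonormal.1 i), smul_eq_mul]
  · have := (StarSubalgebra.centralizer ℂ S).smul_mem (hrank (b' i)) ((l i : ℝ) : ℂ)
    rwa [Complex.coe_smul] at this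
  · exact (IsSelfAdjoint.all (l i)).smul (hrank_sa _)
  · rw [smul_mul_smul_comm, horth b' i j hij, smul_zero]

end IsCornerFrame

end Atomic

section CentralCover
variable {H : Type*} [NormedAddCommGroup H] [InnerProductSpace ℂ H] [CompleteSpace H]

/-- The orbit of a vector under the commutant of `S`. -/
noncomputable def orbit (S : Set (H →L[ℂ] H)) (ζ : H) : Submodule ℂ H :=
  (Subalgebra.toSubmodule (StarSubalgebra.centralizer ℂ S).toSubalgebra).map
    (ContinuousLinearMap.apply ℂ H ζ).toLinearMap

theorem mem_orbit {S : Set (H →L[ℂ] H)} {ζ v : H} :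
    v ∈ orbit S ζ ↔ ∃ u ∈ StarSubalgebra.centralizer ℂ S, u ζ = v := by
  simp [orbit]

theorem exists_cornerFrame {S : Set (H →L[ℂ] H)} {e : H →L[ℂ] H} {ζ : H}
    (he : IsMinimalProjection (StarSubalgebra.centralizer ℂ S) e) (heζ : e ζ = ζ) (hζ : ‖ζ‖ = 1) :
    ∃ Y : orbit S ζ →ₗ[ℂ] (H →L[ℂ] H), IsCornerFrame S e Y ∧ (∀ v, Y v ζ = v) ∧
      ∀ (v : orbit S ζ), ∀ u ∈ StarSubalgebra.centralizer ℂ S, u ζ = v → Y v = u * e := by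
  have hstar : ∀ u ∈ StarSubalgebra.centralizer ℂ S, ∀ w ∈ StarSubalgebra.centralizer ℂ S,
      star (u * e) * (w * e) = ⟪u ζ, w ζ⟫_ℂ • e := by
    intro u hu w hw
    obtain ⟨t, ht⟩ := he.scalar (star u * w) (mul_mem (star_mem hu) hw)
    rw [star_mul, he.proj.isSelfAdjoint.star_eq, mul_assoc, ← mul_assoc (star u), ← mul_assoc, ht]
    congr 1
    have h3 := congrArg (fun T : H →L[ℂ] H => ⟪ζ, T ζ⟫_ℂ) ht
    have h4 : ⟪ζ, e ((star u) (w ζ))⟫_ℂ = ⟪u ζ, w ζ⟫_ℂ := by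
      nth_rw 1 [← he.proj.isSelfAdjoint.star_eq]
      rw [ContinuousLinearMap.star_eq_adjoint, ContinuousLinearMap.adjoint_inner_right, heζ,
        ContinuousLinearMap.star_eq_adjoint, ContinuousLinearMap.adjoint_inner_right]
    simp only [mul_apply_eq_comp, smul_apply, heζ, inner_smul_right, h4,
      inner_self_eq_norm_sq_to_K, hζ] at h3
    rw [h3]; simp
  have huniq : ∀ u ∈ StarSubalgebra.centralizer ℂ S, ∀ w ∈ StarSubalgebra.centralizer ℂ S,
      u ζ = w ζ → u * e = w * e := by
    intro u hu w hw h
    have := hstar (u - w) (sub_mem hu hw) (u - w) (sub_mem hu hw)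
    rw [sub_apply, h, sub_self, inner_zero_left, zero_smul] at this
    have := (CStarRing.star_mul_self_eq_zero_iff _).1 this
    rw [sub_mul] at this
    exact sub_eq_zero.1 this
  choose f hfM hf using fun v : orbit S ζ => mem_orbit.1 v.2
  refine ⟨{ toFun := fun v => f v * e, map_add' := fun v w => ?_, map_smul' := fun a v => ?_ },
    ⟨fun v => mul_mem (hfM v) he.mem, fun v => ?_, fun v w => ?_⟩, fun v => ?_,
    fun v u hu huv => ?_⟩
  · rw [← add_mul]
    exact huniq _ (hfM _) _ (add_mem (hfM _) (hfM _)) (by rw [add_apply, hf, hf, hf]; rfl)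
  · rw [RingHom.id_apply, ← smul_mul_assoc]
    exact huniq _ (hfM _) _ ((StarSubalgebra.centralizer ℂ S).smul_mem (hfM _) _)
      (by rw [smul_apply, hf, hf]; rfl)
  · change f v * e * e = f v * e
    rw [mul_assoc, he.proj.isIdempotentElem.eq]
  · change star (f v * e) * (f w * e) = _
    rw [hstar _ (hfM _) _ (hfM _), hf, hf]; rfl
  · change (f v * e) ζ = v
    rw [mul_apply_eq_comp, heζ, hf]
  · exact huniq _ (hfM _) _ hu (by rw [hf, huv])

omit [CompleteSpace H] in
theorem exists_finiteDimensional_ge {K L₀ : Submodule ℂ H} [FiniteDimensional ℂ L₀] (hL : L₀ ≤ K)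
    (hK : Module.finrank ℂ K ≠ 2) :
    ∃ L : Submodule ℂ H, FiniteDimensional ℂ L ∧ L₀ ≤ L ∧ L ≤ K ∧ Module.finrank ℂ L ≠ 2 := by
  by_cases h2 : Module.finrank ℂ L₀ = 2
  · have hne : L₀ ≠ K := fun h => hK (h ▸ h2)
    obtain ⟨v, hvK, hv⟩ := SetLike.exists_of_lt (lt_of_le_of_ne hL hne)
    refine ⟨L₀ ⊔ Submodule.span ℂ {v}, inferInstance, le_sup_left,
      sup_le hL ((Submodule.span_singleton_le_iff_mem _ _).2 hvK), fun h => hv ?_⟩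
    have := Submodule.eq_of_le_of_finrank_eq (le_sup_left : L₀ ≤ L₀ ⊔ Submodule.span ℂ {v})
      (by rw [h2, h])
    rw [this]
    exact (le_sup_right : _ ≤ L₀ ⊔ Submodule.span ℂ {v}) (Submodule.mem_span_singleton_self v)
  · exact ⟨L₀, inferInstance, le_rfl, hL, h2⟩

/-- The orthogonal projection onto the closure of a subspace. -/
noncomputable def closureProjection (V : Submodule ℂ H) : H →L[ℂ] H :=
  haveI : CompleteSpace V.topologicalClosure := V.isClosed_topologicalClosure.completeSpace_coe
  V.topologicalClosure.starProjection

theorem isStarProjection_closureProjection (V : Submodule ℂ H) :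
    IsStarProjection (closureProjection V) := by
  have : CompleteSpace V.topologicalClosure := V.isClosed_topologicalClosure.completeSpace_coe
  exact isStarProjection_starProjection

theorem closureProjection_apply_mem (V : Submodule ℂ H) (v : H) :
    closureProjection V v ∈ closure (V : Set H) := by
  have : CompleteSpace V.topologicalClosure := V.isClosed_topologicalClosure.completeSpace_coe
  exact V.topologicalClosure.starProjection_apply_mem v

theorem closureProjection_apply_of_mem {V : Submodule ℂ H} {v : H} (hv : v ∈ V) :
    closureProjection V v = v := by
  have : CompleteSpace V.topologicalClosure := V.isClosed_topologicalClosure.completeSpace_coe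
  exact Submodule.starProjection_eq_self_iff.2 (V.le_topologicalClosure hv)

theorem closureProjection_comm {V : Submodule ℂ H} {T : H →L[ℂ] H} (h : ∀ v ∈ V, T v ∈ V)
    (h' : ∀ v ∈ V, star T v ∈ V) : T * closureProjection V = closureProjection V * T := by
  have : CompleteSpace V.topologicalClosure := V.isClosed_topologicalClosure.completeSpace_coe
  have hW : ∀ v ∈ V.topologicalClosure, T v ∈ V.topologicalClosure := fun v hv =>
    map_mem_closure T.continuous hv h
  have hW' : ∀ v ∈ V.topologicalClosure, star T v ∈ V.topologicalClosure := fun v hv =>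
    map_mem_closure (star T).continuous hv h'
  ext v
  rw [mul_apply_eq_comp, mul_apply_eq_comp]
  symm
  refine Submodule.eq_starProjection_of_mem_orthogonal (hW _ ?_) ?_ |>.symm ▸ rfl
  · exact Submodule.starProjection_apply_mem _ v
  · rw [Submodule.mem_orthogonal]
    intro u hu
    have := Submodule.sub_starProjection_mem_orthogonal (K := V.topologicalClosure) v
    rw [Submodule.mem_orthogonal] at this
    have h2 := this _ (hW' u hu)
    rw [ContinuousLinearMap.star_eq_adjoint, ContinuousLinearMap.adjoint_inner_left, map_sub] at h2
    exact h2

/-- Two projections `E ≤ c` with `E` fixing a vector close to `c η` are close at `η`. -/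
theorem norm_sub_le_of_fixed {c E : H →L[ℂ] H} (hE : IsStarProjection E) (hEc : E * c = E)
    {η v : H} (hv : E v = v) : ‖E η - c η‖ ≤ 2 * ‖c η - v‖ := by
  have e : E η - c η = E (c η - v) - (c η - v) := by
    rw [map_sub, hv, ← mul_apply_eq_comp, hEc]; abel
  have h1 := E.le_of_opNorm_le hE.norm_le (c η - v)
  calc ‖E η - c η‖ ≤ ‖E (c η - v)‖ + ‖c η - v‖ := by rw [e]; exact norm_sub_le _ _
    _ ≤ _ := by linarith

theorem norm_mul_mul_le {E x : H →L[ℂ] H} (hE : IsStarProjection E) : ‖E * x * E‖ ≤ ‖x‖ := by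
  have h1 := hE.norm_le
  calc ‖E * x * E‖ ≤ ‖E * x‖ * ‖E‖ := norm_mul_le _ _
    _ ≤ ‖E‖ * ‖x‖ * ‖E‖ := by gcongr; exact norm_mul_le _ _
    _ ≤ 1 * ‖x‖ * 1 := by gcongr
    _ = ‖x‖ := by ring

/-- Central projections over which `m` is additive. -/
structure IsAdditiveProjection (S : Set (H →L[ℂ] H)) (m : (H →L[ℂ] H) → ℝ) (c : H →L[ℂ] H) :
    Prop where
  mem : c ∈ StarSubalgebra.centralizer ℂ S
  proj : IsStarProjection c
  comm : ∀ x ∈ StarSubalgebra.centralizer ℂ S, c * x = x * c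
  add : ∀ x ∈ StarSubalgebra.centralizer ℂ S, ∀ y ∈ StarSubalgebra.centralizer ℂ S,
    IsSelfAdjoint x → IsSelfAdjoint y → m (c * x + c * y) = m (c * x) + m (c * y)

theorem IsLocallyLinear.isAdditiveProjection_of_approx {S : Set (H →L[ℂ] H)} {ξ : H}
    {m : (H →L[ℂ] H) → ℝ} (hm : IsLocallyLinear S ξ m) {c : H →L[ℂ] H}
    (hcM : c ∈ StarSubalgebra.centralizer ℂ S) (hc : IsStarProjection c)
    (hcomm : ∀ x ∈ StarSubalgebra.centralizer ℂ S, c * x = x * c)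
    (happ : ∀ ε > (0 : ℝ), ∀ u v w : H, ∃ E ∈ StarSubalgebra.centralizer ℂ S, IsStarProjection E ∧
      E * c = E ∧ ‖E u - c u‖ ≤ ε ∧ ‖E v - c v‖ ≤ ε ∧ ‖E w - c w‖ ≤ ε ∧
      ∀ x ∈ StarSubalgebra.centralizer ℂ S, ∀ y ∈ StarSubalgebra.centralizer ℂ S,
        IsSelfAdjoint x → IsSelfAdjoint y →
        m (E * x * E + E * y * E) = m (E * x * E) + m (E * y * E)) :
    IsAdditiveProjection S m c := by
  refine ⟨hcM, hc, hcomm, fun x hx y hy hxsa hysa => ?_⟩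
  refine eq_of_forall_dist_le fun ε hε => ?_
  rw [Real.dist_eq]
  have hr : 0 < ‖x‖ + ‖y‖ + 1 := by positivity
  obtain ⟨δ, hδ, hs⟩ := hm.norm_cont hr (ε := ε / 3) (by positivity)
  obtain ⟨t, ht0, ht⟩ : ∃ t > 0, (‖x‖ + ‖y‖ + 2) * t < δ :=
    ⟨δ / (‖x‖ + ‖y‖ + 3), by positivity, by
      rw [← mul_div_assoc, div_lt_iff₀ (by positivity), mul_comm]; gcongr; norm_num⟩
  obtain ⟨E, hEM, hE, hEc, h1, h2, h3, hadd⟩ := happ t ht0 ξ (x ξ) (y ξ)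
  have hcn : ∀ z, ‖c * z‖ ≤ ‖z‖ := fun z => (norm_mul_le _ _).trans
    (mul_le_of_le_one_left (norm_nonneg _) hc.norm_le)
  have hEn : ∀ z, ‖E * z‖ ≤ ‖z‖ := fun z => (norm_mul_le _ _).trans
    (mul_le_of_le_one_left (norm_nonneg _) hE.norm_le)
  have hcsa : ∀ z ∈ StarSubalgebra.centralizer ℂ S, IsSelfAdjoint z → IsSelfAdjoint (c * z) :=
    fun z hz hzsa => by
      rw [isSelfAdjoint_iff, star_mul, hzsa.star_eq, hc.isSelfAdjoint.star_eq, hcomm z hz]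
  have hEsa : ∀ z, IsSelfAdjoint z → IsSelfAdjoint (E * z * E) := fun z hz => by
    rw [isSelfAdjoint_iff, star_mul, star_mul, hz.star_eq, hE.isSelfAdjoint.star_eq, mul_assoc]
  have key : ∀ z ∈ StarSubalgebra.centralizer ℂ S, ‖E (z ξ) - c (z ξ)‖ ≤ t →
      ‖(E * z * E) ξ - (c * z) ξ‖ ≤ (‖z‖ + 1) * t := by
    intro z hz h
    have e : (E * z * E) ξ - (c * z) ξ = (E * z) (E ξ - c ξ) + (E (z ξ) - c (z ξ)) := by
      have : (E * z) (c ξ) = E (z ξ) := by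
        rw [← mul_apply_eq_comp, mul_assoc, ← hcomm z hz, ← mul_assoc, hEc, mul_apply_eq_comp]
      rw [map_sub, this]
      simp only [mul_apply_eq_comp]; abel
    rw [e]
    refine (norm_add_le _ _).trans ?_
    have := (E * z).le_of_opNorm_le (hEn z) (E ξ - c ξ)
    have h5 : ‖z‖ * ‖E ξ - c ξ‖ ≤ ‖z‖ * t := by gcongr
    linarith
  have kx := key x hx h2
  have ky := key y hy h3
  have hEM' : ∀ z ∈ StarSubalgebra.centralizer ℂ S, E * z * E ∈ StarSubalgebra.centralizer ℂ S :=
    fun z hz => mul_mem (mul_mem hEM hz) hEM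
  have nx := norm_nonneg x
  have ny := norm_nonneg y
  have r1 := hs _ (hEM' x hx) _ (mul_mem hcM hx) (hEsa x hxsa) (hcsa x hx hxsa)
    (by linarith [norm_mul_mul_le (x := x) hE]) (by linarith [hcn x])
    (lt_of_le_of_lt kx (lt_of_le_of_lt 
      (mul_le_mul_of_nonneg_right (by linarith) ht0.le) ht))
  have r2 := hs _ (hEM' y hy) _ (mul_mem hcM hy) (hEsa y hysa) (hcsa y hy hysa)
    (by linarith [norm_mul_mul_le (x := y) hE]) (by linarith [hcn y])
    (lt_of_le_of_lt ky (lt_of_le_of_lt 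
      (mul_le_mul_of_nonneg_right (by linarith) ht0.le) ht))
  have r3 := hs _ (add_mem (hEM' x hx) (hEM' y hy)) _ (add_mem (mul_mem hcM hx) (mul_mem hcM hy))
    ((hEsa x hxsa).add (hEsa y hysa)) ((hcsa x hx hxsa).add (hcsa y hy hysa))
    (by linarith [norm_mul_mul_le (x := x) hE, norm_mul_mul_le (x := y) hE,
      norm_add_le (E * x * E) (E * y * E)])
    (by linarith [hcn x, hcn y, norm_add_le (c * x) (c * y)])
    (by
      refine lt_of_le_of_lt ?_ ht
      rw [add_apply, add_apply, add_sub_add_comm]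
      refine (norm_add_le _ _).trans ?_
      linarith)
  rw [hadd x hx y hy hxsa hysa] at r3
  rw [abs_lt] at r1 r2 r3
  rw [abs_le]
  constructor <;> linarith

/-- Every minimal projection lies under a central projection over which `m` is additive. -/
theorem IsLocallyLinear.exists_isAdditiveProjection_ge {S : Set (H →L[ℂ] H)} {ξ : H}
    {m : (H →L[ℂ] H) → ℝ} (hm : IsLocallyLinear S ξ m) {e : H →L[ℂ] H}
    (he : IsMinimalProjection (StarSubalgebra.centralizer ℂ S) e)
    (hrank : ∀ ζ, e ζ = ζ → ‖ζ‖ = 1 → Module.finrank ℂ (orbit S ζ) ≠ 2) :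
    ∃ c, IsAdditiveProjection S m c ∧ c * e = e := by
  obtain ⟨ζ, heζ, hζ⟩ : ∃ ζ, e ζ = ζ ∧ ‖ζ‖ = 1 := by
    obtain ⟨v, hv⟩ : ∃ v, e v ≠ 0 := by
      by_contra! h
      exact he.ne_zero (by ext v; simp [h v])
    have hev : e (e v) = e v := by
      rw [← mul_apply_eq_comp, he.proj.isIdempotentElem.eq]
    refine ⟨((‖e v‖⁻¹ : ℝ) : ℂ) • e v, by rw [map_smul, hev], ?_⟩
    rw [norm_smul, Complex.norm_real, norm_inv, norm_norm, inv_mul_cancel₀ (norm_ne_zero_iff.2 hv)]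
  obtain ⟨Y, hY, hYζ, hYu⟩ := exists_cornerFrame he heζ hζ
  set M := StarSubalgebra.centralizer ℂ S with hM
  let V : Submodule ℂ H := Submodule.span ℂ {v | ∃ u ∈ M, ∃ w, v = u (e w)}
  have hVinv : ∀ T : H →L[ℂ] H, (∀ u ∈ M, ∀ w, T (u (e w)) ∈ V) → ∀ v ∈ V, T v ∈ V := by
    intro T hT v hv
    induction hv using Submodule.span_induction with
    | mem v h => obtain ⟨u, hu, w, rfl⟩ := h; exact hT u hu w
    | zero => rw [map_zero]; exact V.zero_mem
    | add v w _ _ h1 h2 => rw [map_add]; exact V.add_mem h1 h2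
    | smul a v _ h => rw [map_smul]; exact V.smul_mem _ h
  have hgen : ∀ u ∈ M, ∀ w, u (e w) ∈ V := fun u hu w => Submodule.subset_span ⟨u, hu, w, rfl⟩
  have hVM : ∀ T ∈ M, ∀ v ∈ V, T v ∈ V := fun T hT => hVinv T fun u hu w => by
    rw [← mul_apply_eq_comp]; exact hgen _ (mul_mem hT hu) w
  have hVS : ∀ T : H →L[ℂ] H, (∀ u ∈ M, T * u = u * T) → ∀ v ∈ V, T v ∈ V := fun T hT =>
    hVinv T fun u hu w => by
      have : T (u (e w)) = u (e (T w)) := by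
        simp only [← mul_apply_eq_comp]
        rw [← mul_assoc, hT u hu, mul_assoc, hT e he.mem]
      rw [this]; exact hgen u hu _
  have hcM : closureProjection V ∈ M := by
    rw [hM, StarSubalgebra.mem_centralizer_iff]
    intro g hg
    have h1 : ∀ u ∈ M, g * u = u * g := fun u hu =>
      ((StarSubalgebra.mem_centralizer_iff ℂ).1 hu g hg).1
    have h2 : ∀ u ∈ M, star g * u = u * star g := fun u hu =>
      ((StarSubalgebra.mem_centralizer_iff ℂ).1 hu g hg).2
    exact ⟨closureProjection_comm (hVS g h1) (hVS _ h2),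
      closureProjection_comm (hVS _ h2) (by rw [star_star]; exact hVS g h1)⟩
  have hproj := isStarProjection_closureProjection V
  have hcV : ∀ u ∈ M, closureProjection V * (u * e) = u * e := fun u hu => by
    ext w
    exact closureProjection_apply_of_mem (hgen u hu w)
  refine ⟨closureProjection V, hm.isAdditiveProjection_of_approx hcM hproj
    (fun x hx => (closureProjection_comm (hVM x hx) (hVM _ (star_mem hx))).symm) ?_,
    by simpa using hcV 1 (one_mem _)⟩
  have hfix : ∀ v ∈ V, ∃ t : Set (H →L[ℂ] H), t.Finite ∧ t ⊆ M ∧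
      ∀ E : H →L[ℂ] H, (∀ u ∈ t, E * (u * e) = u * e) → E v = v := by
    intro v hv
    induction hv using Submodule.span_induction with
    | mem v h =>
      obtain ⟨u, hu, w, rfl⟩ := h
      refine ⟨{u}, Set.finite_singleton u, Set.singleton_subset_iff.2 hu, fun E hE => ?_⟩
      exact congrArg (fun T : H →L[ℂ] H => T w) (hE u rfl)
    | zero => exact ⟨∅, Set.finite_empty, Set.empty_subset _, fun E _ => map_zero E⟩
    | add v w _ _ h1 h2 =>
      obtain ⟨t, ht, htM, h⟩ := h1
      obtain ⟨t', ht', htM', h'⟩ := h2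
      refine ⟨t ∪ t', ht.union ht', Set.union_subset htM htM', fun E hE => ?_⟩
      rw [map_add, h E fun u hu => hE u (Or.inl hu), h' E fun u hu => hE u (Or.inr hu)]
    | smul a v _ h =>
      obtain ⟨t, ht, htM, h⟩ := h
      exact ⟨t, ht, htM, fun E hE => by rw [map_smul, h E hE]⟩
  intro ε hε η₁ η₂ η₃
  have hclose : ∀ η, ∃ v ∈ V, 2 * ‖closureProjection V η - v‖ ≤ ε := fun η => by
    obtain ⟨v, hv, h⟩ := Metric.mem_closure_iff.1 (closureProjection_apply_mem V η) (ε / 2)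
      (by positivity)
    rw [dist_eq_norm] at h
    exact ⟨v, hv, by linarith⟩
  obtain ⟨v₁, hv₁, hd₁⟩ := hclose η₁
  obtain ⟨v₂, hv₂, hd₂⟩ := hclose η₂
  obtain ⟨v₃, hv₃, hd₃⟩ := hclose η₃
  obtain ⟨t₁, ht₁, hM₁, h₁⟩ := hfix v₁ hv₁
  obtain ⟨t₂, ht₂, hM₂, h₂⟩ := hfix v₂ hv₂
  obtain ⟨t₃, ht₃, hM₃, h₃⟩ := hfix v₃ hv₃
  let t := t₁ ∪ t₂ ∪ t₃
  have ht : t.Finite := (ht₁.union ht₂).union ht₃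
  have htM : t ⊆ M := Set.union_subset (Set.union_subset hM₁ hM₂) hM₃
  let L₀ : Submodule ℂ H := Submodule.span ℂ ((fun u : H →L[ℂ] H => u ζ) '' t)
  have hL₀ : FiniteDimensional ℂ L₀ := FiniteDimensional.span_of_finite ℂ (ht.image _)
  have hL₀K : L₀ ≤ orbit S ζ := Submodule.span_le.2 (by
    rintro _ ⟨u, hu, rfl⟩; exact mem_orbit.2 ⟨u, htM hu, rfl⟩)
  obtain ⟨L, hL, hL₀L, hLK, hL2⟩ := exists_finiteDimensional_ge hL₀K (hrank ζ heζ hζ)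
  have hYL : IsCornerFrame S e (Y ∘ₗ Submodule.inclusion hLK) :=
    ⟨fun v => hY.mem _, fun v => hY.mul_right _, fun v w => hY.star_mul _ _⟩
  let b := stdOrthonormalBasis ℂ L
  have hEproj := hYL.isStarProjection_final b
  have hEu : ∀ u ∈ t, IsCornerFrame.final (Y ∘ₗ Submodule.inclusion hLK) b * (u * e) = u * e := by
    intro u hu
    have := hYL.final_mul b ⟨u ζ, hL₀L (Submodule.subset_span ⟨u, hu, rfl⟩)⟩
    rwa [LinearMap.comp_apply, hYu _ u (htM hu) rfl] at this
  have hcE : closureProjection V * IsCornerFrame.final (Y ∘ₗ Submodule.inclusion hLK) b =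
      IsCornerFrame.final (Y ∘ₗ Submodule.inclusion hLK) b := by
    rw [IsCornerFrame.final, Finset.mul_sum]
    refine Finset.sum_congr rfl fun i _ => ?_
    rw [← mul_assoc, ← hYL.mul_right, hcV _ (hYL.mem _)]
  have hEc : IsCornerFrame.final (Y ∘ₗ Submodule.inclusion hLK) b * closureProjection V =
      IsCornerFrame.final (Y ∘ₗ Submodule.inclusion hLK) b := by
    have := congrArg star hcE
    rwa [star_mul, hEproj.isSelfAdjoint.star_eq, hproj.isSelfAdjoint.star_eq] at this
  refine ⟨_, hYL.final_mem b, hEproj, hEc,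
    (norm_sub_le_of_fixed hEproj hEc (h₁ _ fun u hu => hEu u (Or.inl (Or.inl hu)))).trans hd₁,
    (norm_sub_le_of_fixed hEproj hEc (h₂ _ fun u hu => hEu u (Or.inl (Or.inr hu)))).trans hd₂,
    (norm_sub_le_of_fixed hEproj hEc (h₃ _ fun u hu => hEu u (Or.inr hu))).trans hd₃, ?_⟩
  obtain ⟨ℓ, hℓ⟩ := hYL.isLinear_compression hm he heζ hζ hL2 b
  intro x hx y hy hxsa hysa
  rw [hℓ x hx hxsa, hℓ y hy hysa, ← map_add, ← map_add, ← hℓ _ (add_mem hx hy) (hxsa.add hysa),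
    mul_add, add_mul]

end CentralCover

section Additivity
variable {H : Type*} [NormedAddCommGroup H] [InnerProductSpace ℂ H] [CompleteSpace H]
variable {S : Set (H →L[ℂ] H)} {ξ : H} {m : (H →L[ℂ] H) → ℝ}

theorem IsSelfAdjoint.mul_of_comm {c x : H →L[ℂ] H} (hc : IsSelfAdjoint c) (hx : IsSelfAdjoint x)
    (h : c * x = x * c) : IsSelfAdjoint (c * x) := by
  rw [isSelfAdjoint_iff, star_mul, hc.star_eq, hx.star_eq, h]

theorem IsLocallyLinear.isAdditiveProjection_zero (hm : IsLocallyLinear S ξ m) :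
    IsAdditiveProjection S m 0 :=
  ⟨zero_mem _, IsStarProjection.zero _, fun x _ => by simp, fun x _ y _ _ _ => by
    simp [hm.zero]⟩

/-- Splitting along a central projection. -/
theorem IsLocallyLinear.split (hm : IsLocallyLinear S ξ m) {c x : H →L[ℂ] H}
    (hcM : c ∈ StarSubalgebra.centralizer ℂ S) (hc : IsStarProjection c)
    (hx : x ∈ StarSubalgebra.centralizer ℂ S) (hxsa : IsSelfAdjoint x) (h : c * x = x * c) :
    m x = m (c * x) + m ((1 - c) * x) := by
  have h' : (1 - c) * x = x * (1 - c) := by rw [sub_mul, mul_sub, h, one_mul, mul_one]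
  have hcc := hc.isIdempotentElem.eq
  rw [← hm.orth _ (mul_mem hcM hx) _ (mul_mem (sub_mem (one_mem _) hcM) hx)
    (hc.isSelfAdjoint.mul_of_comm hxsa h) (hc.one_sub.isSelfAdjoint.mul_of_comm hxsa h')]
  · rw [sub_mul, one_mul, add_sub_cancel]
  · rw [h, mul_assoc, ← mul_assoc c, mul_sub, mul_one, hcc, sub_self, zero_mul, mul_zero]

theorem IsLocallyLinear.isAdditiveProjection_sup (hm : IsLocallyLinear S ξ m) {c d : H →L[ℂ] H}
    (hc : IsAdditiveProjection S m c) (hd : IsAdditiveProjection S m d) :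
    IsAdditiveProjection S m (c + (1 - c) * d) := by
  have hcc := hc.proj.isIdempotentElem.eq
  have hdd := hd.proj.isIdempotentElem.eq
  have hcd := hc.comm d hd.mem
  have h1c : (1 - c) ∈ StarSubalgebra.centralizer ℂ S := sub_mem (one_mem _) hc.mem
  have hccd : c * ((1 - c) * d) = 0 := by
    rw [← mul_assoc, mul_sub, mul_one, hcc, sub_self, zero_mul]
  have hprod : IsStarProjection ((1 - c) * d) := by
    refine ⟨?_, hc.proj.one_sub.isSelfAdjoint.mul_of_comm hd.proj.isSelfAdjoint
      (by rw [sub_mul, mul_sub, hcd, one_mul, mul_one])⟩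
    have e : d * (1 - c) = (1 - c) * d := by rw [sub_mul, mul_sub, hcd, one_mul, mul_one]
    rw [IsIdempotentElem, mul_assoc, ← mul_assoc d, e, mul_assoc, hdd, ← mul_assoc,
      hc.proj.one_sub.isIdempotentElem.eq]
  have hmem : c + (1 - c) * d ∈ StarSubalgebra.centralizer ℂ S :=
    add_mem hc.mem (mul_mem h1c hd.mem)
  have hproj : IsStarProjection (c + (1 - c) * d) := hc.proj.add hprod hccd
  have hcomm : ∀ x ∈ StarSubalgebra.centralizer ℂ S,
      (c + (1 - c) * d) * x = x * (c + (1 - c) * d) := fun x hx => by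
    have h1 := hc.comm x hx
    have h2 := hd.comm x hx
    have h3 : (1 - c) * x = x * (1 - c) := by rw [sub_mul, mul_sub, h1, one_mul, mul_one]
    rw [add_mul, mul_add, h1, mul_assoc, h2, ← mul_assoc, h3, mul_assoc]
  refine ⟨hmem, hproj, hcomm, fun x hx y hy hxsa hysa => ?_⟩
  have hsa : ∀ x ∈ StarSubalgebra.centralizer ℂ S, IsSelfAdjoint x →
      IsSelfAdjoint ((1 - c) * x) := fun x hx h =>
    hc.proj.one_sub.isSelfAdjoint.mul_of_comm h
      (by rw [sub_mul, mul_sub, hc.comm x hx, one_mul, mul_one])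
  have key : ∀ x ∈ StarSubalgebra.centralizer ℂ S, IsSelfAdjoint x →
      m ((c + (1 - c) * d) * x) = m (c * x) + m (d * ((1 - c) * x)) := fun x hx hxsa => by
    rw [hm.split hc.mem hc.proj (mul_mem hmem hx)
      (hproj.isSelfAdjoint.mul_of_comm hxsa (hcomm x hx)) (hc.comm _ (mul_mem hmem hx))]
    have e1 : c * ((c + (1 - c) * d) * x) = c * x := by
      rw [← mul_assoc, mul_add, hcc, hccd, add_zero]
    have e2 : (1 - c) * ((c + (1 - c) * d) * x) = d * ((1 - c) * x) := by
      rw [← mul_assoc, ← mul_assoc, mul_add, ← mul_assoc, hc.proj.one_sub.isIdempotentElem.eq,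
        sub_mul, one_mul, hcc, sub_self, zero_add, sub_mul, mul_sub, hcd, one_mul, mul_one]
    rw [e1, e2]
  have hx' := mul_mem h1c hx
  have hy' := mul_mem h1c hy
  rw [← mul_add, key _ (add_mem hx hy) (hxsa.add hysa), key x hx hxsa, key y hy hysa, mul_add,
    mul_add, mul_add, hc.add x hx y hy hxsa hysa,
    hd.add _ hx' _ hy' (hsa x hx hxsa) (hsa y hy hysa)]
  ring

omit [CompleteSpace H] in
theorem IsAdditiveProjection.sup_apply_left {c d : H →L[ℂ] H}
    {v : H} (hv : c v = v) (hd : c * d = d * c) : (c + (1 - c) * d) v = v := by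
  rw [add_apply, sub_mul, one_mul, sub_apply, hd, mul_apply_eq_comp, hv]; abel

omit [CompleteSpace H] in
theorem IsAdditiveProjection.sup_apply_right {c d : H →L[ℂ] H} {v : H} (hv : d v = v) :
    (c + (1 - c) * d) v = v := by
  rw [add_apply, sub_mul, one_mul, sub_apply, mul_apply_eq_comp, hv]; abel

/-- The vectors fixed by some additive central projection. -/
def IsLocallyLinear.additiveSubmodule (hm : IsLocallyLinear S ξ m) : Submodule ℂ H where
  carrier := {v | ∃ c, IsAdditiveProjection S m c ∧ c v = v}
  add_mem' := by
    rintro v w ⟨c, hc, hcv⟩ ⟨d, hd, hdw⟩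
    refine ⟨_, hm.isAdditiveProjection_sup hc hd, ?_⟩
    rw [map_add, IsAdditiveProjection.sup_apply_left hcv (hc.comm d hd.mem),
      IsAdditiveProjection.sup_apply_right hdw]
  zero_mem' := ⟨0, hm.isAdditiveProjection_zero, rfl⟩
  smul_mem' := by
    rintro a v ⟨c, hc, hcv⟩
    exact ⟨c, hc, by rw [map_smul, hcv]⟩

theorem IsLocallyLinear.exists_isAdditiveProjection_top (hm : IsLocallyLinear S ξ m) :
    ∃ z, IsAdditiveProjection S m z ∧ ∀ c, IsAdditiveProjection S m c → z * c = c := by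
  set M := StarSubalgebra.centralizer ℂ S with hM
  let W := hm.additiveSubmodule
  have hW : ∀ T : H →L[ℂ] H, (∀ c, IsAdditiveProjection S m c → c * T = T * c) →
      ∀ v ∈ W, T v ∈ W := by
    rintro T hT v ⟨c, hc, hcv⟩
    exact ⟨c, hc, by rw [← mul_apply_eq_comp, hT c hc, mul_apply_eq_comp, hcv]⟩
  have hWM : ∀ T ∈ M, ∀ v ∈ W, T v ∈ W := fun T hT => hW T fun c hc => hc.comm T hT
  have hWz : ∀ c, IsAdditiveProjection S m c → closureProjection W * c = c := fun c hc => by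
    ext v
    refine closureProjection_apply_of_mem ⟨c, hc, ?_⟩
    change c (c v) = c v
    rw [← mul_apply_eq_comp, hc.proj.isIdempotentElem.eq]
  have hzM : closureProjection W ∈ M := by
    rw [hM, StarSubalgebra.mem_centralizer_iff]
    intro g hg
    have h1 : ∀ c, IsAdditiveProjection S m c → c * g = g * c := fun c hc =>
      ((StarSubalgebra.mem_centralizer_iff ℂ).1 hc.mem g hg).1.symm
    have h2 : ∀ c, IsAdditiveProjection S m c → c * star g = star g * c := fun c hc =>
      ((StarSubalgebra.mem_centralizer_iff ℂ).1 hc.mem g hg).2.symm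
    exact ⟨closureProjection_comm (hW g h1) (hW _ h2),
      closureProjection_comm (hW _ h2) (by rw [star_star]; exact hW g h1)⟩
  have hproj := isStarProjection_closureProjection W
  refine ⟨closureProjection W, hm.isAdditiveProjection_of_approx hzM hproj
    (fun x hx => (closureProjection_comm (hWM x hx) (hWM _ (star_mem hx))).symm) ?_, hWz⟩
  intro ε hε η₁ η₂ η₃
  have hclose : ∀ η, ∃ v ∈ W, 2 * ‖closureProjection W η - v‖ ≤ ε := fun η => by
    obtain ⟨v, hv, h⟩ := Metric.mem_closure_iff.1 (closureProjection_apply_mem W η) (ε / 2)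
      (by positivity)
    rw [dist_eq_norm] at h
    exact ⟨v, hv, by linarith⟩
  obtain ⟨v₁, ⟨c₁, hc₁, h₁⟩, hd₁⟩ := hclose η₁
  obtain ⟨v₂, ⟨c₂, hc₂, h₂⟩, hd₂⟩ := hclose η₂
  obtain ⟨v₃, ⟨c₃, hc₃, h₃⟩, hd₃⟩ := hclose η₃
  have h12 := hm.isAdditiveProjection_sup hc₁ hc₂
  have hE := hm.isAdditiveProjection_sup h12 hc₃
  set c := c₁ + (1 - c₁) * c₂ with hcdef
  set E := c + (1 - c) * c₃ with hEdef
  have k₁ : E v₁ = v₁ := IsAdditiveProjection.sup_apply_left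
    (IsAdditiveProjection.sup_apply_left h₁ (hc₁.comm _ hc₂.mem)) (h12.comm _ hc₃.mem)
  have k₂ : E v₂ = v₂ := IsAdditiveProjection.sup_apply_left
    (IsAdditiveProjection.sup_apply_right h₂) (h12.comm _ hc₃.mem)
  have k₃ : E v₃ = v₃ := IsAdditiveProjection.sup_apply_right h₃
  have hEz : E * closureProjection W = E := by
    rw [hE.comm _ hzM, hWz E hE]
  have hsq : ∀ x ∈ M, E * x * E = E * x := fun x hx => by
    rw [hE.comm x hx, mul_assoc, hE.proj.isIdempotentElem.eq]
  refine ⟨E, hE.mem, hE.proj, hEz, (norm_sub_le_of_fixed hE.proj hEz k₁).trans hd₁,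
    (norm_sub_le_of_fixed hE.proj hEz k₂).trans hd₂,
    (norm_sub_le_of_fixed hE.proj hEz k₃).trans hd₃, fun x hx y hy hxsa hysa => ?_⟩
  rw [hsq x hx, hsq y hy, hE.add x hx y hy hxsa hysa]

theorem IsLocallyLinear.shift_central (hm : IsLocallyLinear S ξ m) {c x : H →L[ℂ] H}
    (hcM : c ∈ StarSubalgebra.centralizer ℂ S) (hc : IsStarProjection c)
    (hx : x ∈ StarSubalgebra.centralizer ℂ S) (hxsa : IsSelfAdjoint x)
    (h' : x * c = x) (t : ℝ) : m (x + t • c) = m x + t * m c := by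
  have smem : ∀ {y : H →L[ℂ] H} (t : ℝ), y ∈ StarSubalgebra.centralizer ℂ S →
      t • y ∈ StarSubalgebra.centralizer ℂ S := fun t hy => by
    have := (StarSubalgebra.centralizer ℂ S).smul_mem hy (t : ℂ)
    rwa [Complex.coe_smul] at this
  have hc1 : (1 - c) ∈ StarSubalgebra.centralizer ℂ S := sub_mem (one_mem _) hcM
  have hcc := hc.isIdempotentElem.eq
  have hsat : IsSelfAdjoint (t • c) := (IsSelfAdjoint.all t).smul hc.isSelfAdjoint
  have h1 : m (x + t • 1) = m (x + t • c) + m (t • (1 - c)) := by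
    rw [← hm.orth _ (add_mem hx (smem t hcM)) _ (smem t hc1) (hxsa.add hsat)
      ((IsSelfAdjoint.all t).smul hc.one_sub.isSelfAdjoint)]
    · congr 1; module
    · rw [mul_smul_comm, mul_sub, mul_one, add_mul, h', smul_mul_assoc, hcc, sub_self, smul_zero]
  have h2 : m 1 = m c + m (1 - c) := by
    rw [← hm.orth _ hcM _ hc1 hc.isSelfAdjoint hc.one_sub.isSelfAdjoint
      (by rw [mul_sub, mul_one, hcc, sub_self]), add_sub_cancel]
  rw [hm.shift x hx hxsa, h2, hm.smul _ hc1 hc.one_sub.isSelfAdjoint] at h1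
  linarith

theorem IsLocallyLinear.add (hm : IsLocallyLinear S ξ m)
    (hrank : ∀ e, IsMinimalProjection (StarSubalgebra.centralizer ℂ S) e → ∀ ζ, e ζ = ζ → ‖ζ‖ = 1 →
      Module.finrank ℂ (orbit S ζ) ≠ 2)
    {x y : H →L[ℂ] H} (hx : x ∈ StarSubalgebra.centralizer ℂ S)
    (hy : y ∈ StarSubalgebra.centralizer ℂ S) (hxsa : IsSelfAdjoint x) (hysa : IsSelfAdjoint y) :
    m (x + y) = m x + m y := by
  obtain ⟨z, hz, hzc⟩ := hm.exists_isAdditiveProjection_top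
  set M := StarSubalgebra.centralizer ℂ S with hM
  set c := 1 - z with hcdef
  have hcM : c ∈ M := sub_mem (one_mem _) hz.mem
  have hcp : IsStarProjection c := hz.proj.one_sub
  have hcc := hcp.isIdempotentElem.eq
  have hccomm : ∀ x ∈ M, c * x = x * c := fun x hx => by
    rw [hcdef, sub_mul, mul_sub, hz.comm x hx, one_mul, mul_one]
  have hc : ∀ e, IsMinimalProjection M e → c * e ≠ e := by
    intro e he hce
    obtain ⟨d, hd, hde⟩ := hm.exists_isAdditiveProjection_ge he (hrank e he)
    have hze : z * e = e := by rw [← hde, ← mul_assoc, hzc d hd]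
    refine he.ne_zero ?_
    rw [← hce, hcdef, sub_mul, one_mul, hze, sub_self]
  have smem : ∀ {y : H →L[ℂ] H} (t : ℝ), y ∈ M → t • y ∈ M := fun t hy => by
    have := M.smul_mem hy (t : ℂ)
    rwa [Complex.coe_smul] at this
  have hdiff : ∀ x ∈ M, ∀ y ∈ M, IsSelfAdjoint x → IsSelfAdjoint y → c * x = x → c * y = y →
      m (x + y) = m x + m y := by
    intro x hx y hy hxsa hysa hcx hcy
    have hxc : x * c = x := by rw [← hccomm x hx, hcx]
    have hyc : y * c = y := by rw [← hccomm y hy, hcy]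
    obtain ⟨r, hr0, hrx, hry⟩ : ∃ r : ℝ, 0 < r ∧ ‖x‖ ≤ r ∧ ‖y‖ ≤ r :=
      ⟨‖x‖ + ‖y‖ + 1, by positivity, by linarith [norm_nonneg y], by linarith [norm_nonneg x]⟩
    have hpos : ∀ x ∈ M, IsSelfAdjoint x → c * x = x → x * c = x → ‖x‖ ≤ r →
        0 ≤ (2 * r)⁻¹ • (x + r • c) ∧ (2 * r)⁻¹ • (x + r • c) ≤ 1 := by
      intro x hx hxsa hcx hxc hxr
      have hle : x ≤ r • (1 : H →L[ℂ] H) := by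
        have := hxsa.le_algebraMap_norm_self
        rw [Algebra.algebraMap_eq_smul_one] at this
        exact this.trans (smul_le_smul_of_nonneg_right hxr zero_le_one)
      have hge : -(r • (1 : H →L[ℂ] H)) ≤ x := by
        have := hxsa.neg_algebraMap_norm_le_self
        rw [Algebra.algebraMap_eq_smul_one] at this
        exact (neg_le_neg (smul_le_smul_of_nonneg_right hxr zero_le_one)).trans this
      have hconj : ∀ a b : H →L[ℂ] H, a ≤ b → c * a * c ≤ c * b * c := fun a b hab => by
        have := star_right_conjugate_le_conjugate hab c
        rwa [hcp.isSelfAdjoint.star_eq] at this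
      have e1 : c * x * c = x := by rw [hcx, hxc]
      have e2 : c * (r • (1 : H →L[ℂ] H)) * c = r • c := by
        rw [mul_smul_comm, mul_one, smul_mul_assoc, hcc]
      have l1 := hconj _ _ hle
      have l2 := hconj _ _ hge
      rw [mul_neg, neg_mul] at l2
      rw [e1, e2] at l1 l2
      have h2r : (0 : ℝ) ≤ (2 * r)⁻¹ := by positivity
      refine ⟨smul_nonneg h2r (by rw [← neg_le_iff_add_nonneg]; exact l2), ?_⟩
      calc (2 * r)⁻¹ • (x + r • c) ≤ (2 * r)⁻¹ • (r • c + r • c) :=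
            smul_le_smul_of_nonneg_left (by gcongr) h2r
        _ = c := by rw [← add_smul, smul_smul, ← two_mul, inv_mul_cancel₀ (by positivity), one_smul]
        _ ≤ 1 := hcp.le_one
    have hsat : IsSelfAdjoint (r • c) := (IsSelfAdjoint.all r).smul hcp.isSelfAdjoint
    obtain ⟨px, px'⟩ := hpos x hx hxsa hcx hxc hrx
    obtain ⟨py, py'⟩ := hpos y hy hysa hcy hyc hry
    have hmem : ∀ x ∈ M, x + r • c ∈ M := fun x hx => add_mem hx (smem r hcM)
    have hfix : ∀ x, c * x = x → c * ((2 * r)⁻¹ • (x + r • c)) = (2 * r)⁻¹ • (x + r • c) :=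
      fun x hx => by rw [mul_smul_comm, mul_add, hx, mul_smul_comm, hcc]
    have key := hm.add_of_diffuse hcM hcp hc (smem _ (hmem x hx)) (smem _ (hmem y hy)) px px'
      (hfix x hcx) py py' (hfix y hcy)
    rw [← smul_add, hm.smul _ (add_mem (hmem x hx) (hmem y hy))
        ((hxsa.add hsat).add (hysa.add hsat)), hm.smul _ (hmem x hx) (hxsa.add hsat),
      hm.smul _ (hmem y hy) (hysa.add hsat), ← mul_add,
      hm.shift_central hcM hcp hx hxsa hxc, hm.shift_central hcM hcp hy hysa hyc,
      show x + r • c + (y + r • c) = (x + y) + (2 * r) • c by module,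
      hm.shift_central hcM hcp (add_mem hx hy) (hxsa.add hysa)
        (by rw [add_mul, hxc, hyc])] at key
    have := mul_left_cancel₀ (inv_ne_zero (by positivity : (2 * r) ≠ 0)) key
    linarith
  have hsac : ∀ x ∈ M, IsSelfAdjoint x → IsSelfAdjoint (c * x) := fun x hx h =>
    hcp.isSelfAdjoint.mul_of_comm h (hccomm x hx)
  have hcfix : ∀ x : H →L[ℂ] H, c * (c * x) = c * x := fun x => by rw [← mul_assoc, hcc]
  have key := hdiff _ (mul_mem hcM hx) _ (mul_mem hcM hy) (hsac x hx hxsa) (hsac y hy hysa)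
    (hcfix x) (hcfix y)
  rw [hm.split hz.mem hz.proj (add_mem hx hy) (hxsa.add hysa) (hz.comm _ (add_mem hx hy)),
    hm.split hz.mem hz.proj hx hxsa (hz.comm x hx), hm.split hz.mem hz.proj hy hysa (hz.comm y hy),
    mul_add, mul_add, ← hcdef, key, hz.add x hx y hy hxsa hysa]
  ring

end Additivity

section Domination
variable {A : Type*} [CStarAlgebra A] [PartialOrder A] [StarOrderedRing A]

omit [PartialOrder A] [StarOrderedRing A] in
theorem smul_add_smul_sq_sub (a b : A) {l k : ℝ} (hl : 0 < l) (hk : 0 < k) :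
    (l⁻¹ • (a * a) + k⁻¹ • (b * b)) - (l + k)⁻¹ • ((a + b) * (a + b)) =
      (l * k * (l + k))⁻¹ • ((k • a - l • b) * (k • a - l • b)) := by
  have h : l * k * (l + k) ≠ 0 := by positivity
  refine smul_right_injective A h ?_
  simp only [smul_sub, smul_add, smul_smul, mul_add, add_mul, mul_sub, sub_mul, smul_mul_assoc,
    mul_smul_comm]
  match_scalars <;> field_simp <;> ring

/-- The cone used to dominate `f` by a positive functional. -/
def dominationCone (f : A →L[ℝ] ℝ) : PointedCone ℝ (A × ℝ × ℝ) where
  carrier := {p | p = 0 ∨ ∃ a : A, IsSelfAdjoint a ∧ ∃ l : ℝ, 0 < l ∧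
    l • (1 : A) + l⁻¹ • (a * a) ≤ (ℜ p.1 : A) + p.2.1 • (1 : A) ∧ -(2 * f a) ≤ p.2.2}
  zero_mem' := Or.inl rfl
  add_mem' := by
    rintro p q (rfl | ⟨a, ha, l, hl, h1, h2⟩) hq
    · rwa [zero_add]
    obtain (rfl | ⟨b, hb, k, hk, h3, h4⟩) := hq
    · rw [add_zero]; exact Or.inr ⟨a, ha, l, hl, h1, h2⟩
    refine Or.inr ⟨a + b, ha.add hb, l + k, by positivity, ?_, ?_⟩
    · have h5 : (l + k)⁻¹ • ((a + b) * (a + b)) ≤ l⁻¹ • (a * a) + k⁻¹ • (b * b) := by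
        rw [← sub_nonneg, smul_add_smul_sq_sub a b hl hk]
        refine smul_nonneg (by positivity) (IsSelfAdjoint.mul_self_nonneg ?_)
        exact ((IsSelfAdjoint.all k).smul ha).sub ((IsSelfAdjoint.all l).smul hb)
      calc _ ≤ (l + k) • (1 : A) + (l⁻¹ • (a * a) + k⁻¹ • (b * b)) := by gcongr
        _ = (l • (1 : A) + l⁻¹ • (a * a)) + (k • (1 : A) + k⁻¹ • (b * b)) := by module
        _ ≤ _ := add_le_add h1 h3
        _ = _ := by
          rw [Prod.fst_add, Prod.snd_add, Prod.fst_add, map_add, AddSubgroup.coe_add]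
          module
    · rw [map_add, Prod.snd_add, Prod.snd_add]; linarith
  smul_mem' := by
    rintro ⟨c, hc⟩ p hp
    rw [Nonneg.mk_smul]
    obtain (rfl | hc) := hc.eq_or_lt
    · exact Or.inl (zero_smul _ _)
    obtain (rfl | ⟨a, ha, l, hl, h1, h2⟩) := hp
    · exact Or.inl (smul_zero _)
    refine Or.inr ⟨c • a, (IsSelfAdjoint.all c).smul ha, c * l, by positivity, ?_, ?_⟩
    · have := smul_le_smul_of_nonneg_left h1 hc.le
      calc _ = c • (l • (1 : A) + l⁻¹ • (a * a)) := by
            rw [smul_mul_smul_comm, smul_add, smul_smul, smul_smul, smul_smul]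
            congr 2; field_simp
        _ ≤ _ := this
        _ = _ := by
          rw [Prod.smul_fst, Prod.smul_snd, Prod.smul_fst, map_smul]
          simp [smul_smul]
    · rw [map_smul, Prod.smul_snd, Prod.smul_snd, smul_eq_mul, smul_eq_mul]
      nlinarith

theorem sq_norm_le_of_smul_add_le [Nontrivial A] {a : A} (ha : IsSelfAdjoint a) {l r : ℝ}
    (hl : 0 < l) (h : l • (1 : A) + l⁻¹ • (a * a) ≤ r • (1 : A)) : 2 * ‖a‖ ≤ r := by
  have h0 : 0 ≤ a * a := ha.mul_self_nonneg
  have h1 : a * a ≤ algebraMap ℝ A (l * (r - l)) := by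
    rw [Algebra.algebraMap_eq_smul_one]
    have := smul_le_smul_of_nonneg_left h hl.le
    rw [smul_add, smul_smul, smul_smul, smul_smul, mul_inv_cancel₀ hl.ne', one_smul] at this
    rw [mul_sub, sub_smul]
    exact le_sub_iff_add_le'.2 this
  have h2 : 0 ≤ l * (r - l) := by
    have := h0.trans h1
    rwa [← map_zero (algebraMap ℝ A), algebraMap_le_algebraMap] at this
  have h3 := (CStarAlgebra.norm_le_iff_le_algebraMap (a * a) h2 h0).2 h1
  have h4 : ‖a * a‖ = ‖a‖ * ‖a‖ := by
    nth_rw 1 [← ha.star_eq]; exact CStarRing.norm_star_mul_self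
  have h5 : 0 ≤ r - l := nonneg_of_mul_nonneg_right h2 hl
  refine abs_le_of_sq_le_sq' ?_ (by linarith) |>.2
  nlinarith [sq_nonneg (r - 2 * l)]

theorem exists_dominating_linear (f : A →L[ℝ] ℝ) : ∃ g : A →ₗ[ℝ] ℝ, (∀ x, 0 ≤ x → 0 ≤ g x) ∧
    ∀ a : A, IsSelfAdjoint a → f a ^ 2 ≤ g 1 * g (a * a) := by
  rcases subsingleton_or_nontrivial A with hA | hA
  · refine ⟨0, by simp, fun a _ => ?_⟩
    rw [Subsingleton.elim a 0]; simp
  let D : Submodule ℝ (A × ℝ × ℝ) := Submodule.prod ⊥ ⊤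
  let F : A × ℝ × ℝ →ₗ[ℝ] ℝ := ‖f‖ • (LinearMap.fst ℝ ℝ ℝ ∘ₗ LinearMap.snd ℝ A (ℝ × ℝ)) +
    (LinearMap.snd ℝ ℝ ℝ ∘ₗ LinearMap.snd ℝ A (ℝ × ℝ))
  have hF : ∀ p, F p = ‖f‖ * p.2.1 + p.2.2 := fun p => by simp [F]
  obtain ⟨G, hG1, hG2⟩ := riesz_extension (dominationCone f) ⟨D, F ∘ₗ D.subtype⟩ (by
      rintro ⟨⟨x, r, t⟩, hx⟩ (h | ⟨a, ha, l, hl, h1, h2⟩)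
      · change 0 ≤ F (x, r, t)
        change (x, r, t) = 0 at h
        rw [h, map_zero]
      · change 0 ≤ F (x, r, t)
        have hx0 : x = 0 := by simpa [D] using hx
        subst hx0
        rw [hF]
        simp only [map_zero, ZeroMemClass.coe_zero, zero_add] at h1 h2 ⊢
        have h3 := sq_norm_le_of_smul_add_le ha hl h1
        have h4 := (le_abs_self _).trans (f.le_opNorm a)
        nlinarith [norm_nonneg f]) (by
      rintro ⟨x, r, t⟩
      refine ⟨⟨(0, ‖(ℜ x : A)‖ - r + 1, -t), by simp [D]⟩, Or.inr ⟨0, .zero _, 1, one_pos, ?_, ?_⟩⟩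
      · have : -(‖(ℜ x : A)‖ • (1 : A)) ≤ (ℜ x : A) := by
          have := (ℜ x).2.neg_algebraMap_norm_le_self
          rwa [Algebra.algebraMap_eq_smul_one] at this
        have h2 := add_le_add_left this ((‖(ℜ x : A)‖ + 1) • (1 : A))
        simp only [Prod.mk_add_mk, zero_add, mul_zero, smul_zero, add_zero]
        convert h2 using 1
        · module
        · module
      · simp)
  have hGt : ∀ t, G (0, 0, t) = t := fun t => by
    have := hG1 ⟨(0, 0, t), by simp [D]⟩
    exact this.trans (by change F (0, 0, t) = t; simp [hF])
  let g : A →ₗ[ℝ] ℝ := G ∘ₗ LinearMap.inl ℝ A (ℝ × ℝ)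
  have hg : ∀ x t, G (x, 0, t) = g x + t := fun x t => by
    nth_rw 2 [← hGt t]
    change G _ = G (x, 0, 0) + G _
    rw [← map_add]; simp
  have key : ∀ x a, IsSelfAdjoint a → ∀ l > (0 : ℝ), l • (1 : A) + l⁻¹ • (a * a) ≤ (ℜ x : A) →
      2 * f a ≤ g x := fun x a ha l hl h => by
    have := hG2 (x, 0, -(2 * f a)) (Or.inr ⟨a, ha, l, hl, by simpa using h, le_rfl⟩)
    rw [hg] at this; linarith
  have h1 : ∀ l > (0 : ℝ), ∀ a, IsSelfAdjoint a → 2 * f a ≤ l * g 1 + l⁻¹ * g (a * a) := by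
    intro l hl a ha
    have hs : IsSelfAdjoint (l • (1 : A) + l⁻¹ • (a * a)) :=
      ((IsSelfAdjoint.all l).smul (.one A)).add
        ((IsSelfAdjoint.all _).smul (ha.mul_self_nonneg.isSelfAdjoint))
    have := key (l • (1 : A) + l⁻¹ • (a * a)) a ha l hl (by rw [hs.coe_realPart])
    simpa using this
  have hpos : ∀ x, 0 ≤ x → 0 ≤ g x := by
    intro x hx
    refine le_of_forall_pos_le_add fun ε hε => ?_
    have h := fun (l : ℝ) (hl : 0 < l) => key (x + l • 1) 0 (.zero _) l hl (by
      rw [(hx.isSelfAdjoint.add ((IsSelfAdjoint.all l).smul (.one A))).coe_realPart]; simpa using hx)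
    simp only [map_zero, mul_zero, map_add, map_smul, smul_eq_mul] at h
    have h2 := h (ε / (|g 1| + 1)) (by positivity)
    have h3 : ε / (|g 1| + 1) * g 1 ≤ ε := by
      rw [div_mul_eq_mul_div, div_le_iff₀ (by positivity)]
      nlinarith [le_abs_self (g 1)]
    linarith
  refine ⟨g, hpos, fun a ha => ?_⟩
  have hg1 : 0 ≤ g 1 := hpos 1 zero_le_one
  have hga : 0 ≤ g (a * a) := hpos _ ha.mul_self_nonneg
  have h2 : ∀ l : ℝ, 0 ≤ g 1 * (l * l) + (-(2 * f a)) * l + g (a * a) := by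
    intro l
    rcases lt_trichotomy l 0 with hl | rfl | hl
    · have := h1 (-l) (by linarith) (-a) ha.neg
      rw [map_neg, neg_mul_neg] at this
      have h3 := mul_le_mul_of_nonneg_left this (by linarith : 0 ≤ -l)
      have h4 : -l * ((-l)⁻¹ * g (a * a)) = g (a * a) := by
        rw [← mul_assoc, mul_inv_cancel₀ (by linarith), one_mul]
      rw [mul_add, h4] at h3
      nlinarith
    · simpa using hga
    · have := h1 l hl a ha
      have h3 := mul_le_mul_of_nonneg_left this hl.le
      have h4 : l * (l⁻¹ * g (a * a)) = g (a * a) := by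
        rw [← mul_assoc, mul_inv_cancel₀ hl.ne', one_mul]
      rw [mul_add, h4] at h3
      nlinarith
  have := discrim_le_zero h2
  rw [discrim] at this
  nlinarith

theorem exists_dominating (f : A →L[ℝ] ℝ) : ∃ g : A →L[ℝ] ℝ, (∀ x, 0 ≤ x → 0 ≤ g x) ∧
    ∀ a : A, IsSelfAdjoint a → f a ^ 2 ≤ g 1 * g (a * a) := by
  obtain ⟨g, h0, hg⟩ := exists_dominating_linear f
  let g' : A →ₗ[ℝ] ℝ := g ∘ₗ (selfAdjoint.submodule ℝ A).subtype ∘ₗ (realPart : A →ₗ[ℝ] selfAdjoint A)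
  have hg' : ∀ x, IsSelfAdjoint x → g' x = g x := fun x hx => by
    change g (ℜ x : A) = g x
    rw [hx.coe_realPart]
  refine ⟨g'.mkContinuous (g 1) fun x => ?_, fun x hx => ?_, fun a ha => ?_⟩
  · change ‖g (ℜ x : A)‖ ≤ _
    have hn : ‖(ℜ x : A)‖ ≤ ‖x‖ := realPart.norm_le x
    have h1 := (ℜ x).2.neg_algebraMap_norm_le_self
    have h2 := (ℜ x).2.le_algebraMap_norm_self
    rw [Algebra.algebraMap_eq_smul_one] at h1 h2
    have h3 := h0 _ (sub_nonneg.2 h1)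
    have h4 := h0 _ (sub_nonneg.2 h2)
    rw [map_sub, map_smul, smul_eq_mul] at h4
    rw [sub_neg_eq_add, map_add, map_smul, smul_eq_mul] at h3
    have h5 := h0 1 zero_le_one
    rw [Real.norm_eq_abs, abs_le]
    constructor <;> nlinarith
  · change 0 ≤ g' x
    rw [hg' x hx.isSelfAdjoint]; exact h0 x hx
  · change _ ≤ g' 1 * g' (a * a)
    rw [hg' 1 (.one A), hg' _ ha.mul_self_nonneg.isSelfAdjoint]
    exact hg a ha

theorem exists_dominating_seq (f : ℕ → (A →L[ℝ] ℝ)) : ∃ g : A →L[ℝ] ℝ, (∀ x, 0 ≤ x → 0 ≤ g x) ∧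
    ∀ n, ∃ C, 0 ≤ C ∧ ∀ a : A, IsSelfAdjoint a → f n a ^ 2 ≤ C * g (a * a) := by
  choose g h0 hg using fun n => exists_dominating (f n)
  let c : ℕ → ℝ := fun n => (1 / 2) ^ n * (‖g n‖ + 1)⁻¹
  have hc : ∀ n, 0 < c n := fun n => by positivity
  have hs : Summable fun n => c n • g n := by
    refine Summable.of_norm_bounded (g := fun n => (1 / 2 : ℝ) ^ n)
      (summable_geometric_of_lt_one (by norm_num) (by norm_num)) fun n => ?_
    rw [norm_smul, Real.norm_of_nonneg (hc n).le, mul_assoc]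
    refine mul_le_of_le_one_right (by positivity) ?_
    rw [inv_mul_le_iff₀ (by positivity)]; linarith
  have hsx : ∀ x, HasSum (fun n => c n * g n x) ((∑' n, c n • g n) x) := fun x => by
    simpa using hs.hasSum.mapL (ContinuousLinearMap.apply ℝ ℝ x)
  have hge : ∀ n x, 0 ≤ x → c n * g n x ≤ (∑' n, c n • g n) x := fun n x hx =>
    le_hasSum (hsx x) n fun k _ => mul_nonneg (hc k).le (h0 k x hx)
  refine ⟨∑' n, c n • g n, fun x hx => (hsx x).nonneg fun n => mul_nonneg (hc n).le (h0 n x hx),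
    fun n => ⟨g n 1 * (c n)⁻¹, mul_nonneg (h0 n 1 zero_le_one) (inv_nonneg.2 (hc n).le),
      fun a ha => (hg n a ha).trans ?_⟩⟩
  rw [mul_assoc]
  refine mul_le_mul_of_nonneg_left ?_ (h0 n 1 zero_le_one)
  rw [le_inv_mul_iff₀ (hc n)]
  exact hge n _ ha.mul_self_nonneg

end Domination

section Representation
universe u

/-- A real functional on a real subspace image bounded by the norm is given by an inner product. -/
theorem exists_inner_eq_of_abs_le {E H : Type*} [AddCommGroup E] [Module ℝ E]
    [NormedAddCommGroup H] [InnerProductSpace ℂ H] [CompleteSpace H] (T : E →ₗ[ℝ] H)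
    (f : E →ₗ[ℝ] ℝ) (C : ℝ) (h : ∀ x, |f x| ≤ C * ‖T x‖) : ∃ η : H, ∀ x, f x = (⟪η, T x⟫_ℂ).re := by
  have hker : LinearMap.ker T.rangeRestrict ≤ LinearMap.ker f := by
    intro x hx
    rw [LinearMap.ker_rangeRestrict, LinearMap.mem_ker] at hx
    have := h x
    rw [hx, norm_zero, mul_zero] at this
    exact abs_nonpos_iff.1 this
  let F : LinearMap.range T →ₗ[ℝ] ℝ :=
    ((LinearMap.ker T.rangeRestrict).liftQ f hker) ∘ₗ
      (T.rangeRestrict.quotKerEquivOfSurjective T.surjective_rangeRestrict).symm.toLinearMap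
  have hF : ∀ x, F (T.rangeRestrict x) = f x := fun x => by
    have : (T.rangeRestrict.quotKerEquivOfSurjective T.surjective_rangeRestrict).symm
        (T.rangeRestrict x) = Submodule.Quotient.mk x := by
      rw [LinearEquiv.symm_apply_eq]; rfl
    simp only [F, LinearMap.comp_apply, LinearEquiv.coe_coe, this]
    rfl
  obtain ⟨G, hG, -⟩ := exists_extension_norm_eq (LinearMap.range T) (F.mkContinuous C (by
    rintro ⟨_, x, rfl⟩
    exact (congrArg (fun t : ℝ => ‖t‖) (hF x)).trans_le (h x)))
  refine ⟨(InnerProductSpace.toDual ℂ H).symm (StrongDual.extendRCLike (𝕜 := ℂ) G), fun x => ?_⟩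
  rw [InnerProductSpace.toDual_symm_apply]
  have h1 := StrongDual.re_extendRCLike_apply (𝕜 := ℂ) G (T x)
  have h2 := hG (T.rangeRestrict x)
  rw [LinearMap.mkContinuous_apply, hF] at h2
  exact h2.symm.trans h1.symm

theorem exists_representation {A : Type u} [CStarAlgebra A] (f : ℕ → (A →L[ℝ] ℝ)) :
    ∃ (H : Type u) (_ : NormedAddCommGroup H) (_ : InnerProductSpace ℂ H) (_ : CompleteSpace H)
      (π : A →⋆ₐ[ℂ] (H →L[ℂ] H)) (ξ : H),
      ∀ n, ∃ η : H, ∀ a : A, IsSelfAdjoint a → f n a = (⟪η, π a ξ⟫_ℂ).re := by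
  let _ := CStarAlgebra.spectralOrder A
  have := CStarAlgebra.spectralOrderedRing A
  obtain ⟨g, h0, hg⟩ := exists_dominating_seq f
  let g' : Module.Dual ℝ A :=
    g.toLinearMap ∘ₗ (selfAdjoint.submodule ℝ A).subtype ∘ₗ (realPart : A →ₗ[ℝ] selfAdjoint A)
  have hg' : ∀ x, g' x = g (ℜ x : A) := fun x => rfl
  have hsa : ∀ x : A, IsSelfAdjoint x → Module.Dual.extendRCLike (𝕜 := ℂ) g' x = (g x : ℂ) :=
    fun x hx => by
      rw [Module.Dual.extendRCLike_apply, hg', hg', hx.coe_realPart]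
      have : (ℜ ((RCLike.I : ℂ) • x) : A) = 0 := by
        change (ℜ (Complex.I • x) : A) = 0
        rw [realPart_I_smul, hx.imaginaryPart]; simp
      rw [this]; simp
  open scoped ComplexOrder in
  let ω : A →ₚ[ℂ] ℂ := PositiveLinearMap.mk₀ (Module.Dual.extendRCLike (𝕜 := ℂ) g') (by
    intro x hx
    rw [hsa x hx.isSelfAdjoint]
    exact_mod_cast h0 x hx)
  let ξ : ω.GNS := ((ω.toPreGNS 1 : ω.PreGNS) : ω.GNS)
  have hnorm : ∀ a : A, IsSelfAdjoint a → ‖ω.gnsStarAlgHom a ξ‖ ^ 2 = g (a * a) := by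
    intro a ha
    have e : ω.gnsStarAlgHom a ξ = ((ω.toPreGNS a : ω.PreGNS) : ω.GNS) := by
      change ω.gnsNonUnitalStarAlgHom a ((ω.toPreGNS 1 : ω.PreGNS) : ω.GNS) = _
      rw [PositiveLinearMap.gnsNonUnitalStarAlgHom_apply_coe]
      simp
    have h1 := ω.preGNS_norm_sq (ω.toPreGNS a)
    rw [PositiveLinearMap.ofPreGNS_toPreGNS, ha.star_eq] at h1
    have h2 : ω (a * a) = g (a * a) := hsa _ ha.mul_self_nonneg.isSelfAdjoint
    rw [h2] at h1
    rw [e, UniformSpace.Completion.norm_coe]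
    exact_mod_cast h1
  refine ⟨ω.GNS, inferInstance, inferInstance, inferInstance, ω.gnsStarAlgHom, ξ, fun n => ?_⟩
  obtain ⟨C, hC, hCf⟩ := hg n
  let T : selfAdjoint A →ₗ[ℝ] ω.GNS :=
    { toFun := fun a => ω.gnsStarAlgHom a ξ
      map_add' := fun a b => by rw [AddSubgroup.coe_add, map_add, add_apply]
      map_smul' := fun t a => by
        rw [selfAdjoint.val_smul, ← Complex.coe_smul, map_smul, smul_apply, Complex.coe_smul]
        rfl }
  obtain ⟨η, hη⟩ := exists_inner_eq_of_abs_le T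
    ((f n).toLinearMap ∘ₗ (selfAdjoint.submodule ℝ A).subtype) (√C) (fun x => by
      refine abs_le_of_sq_le_sq ?_ (by positivity)
      rw [mul_pow, Real.sq_sqrt hC]
      change f n x ^ 2 ≤ C * ‖ω.gnsStarAlgHom x ξ‖ ^ 2
      rw [hnorm x x.2]
      exact hCf x x.2)
  exact ⟨η, fun a ha => hη ⟨a, ha⟩⟩

end Representation

theorem mem_closure_of_forall_finset {X Y : Type*} [TopologicalSpace Y] {F : X → Y}
    {s : Set (X → Y)}
    (h : ∀ I : Finset X, (fun i : I => F i) ∈ closure ((fun (G : X → Y) (i : I) => G i) '' s)) :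
    F ∈ closure s := by
  rw [mem_closure_iff_nhds]
  intro t ht
  rw [nhds_pi, Filter.mem_pi] at ht
  obtain ⟨I, hI, u, hu, hut⟩ := ht
  obtain ⟨_, hG, G, hGs, rfl⟩ := mem_closure_iff_nhds.1 (h hI.toFinset)
    (Set.univ.pi fun i => u i) (set_pi_mem_nhds Set.finite_univ fun i _ => hu i)
  exact ⟨G, hut fun i hi => hG ⟨i, hI.mem_toFinset.2 hi⟩ trivial, hGs⟩

section Density
variable {H : Type*} [NormedAddCommGroup H] [InnerProductSpace ℂ H] [CompleteSpace H]

section Amplification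
variable {ι : Type*} [Fintype ι]

/-- The diagonal amplification of an operator. -/
noncomputable def amplify (ι : Type*) [Fintype ι] (T : H →L[ℂ] H) :
    PiLp 2 (fun _ : ι => H) →L[ℂ] PiLp 2 (fun _ : ι => H) :=
  (PiLp.continuousLinearEquiv 2 ℂ fun _ : ι => H).symm.toContinuousLinearMap ∘L
    (ContinuousLinearMap.pi fun i => T ∘L ContinuousLinearMap.proj i) ∘L
    (PiLp.continuousLinearEquiv 2 ℂ fun _ : ι => H).toContinuousLinearMap

omit [CompleteSpace H] in
theorem amplify_apply (T : H →L[ℂ] H) (v : PiLp 2 (fun _ : ι => H)) (i : ι) :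
    amplify ι T v i = T (v i) := rfl

theorem star_amplify (T : H →L[ℂ] H) : star (amplify ι T) = amplify ι (star T) := by
  symm
  rw [ContinuousLinearMap.star_eq_adjoint (amplify ι T), ContinuousLinearMap.eq_adjoint_iff]
  intro x y
  simp only [PiLp.inner_apply, amplify_apply, ContinuousLinearMap.star_eq_adjoint,
    ContinuousLinearMap.adjoint_inner_left]

/-- The coordinate embedding. -/
noncomputable def amplifySingle [DecidableEq ι] (j : ι) : H →L[ℂ] PiLp 2 (fun _ : ι => H) :=
  (PiLp.continuousLinearEquiv 2 ℂ fun _ : ι => H).symm.toContinuousLinearMap ∘L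
    ContinuousLinearMap.single ℂ (fun _ : ι => H) j

omit [CompleteSpace H] in
theorem sum_amplifySingle [DecidableEq ι] (v : PiLp 2 (fun _ : ι => H)) :
    ∑ j, amplifySingle j (v j) = v := by
  ext i
  simp [amplifySingle, WithLp.ofLp_sum, Finset.sum_apply, Pi.single_apply]

omit [CompleteSpace H] in
theorem amplify_amplifySingle [DecidableEq ι] (T : H →L[ℂ] H) (j : ι) (x : H) :
    amplify ι T (amplifySingle j x) = amplifySingle j (T x) := by
  ext i
  rw [amplify_apply]
  by_cases h : i = j
  · subst h; simp [amplifySingle]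
  · simp [amplifySingle, h]

/-- The matrix entries of an operator on the amplification. -/
noncomputable def amplifyEntry [DecidableEq ι]
    (P : PiLp 2 (fun _ : ι => H) →L[ℂ] PiLp 2 (fun _ : ι => H)) (i j : ι) : H →L[ℂ] H :=
  PiLp.proj 2 (fun _ : ι => H) i ∘L P ∘L amplifySingle j

omit [CompleteSpace H] in
theorem amplifyEntry_apply [DecidableEq ι]
    (P : PiLp 2 (fun _ : ι => H) →L[ℂ] PiLp 2 (fun _ : ι => H)) (i j : ι) (x : H) :
    amplifyEntry P i j x = P (amplifySingle j x) i := rfl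

omit [CompleteSpace H] in
/-- An operator commutes with an amplification iff its entries do. -/
theorem amplify_comm_iff [DecidableEq ι] {T : H →L[ℂ] H}
    {P : PiLp 2 (fun _ : ι => H) →L[ℂ] PiLp 2 (fun _ : ι => H)} :
    amplify ι T * P = P * amplify ι T ↔
      ∀ i j, T * amplifyEntry P i j = amplifyEntry P i j * T := by
  constructor
  · intro h i j
    ext x
    have := congrArg (fun Q => Q (amplifySingle j x) i) h
    simp only [mul_apply_eq_comp, amplify_apply, amplify_amplifySingle] at this
    simpa only [mul_apply_eq_comp, amplifyEntry_apply] using this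
  · intro h
    ext v i
    rw [mul_apply_eq_comp, mul_apply_eq_comp, amplify_apply, ← sum_amplifySingle v]
    simp only [map_sum, amplify_amplifySingle, WithLp.ofLp_sum, Finset.sum_apply]
    refine Finset.sum_congr rfl fun j _ => ?_
    have := congrArg (fun Q => Q (v j)) (h i j)
    simpa only [mul_apply_eq_comp, amplifyEntry_apply] using this

end Amplification

variable {A : Type*} [CStarAlgebra A] (π : A →⋆ₐ[ℂ] (H →L[ℂ] H))

/-- The commutant of a representation. -/
def repCommutant : Set (H →L[ℂ] H) := {g | ∀ a, g * π a = π a * g}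

theorem star_mem_repCommutant {g : H →L[ℂ] H} (hg : g ∈ repCommutant π) :
    star g ∈ repCommutant π := fun a => by
  have := congrArg star (hg (star a))
  simpa [map_star] using this.symm

theorem mem_bicommutant {T : H →L[ℂ] H} :
    T ∈ StarSubalgebra.centralizer ℂ (repCommutant π) ↔ ∀ g ∈ repCommutant π, g * T = T * g := by
  rw [StarSubalgebra.mem_centralizer_iff]
  exact ⟨fun h g hg => (h g hg).1, fun h g hg => ⟨h g hg, h _ (star_mem_repCommutant π hg)⟩⟩

theorem map_mem_bicommutant (a : A) : π a ∈ StarSubalgebra.centralizer ℂ (repCommutant π) :=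
  (mem_bicommutant π).2 fun _ hg => hg a

/-- The double commutant theorem. -/
theorem mem_closure_range_of_mem_bicommutant {T : H →L[ℂ] H}
    (hT : T ∈ StarSubalgebra.centralizer ℂ (repCommutant π)) {ι : Type*} [Fintype ι] (ζ : ι → H) :
    (fun i => T (ζ i)) ∈ closure (Set.range fun (a : A) (i : ι) => π a (ζ i)) := by
  classical
  let z : PiLp 2 (fun _ : ι => H) := WithLp.toLp 2 ζ
  let V : Submodule ℂ (PiLp 2 (fun _ : ι => H)) := LinearMap.range
    ({ toFun := fun a => amplify ι (π a) z
       map_add' := fun a b => by ext i; simp [amplify_apply]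
       map_smul' := fun c a => by ext i; simp [amplify_apply] } : A →ₗ[ℂ] _)
  have hV : ∀ a, ∀ v ∈ V, amplify ι (π a) v ∈ V := by
    rintro a _ ⟨b, rfl⟩
    refine ⟨a * b, ?_⟩
    ext i
    simp [amplify_apply]
  have hP : ∀ a, amplify ι (π a) * closureProjection V = closureProjection V * amplify ι (π a) :=
    fun a => closureProjection_comm (hV a) (by rw [star_amplify, ← map_star]; exact hV _)
  have hTP : amplify ι T * closureProjection V = closureProjection V * amplify ι T := by
    refine amplify_comm_iff.2 fun i j => ?_
    refine ((mem_bicommutant π).1 hT _ fun a => ?_).symm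
    exact (amplify_comm_iff.1 (hP a) i j).symm
  have hz : closureProjection V z = z := closureProjection_apply_of_mem ⟨1, by
    ext i; simp [amplify_apply]⟩
  have hmem : amplify ι T z ∈ closure (V : Set (PiLp 2 (fun _ : ι => H))) := by
    rw [← hz, ← mul_apply_eq_comp, hTP]
    exact closureProjection_apply_mem V _
  refine map_mem_closure (PiLp.continuousLinearEquiv 2 ℂ fun _ : ι => H).continuous hmem ?_
  rintro _ ⟨a, rfl⟩
  exact ⟨a, rfl⟩

/-- A real functional on a finite power of a Hilbert space, in coordinates. -/
theorem exists_sum_inner {ι : Type*} [Fintype ι] (f : (ι → H) →L[ℝ] ℝ) :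
    ∃ θ : ι → H, ∀ v, f v = ∑ i, (⟪θ i, v i⟫_ℂ).re := by
  classical
  refine ⟨fun i => (InnerProductSpace.toDual ℂ H).symm (StrongDual.extendRCLike (𝕜 := ℂ)
    (f ∘L ContinuousLinearMap.single ℝ (fun _ : ι => H) i)), fun v => ?_⟩
  have : ∀ i, (⟪(InnerProductSpace.toDual ℂ H).symm (StrongDual.extendRCLike (𝕜 := ℂ)
      (f ∘L ContinuousLinearMap.single ℝ (fun _ : ι => H) i)), v i⟫_ℂ).re =
      f (Pi.single i (v i)) := fun i => by
    rw [InnerProductSpace.toDual_symm_apply]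
    exact StrongDual.re_extendRCLike_apply (𝕜 := ℂ) _ _
  simp only [this]
  rw [← map_sum, Finset.univ_sum_single]

theorem mem_closure_selfAdjoint {w : H →L[ℂ] H}
    (hw : w ∈ StarSubalgebra.centralizer ℂ (repCommutant π)) (hsa : IsSelfAdjoint w) :
    (fun ζ => w ζ) ∈ closure ((fun (a : A) (ζ : H) => π a ζ) '' {a | IsSelfAdjoint a}) := by
  refine mem_closure_of_forall_finset fun I => ?_
  rw [Set.image_image]
  by_contra hcon
  have hconv : Convex ℝ ((fun (a : A) (i : I) => π a (i : H)) '' {a | IsSelfAdjoint a}) := by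
    rintro _ ⟨a, ha, rfl⟩ _ ⟨b, hb, rfl⟩ s t _ _ _
    refine ⟨s • a + t • b, ((IsSelfAdjoint.all s).smul ha).add ((IsSelfAdjoint.all t).smul hb), ?_⟩
    ext i
    simp [← Complex.coe_smul]
  obtain ⟨f, u, hf, hu⟩ := geometric_hahn_banach_closed_point hconv.closure isClosed_closure hcon
  obtain ⟨θ, hθ⟩ := exists_sum_inner f
  have h0 : ∀ a : A, IsSelfAdjoint a → f (fun i : I => π a (i : H)) = 0 := by
    intro a ha
    by_contra hne
    have h1 := hf _ (subset_closure ⟨((u / f fun i : I => π a (i : H)) : ℝ) • a,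
      (IsSelfAdjoint.all _).smul ha, rfl⟩)
    have h2 : (fun i : I => π (((u / f fun i : I => π a (i : H)) : ℝ) • a) (i : H)) =
        (u / f fun i : I => π a (i : H)) • fun i : I => π a (i : H) := by
      ext i; simp [← Complex.coe_smul]
    beta_reduce at h1
    rw [h2, map_smul, smul_eq_mul, div_mul_cancel₀ _ hne] at h1
    exact lt_irrefl _ h1
  have hu0 : 0 < u := by
    have h1 := hf _ (subset_closure ⟨(0 : A), IsSelfAdjoint.zero A, rfl⟩)
    beta_reduce at h1
    rwa [h0 0 (.zero A)] at h1
  let h : (I ⊕ I → H) → ℂ := fun F => ∑ i, (⟪θ i, F (Sum.inl i)⟫_ℂ + ⟪(i : H), F (Sum.inr i)⟫_ℂ)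
  have hcont : Continuous h := by fun_prop
  let ζ : I ⊕ I → H := Sum.elim (fun i => (i : H)) θ
  have hre : ∀ T : H →L[ℂ] H, IsSelfAdjoint T →
      h (fun i => T (ζ i)) = ((2 * f fun i : I => T (i : H) : ℝ) : ℂ) := by
    intro T hT
    rw [hθ, Finset.mul_sum, Complex.ofReal_sum]
    refine Finset.sum_congr rfl fun i _ => ?_
    change ⟪θ i, T i⟫_ℂ + ⟪(i : H), T (θ i)⟫_ℂ = _
    have : ⟪(i : H), T (θ i)⟫_ℂ = (starRingEnd ℂ) ⟪θ i, T i⟫_ℂ := by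
      rw [inner_conj_symm]
      nth_rw 2 [← hT.star_eq]
      rw [ContinuousLinearMap.star_eq_adjoint, ContinuousLinearMap.adjoint_inner_left]
    rw [this, Complex.add_conj]
  have hA : ∀ a : A, h (fun i => π a (ζ i)) = 0 := by
    have hsa0 : ∀ a : A, IsSelfAdjoint a → h (fun i => π a (ζ i)) = 0 := fun a ha => by
      rw [hre _ (ha.map π), h0 a ha]; simp
    intro a
    have e : h (fun i => π a (ζ i)) = h (fun i => π (ℜ a : A) (ζ i)) +
        Complex.I * h (fun i => π (ℑ a : A) (ζ i)) := by
      conv_lhs => rw [← realPart_add_I_smul_imaginaryPart a]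
      simp only [h, Finset.mul_sum, ← Finset.sum_add_distrib]
      refine Finset.sum_congr rfl fun i _ => ?_
      simp only [map_add, map_smul, add_apply, smul_apply, inner_add_right, inner_smul_right]
      ring
    rw [e, hsa0 _ (ℜ a).2, hsa0 _ (ℑ a).2]; simp
  have hw0 : h (fun i => w (ζ i)) = 0 := by
    have := map_mem_closure hcont (mem_closure_range_of_mem_bicommutant π hw ζ)
      (t := {0}) (by rintro _ ⟨a, rfl⟩; exact hA a)
    simpa using this
  rw [hre w hsa] at hw0
  have : 2 * f (fun i : I => w (i : H)) = 0 := by exact_mod_cast hw0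
  linarith

end Density

section Kaplansky
open Filter Topology

/-- Closure points of an image are limits along filters. -/
theorem mem_closure_image_iff_filter {X Y : Type*} [TopologicalSpace Y] {Φ : X → Y} {s : Set X}
    {y : Y} : y ∈ closure (Φ '' s) ↔ ∃ l : Filter X, l.NeBot ∧ l ≤ 𝓟 s ∧ Tendsto Φ l (𝓝 y) := by
  constructor
  · intro h
    refine ⟨comap Φ (𝓝 y) ⊓ 𝓟 s, ?_, inf_le_right, tendsto_comap.mono_left inf_le_left⟩
    rw [mem_closure_iff_nhdsWithin_neBot, nhdsWithin, ← map_principal] at h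
    rw [← map_neBot_iff Φ, Filter.push_pull']
    exact h
  · rintro ⟨l, hl, hs, ht⟩
    exact mem_closure_of_tendsto ht (Filter.mem_of_superset (le_principal_iff.1 hs)
      fun a ha => ⟨a, ha, rfl⟩)

theorem reciprocal_sub_eq {R : Type*} [Ring R] {ρ B y Q : R} (h1 : ρ + ρ * B * B = 1)
    (h2 : Q + y * y * Q = 1) :
    ρ * B - y * Q = ρ * (B - y) * Q - ρ * B * (B - y) * y * Q := by
  have e1 : ρ * B = ρ * B * Q + ρ * B * (y * y * Q) := by rw [← mul_add, h2, mul_one]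
  have e2 : y * Q = ρ * (y * Q) + ρ * B * B * (y * Q) := by rw [← add_mul, h1, one_mul]
  calc ρ * B - y * Q = (ρ * B * Q + ρ * B * (y * y * Q)) - (ρ * (y * Q) + ρ * B * B * (y * Q)) := by
        rw [← e1, ← e2]
    _ = _ := by noncomm_ring

variable {H : Type*} [NormedAddCommGroup H] [InnerProductSpace ℂ H] [CompleteSpace H]
variable {A : Type*} [CStarAlgebra A] (π : A →⋆ₐ[ℂ] (H →L[ℂ] H))

theorem exists_kaplansky_preimage {w : H →L[ℂ] H} (hsa : IsSelfAdjoint w) (h1 : ‖w‖ ≤ 1) :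
    ∃ f g : ℝ → ℝ, w = (2 : ℝ) • (cfc f w * cfc g w) ∧
      cfc g w + cfc f w * cfc f w * cfc g w = 1 := by
  let s : ℝ → ℝ := fun t => √(1 - t ^ 2)
  have hs : ∀ t, 0 < 1 + s t := fun t => by have := Real.sqrt_nonneg (1 - t ^ 2); positivity
  have hsc : Continuous s := by fun_prop
  have hf : Continuous fun t : ℝ => t / (1 + s t) :=
    continuous_id.div (by fun_prop) fun t => (hs t).ne'
  have hg : Continuous fun t : ℝ => (1 + s t) / 2 := by fun_prop
  have hfg : Continuous fun t : ℝ => t / (1 + s t) * ((1 + s t) / 2) := hf.mul hg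
  have hff : Continuous fun t : ℝ => t / (1 + s t) * (t / (1 + s t)) := hf.mul hf
  have hffg : Continuous fun t : ℝ => t / (1 + s t) * (t / (1 + s t)) * ((1 + s t) / 2) :=
    hff.mul hg
  refine ⟨fun t => t / (1 + s t), fun t => (1 + s t) / 2, ?_, ?_⟩
  · rw [← cfc_mul _ _ w hf.continuousOn hg.continuousOn,
      ← cfc_smul (2 : ℝ) _ w hfg.continuousOn]
    conv_lhs => rw [← cfc_id' ℝ w]
    refine cfc_congr fun t _ => ?_
    have := (hs t).ne'
    simp only [smul_eq_mul]
    field_simp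
  · rw [← cfc_mul _ _ w hf.continuousOn hf.continuousOn,
      ← cfc_mul _ _ w hff.continuousOn hg.continuousOn,
      ← cfc_add w (fun t => (1 + s t) / 2)
        (fun t => t / (1 + s t) * (t / (1 + s t)) * ((1 + s t) / 2)) hg.continuousOn hffg.continuousOn, ← cfc_one ℝ w]
    refine cfc_congr fun t ht => ?_
    have h0 := (hs t).ne'
    have hle : |t| ≤ 1 := (spectrum.norm_le_norm_mul_of_mem ht).trans
      (mul_le_one₀ h1 (norm_nonneg _) ContinuousLinearMap.norm_id_le)
    have hsq : s t ^ 2 = 1 - t ^ 2 := Real.sq_sqrt (by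
      have := (sq_le_one_iff_abs_le_one t).2 hle
      linarith)
    simp only [Pi.one_apply]
    field_simp
    linear_combination hsq

theorem exists_kaplansky_transform {a : A} (ha : IsSelfAdjoint a) :
    ∃ b R : A, IsSelfAdjoint b ∧ ‖b‖ ≤ 1 ∧ ‖R‖ ≤ 1 ∧ ‖R * a‖ ≤ 1 ∧ R + R * a * a = 1 ∧
      b = (2 : ℝ) • (R * a) := by
  have hp : ∀ t : ℝ, (0 : ℝ) < 1 + t ^ 2 := fun t => by positivity
  have hf : Continuous fun t : ℝ => 1 / (1 + t ^ 2) :=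
    continuous_const.div (by fun_prop) fun t => (hp t).ne'
  have hRa : cfc (fun t : ℝ => 1 / (1 + t ^ 2)) a * a = cfc (fun t : ℝ => 1 / (1 + t ^ 2) * t) a := by
    rw [cfc_mul _ (fun t => t) a hf.continuousOn continuousOn_id, cfc_id' ℝ a]
  have hfc : Continuous fun t : ℝ => 1 / (1 + t ^ 2) * t := hf.mul continuous_id
  have hb : ‖cfc (fun t : ℝ => 2 • (1 / (1 + t ^ 2) * t)) a‖ ≤ 1 := by
    refine norm_cfc_le zero_le_one fun t _ => ?_
    have := hp t
    rw [Real.norm_eq_abs, abs_le]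
    simp only [nsmul_eq_mul, Nat.cast_ofNat]
    constructor
    · field_simp; nlinarith [sq_nonneg (t + 1)]
    · field_simp; nlinarith [sq_nonneg (t - 1)]
  have he : cfc (fun t : ℝ => 2 • (1 / (1 + t ^ 2) * t)) a =
      (2 : ℝ) • (cfc (fun t : ℝ => 1 / (1 + t ^ 2)) a * a) := by
    rw [hRa, ← cfc_smul (2 : ℝ) _ a hfc.continuousOn]
    exact cfc_congr fun t _ => by simp
  refine ⟨_, cfc (fun t : ℝ => 1 / (1 + t ^ 2)) a, cfc_predicate _ a, hb, ?_, ?_, ?_, he⟩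
  · refine norm_cfc_le zero_le_one fun t _ => ?_
    have := hp t
    rw [Real.norm_eq_abs, abs_of_pos (by positivity), div_le_one this]
    nlinarith [sq_nonneg t]
  · rw [he, norm_smul, Real.norm_two] at hb
    linarith [norm_nonneg (cfc (fun t : ℝ => 1 / (1 + t ^ 2)) a * a)]
  · rw [hRa]
    nth_rw 3 [← cfc_id' ℝ a]
    have hft : Continuous fun t : ℝ => 1 / (1 + t ^ 2) * t * t := hfc.mul continuous_id
    rw [← cfc_mul _ (fun t => t) a hfc.continuousOn continuousOn_id,
      ← cfc_add a _ _ hf.continuousOn hft.continuousOn, ← cfc_one ℝ a]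
    refine cfc_congr fun t _ => ?_
    have := (hp t).ne'
    simp only [Pi.one_apply]
    field_simp

theorem exists_filter_of_norm_le_one {w : H →L[ℂ] H}
    (hw : w ∈ StarSubalgebra.centralizer ℂ (repCommutant π)) (hsa : IsSelfAdjoint w)
    (h1 : ‖w‖ ≤ 1) :
    (fun ζ => w ζ) ∈
      closure ((fun (a : A) (ζ : H) => π a ζ) '' {a | IsSelfAdjoint a ∧ ‖a‖ ≤ 1}) := by
  obtain ⟨f, g, hwfg, hfg⟩ := exists_kaplansky_preimage hsa h1
  set y := cfc f w with hy
  set Q := cfc g w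
  clear_value Q
  have hysa : IsSelfAdjoint y := cfc_predicate _ _
  have hyM := cfc_mem_centralizer hw f
  rw [← hy] at hyM
  clear_value y
  obtain ⟨l, hl, hls, hlt⟩ := mem_closure_image_iff_filter.1 (mem_closure_selfAdjoint π hyM hysa)
  have htr : ∀ a : A, ∃ b : A, IsSelfAdjoint a → (IsSelfAdjoint b ∧ ‖b‖ ≤ 1 ∧ ∀ ζ,
      ‖π b ζ - w ζ‖ ≤ 2 * (‖π a (Q ζ) - y (Q ζ)‖ + ‖π a (y (Q ζ)) - y (y (Q ζ))‖)) := by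
    intro a
    by_cases ha : IsSelfAdjoint a
    swap
    · exact ⟨0, fun h => absurd h ha⟩
    obtain ⟨b, R, hb, hb1, hR, hRa, hR1, hbR⟩ := exists_kaplansky_transform ha
    refine ⟨b, fun _ => ⟨hb, hb1, fun ζ => ?_⟩⟩
    have e1 : π R + π R * π a * π a = 1 := by
      rw [← map_mul, ← map_mul, ← map_add, hR1, map_one]
    have key := congrArg (fun T : H →L[ℂ] H => T ζ) (reciprocal_sub_eq e1 hfg)
    have e2 : π b ζ - w ζ = (2 : ℝ) • ((π R * π a - y * Q) ζ) := by
      rw [hwfg, hbR, ← Complex.coe_smul, map_smul, map_mul, sub_apply, smul_sub, Complex.coe_smul]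
      rfl
    rw [e2, norm_smul, Real.norm_two]
    refine mul_le_mul_of_nonneg_left ?_ zero_le_two
    beta_reduce at key
    rw [key]
    have h2 : ‖π R‖ ≤ 1 := (NonUnitalStarAlgHom.norm_apply_le π R).trans hR
    have h3 : ‖π R * π a‖ ≤ 1 := by
      rw [← map_mul]; exact (NonUnitalStarAlgHom.norm_apply_le π _).trans hRa
    refine (norm_sub_le _ _).trans (add_le_add ?_ ?_)
    · exact ((π R).le_of_opNorm_le h2 (π a (Q ζ) - y (Q ζ))).trans_eq (one_mul _)
    · exact ((π R * π a).le_of_opNorm_le h3 (π a (y (Q ζ)) - y (y (Q ζ)))).trans_eq (one_mul _)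
  choose b hb using htr
  have hsl : ∀ᶠ a in l, IsSelfAdjoint a := le_principal_iff.1 hls
  refine mem_closure_image_iff_filter.2 ⟨l.map b, inferInstance, ?_, ?_⟩
  · rw [le_principal_iff, mem_map]
    filter_upwards [hsl] with a ha using ⟨(hb a ha).1, (hb a ha).2.1⟩
  · rw [tendsto_map'_iff, tendsto_pi_nhds]
    intro ζ
    rw [tendsto_iff_norm_sub_tendsto_zero]
    rw [tendsto_pi_nhds] at hlt
    have h4 := ((tendsto_iff_norm_sub_tendsto_zero.1 (hlt (Q ζ))).add
      (tendsto_iff_norm_sub_tendsto_zero.1 (hlt (y (Q ζ))))).const_mul 2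
    rw [add_zero, mul_zero] at h4
    refine squeeze_zero' (Eventually.of_forall fun _ => norm_nonneg _) ?_ h4
    filter_upwards [hsl] with a ha using (hb a ha).2.2 ζ

/-- Strong approximation of an operator by bounded self-adjoint elements along a filter. -/
structure IsStrongApprox (l : Filter A) (w : H →L[ℂ] H) (r : ℝ) : Prop where
  neBot : l.NeBot
  eventually : ∀ᶠ a in l, IsSelfAdjoint a ∧ ‖a‖ ≤ r
  tendsto : ∀ ζ, Tendsto (fun a => π a ζ) l (𝓝 (w ζ))

/-- The Kaplansky density theorem. -/
theorem exists_isStrongApprox {w : H →L[ℂ] H}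
    (hw : w ∈ StarSubalgebra.centralizer ℂ (repCommutant π)) (hsa : IsSelfAdjoint w) {r : ℝ}
    (hr : 0 < r) (hwr : ‖w‖ ≤ r) : ∃ l : Filter A, IsStrongApprox π l w r := by
  obtain ⟨l, hl, hls, hlt⟩ := mem_closure_image_iff_filter.1 (exists_filter_of_norm_le_one π
    (w := (r⁻¹ : ℝ) • w) (by
      rw [← Complex.coe_smul]; exact StarSubalgebra.smul_mem _ hw _)
    ((IsSelfAdjoint.all _).smul hsa) (by
      rw [norm_smul, norm_inv, Real.norm_of_nonneg hr.le]
      exact (inv_mul_le_one₀ hr).2 hwr))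
  refine ⟨l.map (r • ·), inferInstance, ?_, fun ζ => ?_⟩
  · rw [eventually_map]
    filter_upwards [le_principal_iff.1 hls] with a ha
    refine ⟨(IsSelfAdjoint.all r).smul ha.1, ?_⟩
    rw [norm_smul, Real.norm_of_nonneg hr.le]
    exact mul_le_of_le_one_right hr.le ha.2
  · rw [tendsto_map'_iff]
    have := ((tendsto_pi_nhds.1 hlt) ζ).const_smul r
    refine (this.congr fun a => ?_).trans_eq ?_
    · simp [← Complex.coe_smul]
    · simp [smul_smul, hr.ne']

end Kaplansky

section StrongContinuity
open Filter Topology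
variable {H : Type*} [NormedAddCommGroup H] [InnerProductSpace ℂ H] [CompleteSpace H]
variable {A : Type*} [CStarAlgebra A] {π : A →⋆ₐ[ℂ] (H →L[ℂ] H)}

omit [CompleteSpace H] in
theorem tendsto_mul_apply {X : Type*} {l : Filter X} {F G : X → (H →L[ℂ] H)} {x y : H →L[ℂ] H}
    {r : ℝ} (hr : ∀ᶠ a in l, ‖F a‖ ≤ r) (hF : ∀ ζ, Tendsto (fun a => F a ζ) l (𝓝 (x ζ)))
    (hG : ∀ ζ, Tendsto (fun a => G a ζ) l (𝓝 (y ζ))) (ζ : H) :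
    Tendsto (fun a => (F a * G a) ζ) l (𝓝 ((x * y) ζ)) := by
  have h1 : Tendsto (fun a => F a (G a ζ - y ζ)) l (𝓝 0) := by
    rw [tendsto_zero_iff_norm_tendsto_zero]
    have h2 := (tendsto_iff_norm_sub_tendsto_zero.1 (hG ζ)).const_mul r
    rw [mul_zero] at h2
    refine squeeze_zero' (Eventually.of_forall fun _ => norm_nonneg _) ?_ h2
    filter_upwards [hr] with a ha using (F a).le_of_opNorm_le ha _
  have h3 := h1.add (hF (y ζ))
  rw [zero_add] at h3
  exact h3.congr fun a => by simp

theorem IsStrongApprox.eventually_norm_le {l : Filter A} {w : H →L[ℂ] H} {r : ℝ}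
    (h : IsStrongApprox π l w r) : ∀ᶠ a in l, ‖π a‖ ≤ r := by
  filter_upwards [h.eventually] with a ha using (NonUnitalStarAlgHom.norm_apply_le π a).trans ha.2

theorem IsStrongApprox.tendsto_aeval {l : Filter A} {w : H →L[ℂ] H} {r : ℝ}
    (h : IsStrongApprox π l w r) (p : Polynomial ℝ) (ζ : H) :
    Tendsto (fun a => Polynomial.aeval (π a) p ζ) l (𝓝 (Polynomial.aeval w p ζ)) := by
  induction p using Polynomial.induction_on' generalizing ζ with
  | add p q hp hq => simpa using (hp ζ).add (hq ζ)
  | monomial n t =>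
    have hpow : ∀ n : ℕ, ∀ ζ, Tendsto (fun a => (π a ^ n) ζ) l (𝓝 ((w ^ n) ζ)) := by
      intro n
      induction n with
      | zero => intro ζ; simpa using tendsto_const_nhds
      | succ n ih =>
        intro ζ
        simp only [pow_succ']
        exact tendsto_mul_apply h.eventually_norm_le h.tendsto ih ζ
    simp only [Polynomial.aeval_monomial, ← Algebra.smul_def, smul_apply]
    exact (hpow n ζ).const_smul t

theorem norm_cfc_sub_aeval_le {B : Type*} [CStarAlgebra B] {x : B} (hx : IsSelfAdjoint x) {R : ℝ}
    (hxR : ‖x‖ ≤ R) {f : ℝ → ℝ} (hf : Continuous f) {p : Polynomial ℝ} {ε : ℝ} (hε : 0 ≤ ε)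
    (hp : ∀ t ∈ Set.Icc (-R) R, |p.eval t - f t| ≤ ε) : ‖cfc f x - Polynomial.aeval x p‖ ≤ ε := by
  rw [← cfc_polynomial p x, ← cfc_sub f _ x hf.continuousOn p.continuous.continuousOn]
  refine norm_cfc_le hε fun t ht => ?_
  rw [Real.norm_eq_abs, abs_sub_comm]
  refine hp t (abs_le.1 ?_)
  rcases subsingleton_or_nontrivial B with hB | hB
  · simp [spectrum.of_subsingleton] at ht
  · exact (spectrum.norm_le_norm_of_mem ht).trans hxR

/-- Strong continuity of the functional calculus on bounded sets. -/
theorem IsStrongApprox.tendsto_cfc {l : Filter A} {w : H →L[ℂ] H} {r : ℝ}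
    (h : IsStrongApprox π l w r) (hw : IsSelfAdjoint w) {f : ℝ → ℝ} (hf : Continuous f) (ζ : H) :
    Tendsto (fun a => π (cfc f a) ζ) l (𝓝 (cfc f w ζ)) := by
  rw [Metric.tendsto_nhds]
  intro ε hε
  obtain ⟨η, hη, hηε⟩ : ∃ η > 0, η * ‖ζ‖ < ε / 3 := by
    refine ⟨ε / 3 / (‖ζ‖ + 1), by positivity, ?_⟩
    rw [div_mul_eq_mul_div, div_lt_iff₀ (by positivity)]
    nlinarith [norm_nonneg ζ]
  obtain ⟨p, hp⟩ := exists_polynomial_near_of_continuousOn (-(max r ‖w‖)) (max r ‖w‖) f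
    hf.continuousOn η hη
  have hp' := fun t ht => (hp t ht).le
  have hev := Metric.tendsto_nhds.1 (h.tendsto_aeval p ζ) (ε / 3) (by positivity)
  filter_upwards [hev, h.eventually, h.eventually_norm_le] with a h1 h2 h3
  have hπ : Continuous π :=
    AddMonoidHomClass.continuous_of_bound π 1 fun a => by
      rw [one_mul]; exact NonUnitalStarAlgHom.norm_apply_le π a
  have e1 : π (cfc f a) = cfc f (π a) :=
    StarAlgHomClass.map_cfc ((π : A →⋆ₐ[ℂ] (H →L[ℂ] H)).restrictScalars ℝ) f a hf.continuousOn hπ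
      h2.1 (h2.1.map π)
  rw [e1]
  have b1 := norm_cfc_sub_aeval_le (h2.1.map π) (h3.trans (le_max_left _ ‖w‖)) hf hη.le hp'
  have b2 := norm_cfc_sub_aeval_le hw (le_max_right r _) hf hη.le hp'
  have c1 := ((cfc f (π a) - Polynomial.aeval (π a) p).le_of_opNorm_le b1 ζ).trans_lt hηε
  have c2 := ((cfc f w - Polynomial.aeval w p).le_of_opNorm_le b2 ζ).trans_lt hηε
  rw [sub_apply, ← dist_eq_norm] at c1 c2
  have := dist_triangle4 (cfc f (π a) ζ) (Polynomial.aeval (π a) p ζ) (Polynomial.aeval w p ζ)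
    (cfc f w ζ)
  rw [dist_comm] at c2
  linarith

theorem IsStrongApprox.cfc {l : Filter A} {w : H →L[ℂ] H} {r : ℝ}
    (h : IsStrongApprox π l w r) (hw : IsSelfAdjoint w) {f : ℝ → ℝ} (hf : Continuous f) :
    ∃ R, IsStrongApprox π (l.map (cfc f)) (cfc f w) R := by
  obtain ⟨R, hR⟩ := isCompact_Icc.exists_bound_of_continuousOn (s := Set.Icc (-r) r) hf.continuousOn
  refine ⟨max R 0, h.neBot.map _, ?_, fun ζ => ?_⟩
  · rw [eventually_map]
    filter_upwards [h.eventually] with a ha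
    refine ⟨cfc_predicate _ _, norm_cfc_le (le_max_right _ _) fun t ht => ?_⟩
    refine (hR t (abs_le.1 ?_)).trans (le_max_left _ _)
    rcases subsingleton_or_nontrivial A with hB | hB
    · simp [spectrum.of_subsingleton] at ht
    · exact (spectrum.norm_le_norm_of_mem ht).trans ha.2
  · rw [tendsto_map'_iff]
    exact h.tendsto_cfc hw hf ζ

theorem IsStrongApprox.smul {l : Filter A} {w : H →L[ℂ] H} {r : ℝ}
    (h : IsStrongApprox π l w r) (t : ℝ) :
    IsStrongApprox π (l.map (t • ·)) (t • w) (|t| * r) := by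
  refine ⟨h.neBot.map _, ?_, fun ζ => ?_⟩
  · rw [eventually_map]
    filter_upwards [h.eventually] with a ha
    refine ⟨(IsSelfAdjoint.all t).smul ha.1, ?_⟩
    rw [norm_smul, Real.norm_eq_abs]
    exact mul_le_mul_of_nonneg_left ha.2 (abs_nonneg t)
  · rw [tendsto_map'_iff]
    exact ((h.tendsto ζ).const_smul t).congr fun a => by simp [← Complex.coe_smul]

end StrongContinuity

section Orthogonal
open Filter Topology
variable {B : Type*} [CStarAlgebra B]

/-- Functional calculus as a limit of polynomials without constant term. -/
theorem exists_tendsto_aeval {f : ℝ → ℝ} (hf : Continuous f) (hf0 : f 0 = 0) (R : ℝ) :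
    ∃ p : ℕ → Polynomial ℝ, (∀ n, (p n).coeff 0 = 0) ∧ ∀ x : B, IsSelfAdjoint x → ‖x‖ ≤ R →
      Tendsto (fun n => Polynomial.aeval x (p n)) atTop (𝓝 (cfc f x)) := by
  have hex : ∀ n : ℕ, ∃ p : Polynomial ℝ, p.coeff 0 = 0 ∧
      ∀ t ∈ Set.Icc (-R) R, |p.eval t - f t| ≤ 2 * (1 / ((n : ℝ) + 1)) := by
    intro n
    obtain ⟨p, hp⟩ := exists_polynomial_near_of_continuousOn (-R) R f hf.continuousOn
      (1 / ((n : ℝ) + 1)) (by positivity)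
    refine ⟨p - Polynomial.C (p.coeff 0), by simp, fun t ht => ?_⟩
    have h0 := hp 0 ⟨by linarith [ht.1, ht.2], by linarith [ht.1, ht.2]⟩
    have ht := hp t ht
    rw [hf0, sub_zero, ← Polynomial.coeff_zero_eq_eval_zero] at h0
    rw [Polynomial.eval_sub, Polynomial.eval_C, sub_right_comm]
    linarith [abs_sub (p.eval t - f t) (p.coeff 0)]
  choose p hp0 hp using hex
  refine ⟨p, hp0, fun x hx hxR => ?_⟩
  rw [tendsto_iff_norm_sub_tendsto_zero]
  have h2 := (tendsto_one_div_add_atTop_nhds_zero_nat (𝕜 := ℝ)).const_mul 2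
  rw [mul_zero] at h2
  refine squeeze_zero (fun _ => norm_nonneg _) (fun n => ?_) h2
  rw [norm_sub_rev]
  exact norm_cfc_sub_aeval_le hx hxR hf (by positivity) (hp n)

theorem aeval_add_of_mul_eq_zero {R : Type*} [Ring R] [Algebra ℝ R] {x y : R} (h : x * y = 0)
    (h' : y * x = 0) {p : Polynomial ℝ} (hp : p.coeff 0 = 0) :
    Polynomial.aeval (x + y) p = Polynomial.aeval x p + Polynomial.aeval y p := by
  have hpow : ∀ n : ℕ, (x + y) ^ (n + 1) = x ^ (n + 1) + y ^ (n + 1) := by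
    intro n
    induction n with
    | zero => simp
    | succ n ih =>
      rw [pow_succ (x + y), ih, mul_add, add_mul, add_mul, pow_succ y n, pow_succ x n, mul_assoc _ y x,
        mul_assoc _ x y, h, h', pow_succ x (n + 1), pow_succ y (n + 1), pow_succ x, pow_succ y]
      simp
  simp only [Polynomial.aeval_eq_sum_range, ← Finset.sum_add_distrib]
  refine Finset.sum_congr rfl fun n _ => ?_
  cases n with
  | zero => simp [hp]
  | succ n => rw [hpow, smul_add]

theorem mul_aeval_eq_zero {R : Type*} [Ring R] [Algebra ℝ R] {z y : R} (h : z * y = 0)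
    {p : Polynomial ℝ} (hp : p.coeff 0 = 0) : z * Polynomial.aeval y p = 0 := by
  obtain ⟨q, rfl⟩ := Polynomial.X_dvd_iff.2 hp
  rw [map_mul, Polynomial.aeval_X, ← mul_assoc, h, zero_mul]

theorem IsSelfAdjoint.mul_eq_zero_symm {x y : B} (hx : IsSelfAdjoint x) (hy : IsSelfAdjoint y)
    (h : x * y = 0) : y * x = 0 := by
  have := congrArg star h
  rwa [star_mul, hx.star_eq, hy.star_eq, star_zero] at this

theorem cfc_add_of_mul_eq_zero {x y : B} (hx : IsSelfAdjoint x) (hy : IsSelfAdjoint y)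
    (h : x * y = 0) {f : ℝ → ℝ} (hf : Continuous f) (hf0 : f 0 = 0) :
    cfc f (x + y) = cfc f x + cfc f y := by
  obtain ⟨p, hp0, hp⟩ := exists_tendsto_aeval (B := B) hf hf0 (‖x‖ + ‖y‖)
  refine tendsto_nhds_unique (hp _ (hx.add hy) (norm_add_le x y)) ?_
  refine ((hp x hx (by linarith [norm_nonneg y])).add
    (hp y hy (by linarith [norm_nonneg x]))).congr fun n => ?_
  exact (aeval_add_of_mul_eq_zero h (hx.mul_eq_zero_symm hy h) (hp0 n)).symm

theorem mul_cfc_eq_zero {z y : B} (hy : IsSelfAdjoint y) (h : z * y = 0) {f : ℝ → ℝ}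
    (hf : Continuous f) (hf0 : f 0 = 0) : z * cfc f y = 0 := by
  obtain ⟨p, hp0, hp⟩ := exists_tendsto_aeval (B := B) hf hf0 ‖y‖
  refine tendsto_nhds_unique ((hp y hy le_rfl).const_mul z) ?_
  exact tendsto_const_nhds.congr fun n => (mul_aeval_eq_zero h (hp0 n)).symm

theorem cfc_mul_cfc_eq_zero {x y : B} (hx : IsSelfAdjoint x) (hy : IsSelfAdjoint y)
    (h : x * y = 0) {f : ℝ → ℝ} (hf : Continuous f) (hf0 : f 0 = 0) :
    cfc f x * cfc f y = 0 := by
  refine IsSelfAdjoint.mul_eq_zero_symm (cfc_predicate f y) (cfc_predicate f x) ?_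
  exact mul_cfc_eq_zero hx (hx.mul_eq_zero_symm (cfc_predicate f y) (mul_cfc_eq_zero hy h hf hf0))
    hf hf0

/-- A function which is additive on commuting pairs generated by one element is additive on
orthogonal pairs. -/
theorem map_add_of_mul_eq_zero {M : B → Prop} {m : B → ℝ}
    (hM : ∀ x, M x → IsSelfAdjoint x → ∀ f : ℝ → ℝ, M (cfc f x))
    (hMsub : ∀ x y, M x → M y → M (x - y))
    (hMadd : ∀ x y, M x → M y → M (x + y))
    (hm : ∀ x, M x → IsSelfAdjoint x → ∀ f g : ℝ → ℝ, Continuous f → Continuous g →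
      m (cfc f x + cfc g x) = m (cfc f x) + m (cfc g x))
    {x y : B} (hx : M x) (hy : M y) (hxsa : IsSelfAdjoint x) (hysa : IsSelfAdjoint y)
    (h : x * y = 0) : m (x + y) = m x + m y := by
  let p : ℝ → ℝ := fun t => max t 0
  let n : ℝ → ℝ := fun t => min t 0
  have hp : Continuous p := by fun_prop
  have hn : Continuous n := by fun_prop
  have hp0 : p 0 = 0 := max_self 0
  have hn0 : n 0 = 0 := min_self 0
  have hsplit : ∀ u : B, IsSelfAdjoint u → cfc p u + cfc n u = u := by
    intro u hu
    rw [← cfc_add u p n hp.continuousOn hn.continuousOn]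
    conv_rhs => rw [← cfc_id' ℝ u]
    exact cfc_congr fun t _ => by simp [p, n]
  have hdec : ∀ u : B, M u → IsSelfAdjoint u → m u = m (cfc p u) + m (cfc n u) := by
    intro u hu husa
    rw [← hm u hu husa p n hp hn, hsplit u husa]
  have hsub : ∀ f g : ℝ → ℝ, Continuous f → Continuous g → f 0 = 0 → g 0 = 0 →
      (∀ t, f (f t) = f t) → (∀ t, f (-f t) = 0) → (∀ t, g (f t) = 0) →
      (∀ t, g (-f t) = f t) → m (cfc f x + cfc f y) = m (cfc f x) + m (cfc f y) := by
    intro f g hf hg hf0 hg0 hff hfn hgf hgn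
    have hfx : IsSelfAdjoint (cfc f x) := cfc_predicate f x
    have hfy : IsSelfAdjoint (cfc f y) := cfc_predicate f y
    have hneg : -cfc f y = cfc (fun t => -f t) y := (cfc_neg f y).symm
    have key : ∀ k : ℝ → ℝ, Continuous k → k 0 = 0 → cfc k (cfc f x - cfc f y) =
        cfc (fun t => k (f t)) x + cfc (fun t => k (-f t)) y := by
      intro k hk hk0
      rw [sub_eq_add_neg, cfc_add_of_mul_eq_zero hfx hfy.neg
        (by rw [mul_neg, cfc_mul_cfc_eq_zero hxsa hysa h hf hf0, neg_zero]) hk hk0, hneg,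
        ← cfc_comp' k f x hk.continuousOn hf.continuousOn,
        ← cfc_comp' k (fun t => -f t) y hk.continuousOn hf.neg.continuousOn]
    have e1 : cfc f (cfc f x - cfc f y) = cfc f x := by
      rw [key f hf hf0]; simp [hff, hfn]
    have e2 : cfc g (cfc f x - cfc f y) = cfc f y := by
      rw [key g hg hg0]; simp [hgf, hgn]
    have := hm _ (hMsub _ _ (hM x hx hxsa f) (hM y hy hysa f)) (hfx.sub hfy) f g hf hg
    rwa [e1, e2] at this
  rw [hdec _ (hMadd _ _ hx hy) (hxsa.add hysa), cfc_add_of_mul_eq_zero hxsa hysa h hp hp0,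
    cfc_add_of_mul_eq_zero hxsa hysa h hn hn0,
    hsub p (fun t => -n t) hp hn.neg hp0 (by simp [hn0]), hsub n (fun t => -p t) hn hp.neg hn0
      (by simp [hp0]), hdec x hx hxsa, hdec y hy hysa]
  · ring
  all_goals intro t; rcases le_total t 0 with ht | ht <;> simp [p, n, ht]

end Orthogonal

section Extension
open Filter Topology
variable {H : Type*} [NormedAddCommGroup H] [InnerProductSpace ℂ H] [CompleteSpace H]
variable {A : Type*} [CStarAlgebra A] {π : A →⋆ₐ[ℂ] (H →L[ℂ] H)} {ξ : H} {μ : A → ℝ}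

/-- Uniform continuity of `μ` on bounded self-adjoint sets for the weak topology at `ξ`. -/
def IsUniformlyWeak (π : A →⋆ₐ[ℂ] (H →L[ℂ] H)) (ξ : H) (μ : A → ℝ) (r : ℝ) : Prop :=
  ∀ ε > 0, ∃ δ > 0, ∃ s : Finset H, ∀ a b, IsSelfAdjoint a → IsSelfAdjoint b → ‖a‖ ≤ r → ‖b‖ ≤ r →
    (∀ η ∈ s, ‖⟪η, π a ξ - π b ξ⟫_ℂ‖ < δ) → |μ a - μ b| < ε

theorem IsUniformlyWeak.of_one (h : IsUniformlyWeak π ξ μ 1)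
    (hsmul : ∀ a, IsSelfAdjoint a → ∀ t : ℝ, μ (t • a) = t * μ a) {r : ℝ} (hr : 0 < r) :
    IsUniformlyWeak π ξ μ r := by
  intro ε hε
  obtain ⟨δ, hδ, s, hs⟩ := h (ε / r) (by positivity)
  refine ⟨r * δ, by positivity, s, fun a b ha hb har hbr hab => ?_⟩
  have hn : ∀ c : A, ‖c‖ ≤ r → ‖r⁻¹ • c‖ ≤ 1 := fun c hc => by
    rw [norm_smul, norm_inv, Real.norm_of_nonneg hr.le]
    exact (inv_mul_le_one₀ hr).2 hc
  have := hs (r⁻¹ • a) (r⁻¹ • b) ((IsSelfAdjoint.all _).smul ha) ((IsSelfAdjoint.all _).smul hb)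
    (hn a har) (hn b hbr) fun η hη => by
      have e : π (r⁻¹ • a) ξ - π (r⁻¹ • b) ξ = ((r⁻¹ : ℝ) : ℂ) • (π a ξ - π b ξ) := by
        rw [← Complex.coe_smul, ← Complex.coe_smul, map_smul, map_smul, smul_sub]; rfl
      rw [e, inner_smul_right, norm_mul, Complex.norm_real, norm_inv, Real.norm_of_nonneg hr.le,
        inv_mul_lt_iff₀ hr]
      exact hab η hη
  rwa [hsmul a ha, hsmul b hb, ← mul_sub, abs_mul, abs_inv, abs_of_pos hr, inv_mul_eq_div,
    div_lt_div_iff_of_pos_right hr] at this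

theorem IsUniformlyWeak.eventually {r ε : ℝ} (h : IsUniformlyWeak π ξ μ r) (hε : 0 < ε) :
    ∃ δ > 0, ∃ s : Finset H, ∀ x y : H →L[ℂ] H, (∀ η ∈ s, ‖⟪η, x ξ - y ξ⟫_ℂ‖ < δ) →
      ∀ l k : Filter A, IsStrongApprox π l x r → IsStrongApprox π k y r →
        ∀ᶠ p in l ×ˢ k, |μ p.1 - μ p.2| < ε := by
  obtain ⟨δ, hδ, s, hs⟩ := h ε hε
  refine ⟨δ, hδ, s, fun x y hxy l k hl hk => ?_⟩
  have h1 : Tendsto (fun p : A × A => π p.1 ξ - π p.2 ξ) (l ×ˢ k) (𝓝 (x ξ - y ξ)) :=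
    ((hl.tendsto ξ).comp tendsto_fst).sub ((hk.tendsto ξ).comp tendsto_snd)
  have h2 : ∀ᶠ p in l ×ˢ k, ∀ η ∈ s, ‖⟪η, π p.1 ξ - π p.2 ξ⟫_ℂ‖ < δ := by
    rw [Finset.eventually_all]
    intro η hη
    have h3 : Tendsto (fun p : A × A => ‖⟪η, π p.1 ξ - π p.2 ξ⟫_ℂ‖) (l ×ˢ k)
        (𝓝 ‖⟪η, x ξ - y ξ⟫_ℂ‖) := (tendsto_const_nhds.inner h1).norm
    exact h3.eventually_lt_const (hxy η hη)
  filter_upwards [h2, tendsto_fst.eventually hl.eventually, tendsto_snd.eventually hk.eventually]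
    with p h4 h5 h6 using hs p.1 p.2 h5.1 h6.1 h5.2 h6.2 h4

theorem IsStrongApprox.mono {l : Filter A} {w : H →L[ℂ] H} {r R : ℝ} (h : IsStrongApprox π l w r)
    (hrR : r ≤ R) : IsStrongApprox π l w R :=
  ⟨h.neBot, h.eventually.mono fun _ ha => ⟨ha.1, ha.2.trans hrR⟩, h.tendsto⟩

theorem exists_limit (h : ∀ r > 0, IsUniformlyWeak π ξ μ r) {w : H →L[ℂ] H}
    (hw : w ∈ StarSubalgebra.centralizer ℂ (repCommutant π)) (hsa : IsSelfAdjoint w) :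
    ∃ v : ℝ, ∀ l r, IsStrongApprox π l w r → Tendsto μ l (𝓝 v) := by
  obtain ⟨l₀, hl₀⟩ := exists_isStrongApprox π hw hsa (r := ‖w‖ + 1) (by positivity)
    (le_add_of_nonneg_right zero_le_one)
  have := hl₀.neBot
  have hc : Cauchy (l₀.map μ) := by
    rw [Metric.cauchy_iff]
    refine ⟨inferInstance, fun ε hε => ?_⟩
    obtain ⟨δ, hδ, s, hs⟩ := (h (‖w‖ + 1) (by positivity)).eventually hε
    have h1 := hs w w (by simpa using fun _ _ => hδ) l₀ l₀ hl₀ hl₀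
    obtain ⟨t, ht, ht'⟩ := mem_prod_same_iff.1 h1
    refine ⟨μ '' t, image_mem_map ht, ?_⟩
    rintro _ ⟨a, ha, rfl⟩ _ ⟨b, hb, rfl⟩
    exact ht' (Set.mk_mem_prod ha hb)
  obtain ⟨v, hv⟩ := CompleteSpace.complete hc
  refine ⟨v, fun l r hl => ?_⟩
  rw [Metric.tendsto_nhds]
  intro ε hε
  obtain ⟨δ, hδ, s, hs⟩ := (h (max (‖w‖ + 1) r) (by positivity)).eventually (half_pos hε)
  have h1 := (hs w w (by simpa using fun _ _ => hδ) l l₀ (hl.mono (le_max_right _ _))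
    (hl₀.mono (le_max_left _ _))).curry
  filter_upwards [h1] with a ha
  have h2 : Tendsto (fun b => |μ a - μ b|) l₀ (𝓝 |μ a - v|) :=
    (tendsto_const_nhds.sub (show Tendsto μ l₀ (𝓝 v) from hv)).abs
  have h3 := le_of_tendsto h2 (ha.mono fun b hb => hb.le)
  rw [Real.dist_eq]
  linarith

/-- The extension of `μ` by strong limits is locally linear. -/
theorem exists_isLocallyLinear (h1 : IsUniformlyWeak π ξ μ 1)
    (hsmul : ∀ a, IsSelfAdjoint a → ∀ t : ℝ, μ (t • a) = t * μ a)
    (hadd : ∀ a, IsSelfAdjoint a → ∀ f g : ℝ → ℝ, Continuous f → Continuous g →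
      μ (cfc f a + cfc g a) = μ (cfc f a) + μ (cfc g a)) :
    ∃ m : (H →L[ℂ] H) → ℝ, IsLocallyLinear (repCommutant π) ξ m ∧
      ∀ a, IsSelfAdjoint a → m (π a) = μ a := by
  have h : ∀ r > 0, IsUniformlyWeak π ξ μ r := fun r hr => h1.of_one hsmul hr
  have hex : ∀ w : H →L[ℂ] H, ∃ v : ℝ, w ∈ StarSubalgebra.centralizer ℂ (repCommutant π) →
      IsSelfAdjoint w → ∀ l r, IsStrongApprox π l w r → Tendsto μ l (𝓝 v) := by
    intro w
    by_cases hw : w ∈ StarSubalgebra.centralizer ℂ (repCommutant π) ∧ IsSelfAdjoint w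
    · obtain ⟨v, hv⟩ := exists_limit h hw.1 hw.2
      exact ⟨v, fun _ _ => hv⟩
    · exact ⟨0, fun h1 h2 => absurd ⟨h1, h2⟩ hw⟩
  choose m hm using hex
  have hsmul' : ∀ x ∈ StarSubalgebra.centralizer ℂ (repCommutant π), IsSelfAdjoint x → ∀ t : ℝ,
      m (t • x) = t * m x := by
    intro x hx hxsa t
    obtain ⟨l, hl⟩ := exists_isStrongApprox π hx hxsa (r := ‖x‖ + 1) (by positivity)
      (le_add_of_nonneg_right zero_le_one)
    have := hl.neBot
    have e1 := hm (t • x) (by rw [← Complex.coe_smul]; exact StarSubalgebra.smul_mem _ hx _)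
      ((IsSelfAdjoint.all t).smul hxsa) _ _ (hl.smul t)
    rw [tendsto_map'_iff] at e1
    refine tendsto_nhds_unique (e1.congr' ?_) ((hm x hx hxsa _ _ hl).const_mul t)
    filter_upwards [hl.eventually] with a ha using hsmul a ha.1 t
  have hcfc : ∀ x ∈ StarSubalgebra.centralizer ℂ (repCommutant π), IsSelfAdjoint x →
      ∀ f g : ℝ → ℝ, Continuous f → Continuous g →
        m (cfc f x + cfc g x) = m (cfc f x) + m (cfc g x) := by
    intro x hx hxsa f g hf hg
    obtain ⟨l, hl⟩ := exists_isStrongApprox π hx hxsa (r := ‖x‖ + 1) (by positivity)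
      (le_add_of_nonneg_right zero_le_one)
    have := hl.neBot
    have lim : ∀ f : ℝ → ℝ, Continuous f → Tendsto (fun a => μ (cfc f a)) l (𝓝 (m (cfc f x))) := by
      intro f hf
      obtain ⟨R, hR⟩ := hl.cfc hxsa hf
      have := hm _ (cfc_mem_centralizer hx f) (cfc_predicate f x) _ _ hR
      rwa [tendsto_map'_iff] at this
    have h3 := lim (fun t => f t + g t) (hf.add hg)
    rw [cfc_add x f g hf.continuousOn hg.continuousOn] at h3
    refine tendsto_nhds_unique (h3.congr' ?_) ((lim f hf).add (lim g hg))
    filter_upwards [hl.eventually] with a ha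
    rw [cfc_add a f g hf.continuousOn hg.continuousOn]
    exact hadd a ha.1 f g hf hg
  refine ⟨m, ⟨?_, hsmul', ?_, ?_⟩, ?_⟩
  · intro r hr ε hε
    obtain ⟨δ, hδ, s, hs⟩ := (h r hr).eventually (half_pos hε)
    refine ⟨δ, hδ, s, fun x hx y hy hxsa hysa hxr hyr hxy => ?_⟩
    obtain ⟨l, hl⟩ := exists_isStrongApprox π hx hxsa hr hxr
    obtain ⟨k, hk⟩ := exists_isStrongApprox π hy hysa hr hyr
    have := hl.neBot
    have := hk.neBot
    have h2 : Tendsto (fun p : A × A => |μ p.1 - μ p.2|) (l ×ˢ k) (𝓝 |m x - m y|) :=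
      (((hm x hx hxsa _ _ hl).comp tendsto_fst).sub ((hm y hy hysa _ _ hk).comp tendsto_snd)).abs
    have h3 := le_of_tendsto h2 ((hs x y hxy l k hl hk).mono fun b hb => hb.le)
    linarith
  · intro x hx y hy hxsa hysa hxy
    exact map_add_of_mul_eq_zero (M := (· ∈ StarSubalgebra.centralizer ℂ (repCommutant π)))
      (fun _ hx _ f => cfc_mem_centralizer hx f) (fun _ _ => sub_mem) (fun _ _ => add_mem) hcfc
      hx hy hxsa hysa hxy
  · intro x hx hxsa t
    have h2 := hcfc x hx hxsa (fun s => s) (fun _ => t) continuous_id continuous_const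
    rw [cfc_id' ℝ x, cfc_const t x] at h2
    rw [← Algebra.algebraMap_eq_smul_one, h2, Algebra.algebraMap_eq_smul_one,
      hsmul' 1 (one_mem _) (.one _)]
  · intro a ha
    have hp : IsStrongApprox π (pure a) (π a) ‖a‖ :=
      ⟨inferInstance, by simpa using ha, fun ζ => tendsto_pure_nhds _ _⟩
    exact tendsto_nhds_unique (hm _ (map_mem_bicommutant π a) (ha.map π) _ _ hp)
      (tendsto_pure_nhds μ a)

end Extension

section Matrices
variable {H : Type*} [NormedAddCommGroup H] [InnerProductSpace ℂ H] [CompleteSpace H]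
variable {A : Type*} [CStarAlgebra A] {π : A →⋆ₐ[ℂ] (H →L[ℂ] H)}

/-- The restriction of a representation to a finite-dimensional invariant subspace. -/
noncomputable def restrictRep (π : A →⋆ₐ[ℂ] (H →L[ℂ] H)) (V : Submodule ℂ H)
    [FiniteDimensional ℂ V] (hV : ∀ a, ∀ v ∈ V, π a v ∈ V) : A →⋆ₐ[ℂ] (V →ₗ[ℂ] V) where
  toFun a := (π a).toLinearMap.restrict (hV a)
  map_one' := by ext; simp
  map_mul' a b := by ext; simp
  map_zero' := by ext; simp
  map_add' a b := by ext; simp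
  commutes' c := by ext; simp [Algebra.algebraMap_eq_smul_one]
  map_star' a := by
    rw [LinearMap.star_eq_adjoint, LinearMap.eq_adjoint_iff]
    intro v w
    change ⟪π (star a) (v : H), (w : H)⟫_ℂ = ⟪(v : H), π a (w : H)⟫_ℂ
    rw [map_star, ContinuousLinearMap.star_eq_adjoint, ContinuousLinearMap.adjoint_inner_left]

theorem restrictRep_surjective {V : Submodule ℂ H} [FiniteDimensional ℂ V]
    (hV : ∀ a, ∀ v ∈ V, π a v ∈ V)
    (h : ∀ T : V →ₗ[ℂ] V, ∃ T' ∈ StarSubalgebra.centralizer ℂ (repCommutant π),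
      ∀ v : V, T' v = T v) : Function.Surjective (restrictRep π V hV) := by
  intro T
  obtain ⟨T', hT', hTT⟩ := h T
  let b := Module.finBasis ℂ V
  let L : A →ₗ[ℂ] (Fin (Module.finrank ℂ V) → H) :=
    LinearMap.pi fun i => (ContinuousLinearMap.apply ℂ H ((b i : V) : H)).toLinearMap ∘ₗ
      π.toAlgHom.toLinearMap
  let K : (Fin (Module.finrank ℂ V) → V) →ₗ[ℂ] (Fin (Module.finrank ℂ V) → H) :=
    LinearMap.pi fun i => V.subtype ∘ₗ LinearMap.proj i
  have hLK : LinearMap.range L ≤ LinearMap.range K := by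
    rintro _ ⟨a, rfl⟩
    exact ⟨fun i => ⟨π a (b i : V), hV a _ (b i).2⟩, rfl⟩
  have : FiniteDimensional ℂ (LinearMap.range L) := Submodule.finiteDimensional_of_le hLK
  have hmem : (fun i => T' ((b i : V) : H)) ∈ closure (LinearMap.range L : Set (_ → H)) :=
    mem_closure_range_of_mem_bicommutant π hT' fun i => ((b i : V) : H)
  rw [(Submodule.closed_of_finiteDimensional (LinearMap.range L)).closure_eq] at hmem
  obtain ⟨a, ha⟩ := hmem
  refine ⟨a, b.ext fun i => Subtype.ext ?_⟩
  exact (congrFun ha i).trans (hTT (b i))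

theorem exists_surjective_matrix {e : H →L[ℂ] H} {ζ : H}
    (he : IsMinimalProjection (StarSubalgebra.centralizer ℂ (repCommutant π)) e)
    (heζ : e ζ = ζ) (hζ : ‖ζ‖ = 1) {n : ℕ} (hn : n ≠ 0)
    (hrank : Module.finrank ℂ (orbit (repCommutant π) ζ) = n) :
    ∃ φ : A →⋆ₐ[ℂ] Matrix (Fin n) (Fin n) ℂ, Function.Surjective φ := by
  let V := orbit (repCommutant π) ζ
  obtain ⟨Y, hY, hYζ, -⟩ : ∃ Y : V →ₗ[ℂ] (H →L[ℂ] H), IsCornerFrame (repCommutant π) e Y ∧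
    (∀ v, Y v ζ = v) ∧ _ := exists_cornerFrame he heζ hζ
  have : FiniteDimensional ℂ V := Module.finite_of_finrank_pos (by rw [show Module.finrank ℂ V = n from hrank]; omega)
  have hV : ∀ a, ∀ v ∈ V, π a v ∈ V := by
    intro a v hv
    obtain ⟨u, hu, rfl⟩ := mem_orbit.1 hv
    exact mem_orbit.2 ⟨π a * u, mul_mem (map_mem_bicommutant π a) hu, rfl⟩
  let κ := (stdOrthonormalBasis ℂ V).reindex (finCongr hrank)
  have hsurj : Function.Surjective (restrictRep π V hV) := by
    refine restrictRep_surjective hV fun T => ⟨∑ k, Y (T (κ k)) * star (Y (κ k)),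
      sum_mem fun k _ => mul_mem (hY.mem _) (star_mem (hY.mem _)), fun v => ?_⟩
    have h1 : ∀ w : V, star (Y w) v = ⟪w, v⟫_ℂ • ζ := by
      intro w
      have := congrArg (fun Q : H →L[ℂ] H => Q ζ) (hY.star_mul w v)
      simpa only [mul_apply_eq_comp, hYζ, smul_apply, heζ] using this
    simp only [sum_apply, mul_apply_eq_comp, h1, map_smul, hYζ]
    conv_rhs => rw [← κ.sum_repr' v, map_sum]
    simp
  refine ⟨((LinearMap.toMatrixOrthonormal κ : (V →ₗ[ℂ] V) →⋆ₐ[ℂ] Matrix (Fin n) (Fin n) ℂ)).comp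
    (restrictRep π V hV), ?_⟩
  exact (LinearMap.toMatrixOrthonormal κ).surjective.comp hsurj

end Matrices

section Main
open Filter Topology

theorem cfc_mem_closure_aeval {A : Type*} [CStarAlgebra A] {a : A} (ha : IsSelfAdjoint a)
    {f : ℝ → ℝ} (hf : Continuous f) :
    cfc f a ∈ closure {y : A | ∃ q : Polynomial ℝ, q.coeff 0 = 0 ∧
      Polynomial.aeval (a + algebraMap ℝ A (‖a‖ + 1)) q = y} := by
  let F : ℝ → ℝ := fun t => f (t - (‖a‖ + 1)) * min (max t 0) 1
  have hF : Continuous F := by fun_prop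
  have hF0 : F 0 = 0 := by simp [F]
  have hc : IsSelfAdjoint (a + algebraMap ℝ A (‖a‖ + 1)) :=
    ha.add ((IsSelfAdjoint.all _).algebraMap A)
  have e : cfc f a = cfc F (a + algebraMap ℝ A (‖a‖ + 1)) := by
    have e1 : a + algebraMap ℝ A (‖a‖ + 1) = cfc (fun t : ℝ => t + (‖a‖ + 1)) a := by
      rw [cfc_add_const (‖a‖ + 1) (fun t => t) a continuousOn_id, cfc_id' ℝ a]
    have hsh : Continuous fun t : ℝ => t + (‖a‖ + 1) := by fun_prop
    rw [e1, ← cfc_comp' F (fun t : ℝ => t + (‖a‖ + 1)) a hF.continuousOn hsh.continuousOn]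
    refine cfc_congr fun t ht => ?_
    have hta : |t| ≤ ‖a‖ := by
      rcases subsingleton_or_nontrivial A with hA | hA
      · simp [spectrum.of_subsingleton] at ht
      · exact spectrum.norm_le_norm_of_mem ht
    have h1 : 1 ≤ t + (‖a‖ + 1) := by linarith [(abs_le.1 hta).1]
    simp [F, max_eq_left (zero_le_one.trans h1), min_eq_right h1]
  obtain ⟨p, hp0, hp⟩ := exists_tendsto_aeval (B := A) hF hF0 ‖a + algebraMap ℝ A (‖a‖ + 1)‖
  rw [e]
  exact mem_closure_of_tendsto (hp _ hc le_rfl) (Eventually.of_forall fun n => ⟨p n, hp0 n, rfl⟩)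

/-- Countably many functionals suffice for uniform weak continuity, so that a single vector
implements them. -/
theorem exists_isUniformlyWeak.{u} {A : Type u} [CStarAlgebra A] {μ : A → ℝ}
    (h : ∀ ε > (0 : ℝ), ∃ δ > (0 : ℝ), ∃ (m : ℕ) (f : Fin m → (A →L[ℝ] ℝ)),
      ∀ a b : A, star a = a → star b = b → ‖a‖ ≤ 1 → ‖b‖ ≤ 1 →
        (∀ i, |f i a - f i b| < δ) → |μ a - μ b| < ε) :
    ∃ (H : Type u) (_ : NormedAddCommGroup H) (_ : InnerProductSpace ℂ H) (_ : CompleteSpace H)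
      (π : A →⋆ₐ[ℂ] (H →L[ℂ] H)) (ξ : H), IsUniformlyWeak π ξ μ 1 := by
  choose δ hδ m f hf using fun k : ℕ => h (1 / ((k : ℝ) + 1)) (by positivity)
  let F : ℕ → (A →L[ℝ] ℝ) := fun n =>
    ((Encodable.decode n : Option (Σ k, Fin (m k))).map fun p => f p.1 p.2).getD 0
  have hF : ∀ k i, F (Encodable.encode (⟨k, i⟩ : Σ k, Fin (m k))) = f k i := by
    intro k i
    simp only [F, Encodable.encodek, Option.map_some, Option.getD_some]
  obtain ⟨H, i1, i2, i3, π, ξ, hrep⟩ := exists_representation F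
  refine ⟨H, i1, i2, i3, π, ξ, fun ε hε => ?_⟩
  choose η hη using hrep
  obtain ⟨k, hk⟩ := exists_nat_one_div_lt hε
  classical
  refine ⟨δ k, hδ k, Finset.univ.image fun i : Fin (m k) =>
    η (Encodable.encode (⟨k, i⟩ : Σ k, Fin (m k))), fun a b ha hb ha1 hb1 hab => ?_⟩
  refine (hf k a b ha hb ha1 hb1 fun i => ?_).trans hk
  rw [← hF, hη _ a ha, hη _ b hb, ← Complex.sub_re, ← inner_sub_right]
  exact (Complex.abs_re_le_norm _).trans_lt (hab _ (Finset.mem_image_of_mem _ (Finset.mem_univ i)))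

/-- A function on the self-adjoint part which is additive, homogeneous and bounded on the unit
ball extends to a bounded functional. -/
theorem exists_continuousLinearMap_of_selfAdjoint {A : Type*} [CStarAlgebra A] {μ : A → ℝ}
    (hbdd : ∃ C : ℝ, ∀ a : A, star a = a → ‖a‖ ≤ 1 → |μ a| ≤ C)
    (hadd : ∀ a b : A, IsSelfAdjoint a → IsSelfAdjoint b → μ (a + b) = μ a + μ b)
    (hsmul : ∀ a, IsSelfAdjoint a → ∀ t : ℝ, μ (t • a) = t * μ a) :
    ∃ φ : A →L[ℝ] ℝ, ∀ a : A, star a = a → φ a = μ a := by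
  obtain ⟨C, hC⟩ := hbdd
  have hC0 : 0 ≤ C := (abs_nonneg _).trans (hC 0 (star_zero A) (by simp))
  let φ : A →ₗ[ℝ] ℝ :=
    { toFun := fun a => μ (ℜ a : A)
      map_add' := fun a b => by
        rw [map_add, AddSubgroup.coe_add]; exact hadd _ _ (ℜ a).2 (ℜ b).2
      map_smul' := fun t a => by
        rw [map_smul, selfAdjoint.val_smul]; exact hsmul _ (ℜ a).2 t }
  refine ⟨φ.mkContinuous C fun a => ?_, fun a ha => ?_⟩
  · change |μ (ℜ a : A)| ≤ C * ‖a‖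
    have hle : ‖(ℜ a : A)‖ ≤ ‖a‖ := realPart.norm_le a
    refine le_trans ?_ (mul_le_mul_of_nonneg_left hle hC0)
    have hsa : IsSelfAdjoint (ℜ a : A) := (ℜ a).2
    rcases eq_or_ne ‖(ℜ a : A)‖ 0 with h0 | h0
    · rw [norm_eq_zero.1 h0]
      have := hsmul 0 (.zero A) 0
      rw [zero_smul, zero_mul] at this
      simp [this]
    · have h1 := hC (‖(ℜ a : A)‖⁻¹ • (ℜ a : A)) ((IsSelfAdjoint.all _).smul hsa) (by
        rw [norm_smul, norm_inv, norm_norm, inv_mul_cancel₀ h0])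
      rw [hsmul _ hsa, abs_mul, abs_inv, abs_norm, inv_mul_eq_div,
        div_le_iff₀ (lt_of_le_of_ne (norm_nonneg _) h0.symm)] at h1
      exact h1
  · change μ (ℜ a : A) = μ a
    rw [IsSelfAdjoint.coe_realPart ha]

/-- Let `A` be a unital C*-algebra admitting no surjective *-algebra
homomorphism onto `M₂(ℂ)`. Let `μ : A → ℝ` be bounded on the self-adjoint part of the
closed unit ball and, for every self-adjoint `a`, linear (additive and `ℝ`-homogeneous) on
the norm closure of the non-unital subalgebra generated by `a`. Then `μ` agrees with a
bounded `ℝ`-linear functional on the self-adjoint elements if and only if `μ` is uniformly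
weakly continuous on the self-adjoint part of the closed unit ball. -/
theorem stmt_10 (A : Type*) [CStarAlgebra A]
    (hS2 : ¬∃ φ : A →⋆ₐ[ℂ] Matrix (Fin 2) (Fin 2) ℂ, Function.Surjective φ)
    (μ : A → ℝ)
    (hbdd : ∃ C : ℝ, ∀ a : A, star a = a → ‖a‖ ≤ 1 → |μ a| ≤ C)
    (hloc : ∀ a : A, star a = a →
      (∀ y ∈ closure {y : A | ∃ q : Polynomial ℝ, q.coeff 0 = 0 ∧ Polynomial.aeval a q = y},
       ∀ z ∈ closure {y : A | ∃ q : Polynomial ℝ, q.coeff 0 = 0 ∧ Polynomial.aeval a q = y},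
        μ (y + z) = μ y + μ z) ∧
      (∀ y ∈ closure {y : A | ∃ q : Polynomial ℝ, q.coeff 0 = 0 ∧ Polynomial.aeval a q = y},
       ∀ t : ℝ, μ (t • y) = t * μ y)) :
    (∃ φ : A →L[ℝ] ℝ, ∀ a : A, star a = a → φ a = μ a) ↔
    (∀ ε > (0 : ℝ), ∃ δ > (0 : ℝ), ∃ (m : ℕ) (f : Fin m → (A →L[ℝ] ℝ)),
      ∀ a b : A, star a = a → star b = b → ‖a‖ ≤ 1 → ‖b‖ ≤ 1 →
        (∀ i, |f i a - f i b| < δ) → |μ a - μ b| < ε) := by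
  constructor
  · rintro ⟨φ, hφ⟩ ε hε
    refine ⟨ε, hε, 1, fun _ => φ, fun a b ha hb _ _ hab => ?_⟩
    rw [← hφ a ha, ← hφ b hb]
    exact hab 0
  · intro h
    have hsmul : ∀ a, IsSelfAdjoint a → ∀ t : ℝ, μ (t • a) = t * μ a := fun a ha =>
      (hloc a ha).2 a (subset_closure ⟨Polynomial.X, by simp⟩)
    have hadd : ∀ a, IsSelfAdjoint a → ∀ f g : ℝ → ℝ, Continuous f → Continuous g →
        μ (cfc f a + cfc g a) = μ (cfc f a) + μ (cfc g a) := fun a ha f g hf hg =>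
      (hloc _ (ha.add ((IsSelfAdjoint.all (‖a‖ + 1)).algebraMap A)).star_eq).1
        _ (cfc_mem_closure_aeval ha hf) _ (cfc_mem_closure_aeval ha hg)
    obtain ⟨H, _, _, _, π, ξ, hπ⟩ := exists_isUniformlyWeak h
    obtain ⟨m, hm, hmμ⟩ := exists_isLocallyLinear hπ hsmul hadd
    refine exists_continuousLinearMap_of_selfAdjoint hbdd (fun a b ha hb => ?_) hsmul
    rw [← hmμ a ha, ← hmμ b hb, ← hmμ _ (ha.add hb), map_add]
    exact hm.add (fun e he ζ heζ hζ hrank => hS2 (exists_surjective_matrix he heζ hζ two_ne_zero hrank))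
      (map_mem_bicommutant π a) (map_mem_bicommutant π b) (ha.map π) (hb.map π)

end Main
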